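/- Let Ω ⊆ ℝ^N be a domain with nonempty boundary Γ and let 1 < p < ∞. Let u be a bounded viscosity solution of problem (P) in Ω and let u_B be a bounded viscosity solution of problem (P) in the open unit ball B centered at the origin of ℝ^N. Then u(x,t) ≤ u_B(0, t/d_Γ(x)²) for every (x,t) ∈ Ω×(0,∞). -/

import Mathlib

open MeasureTheory Metric Set Filter
open scoped Topology ENNReal NNReal Real Classical

noncomputable section

/-- The Hessian matrix of a real-valued function, via the second iterated Fréchet derivative. -/
noncomputable def hess {N : ℕ} (f : EuclideanSpace ℝ (Fin N) → ℝ) (x : EuclideanSpace ℝ (Fin N)) :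
    Matrix (Fin N) (Fin N) ℝ :=
  fun i j => iteratedFDeriv ℝ 2 f x ![EuclideanSpace.single i 1, EuclideanSpace.single j 1]

/-- The quadratic form ⟨Xv, v⟩ associated to a matrix. -/
noncomputable def qform {N : ℕ} (X : Matrix (Fin N) (Fin N) ℝ) (v : EuclideanSpace ℝ (Fin N)) : ℝ :=
  ∑ i, ∑ j, X i j * v j * v i

/-- Smallest eigenvalue (via the Rayleigh quotient) of a symmetric matrix. -/
noncomputable def lamMin {N : ℕ} (X : Matrix (Fin N) (Fin N) ℝ) : ℝ :=
  sInf {r | ∃ v : EuclideanSpace ℝ (Fin N), ‖v‖ = 1 ∧ r = qform X v}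

/-- Largest eigenvalue (via the Rayleigh quotient) of a symmetric matrix. -/
noncomputable def lamMax {N : ℕ} (X : Matrix (Fin N) (Fin N) ℝ) : ℝ :=
  sSup {r | ∃ v : EuclideanSpace ℝ (Fin N), ‖v‖ = 1 ∧ r = qform X v}

/-- F(ξ, X) = (1/p)[tr X + (p−2)⟨Xξ,ξ⟩/|ξ|²]. -/
noncomputable def Fop {N : ℕ} (p : ℝ) (ξ : EuclideanSpace ℝ (Fin N))
    (X : Matrix (Fin N) (Fin N) ℝ) : ℝ :=
  (1/p) * (Matrix.trace X + (p - 2) * qform X ξ / ‖ξ‖^2)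

/-- Lower semicontinuous relaxation F_*. -/
noncomputable def Flower {N : ℕ} (p : ℝ) (ξ : EuclideanSpace ℝ (Fin N))
    (X : Matrix (Fin N) (Fin N) ℝ) : ℝ :=
  if ξ = 0 then
    (1/p) * (Matrix.trace X + max (p - 2) 0 * lamMin X + min (p - 2) 0 * lamMax X)
  else Fop p ξ X

/-- Upper semicontinuous relaxation F^*. -/
noncomputable def Fupper {N : ℕ} (p : ℝ) (ξ : EuclideanSpace ℝ (Fin N))
    (X : Matrix (Fin N) (Fin N) ℝ) : ℝ :=
  if ξ = 0 then
    (1/p) * (Matrix.trace X + min (p - 2) 0 * lamMin X + max (p - 2) 0 * lamMax X)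
  else Fop p ξ X

/-- Viscosity solution of `u_t = Δ_p^G u` in `Ω × (0,∞)`. -/
def IsViscositySol {N : ℕ} (p : ℝ) (Ω : Set (EuclideanSpace ℝ (Fin N)))
    (u : EuclideanSpace ℝ (Fin N) → ℝ → ℝ) : Prop :=
  ContinuousOn (fun q : EuclideanSpace ℝ (Fin N) × ℝ => u q.1 q.2) (Ω ×ˢ Set.Ioi 0) ∧
  (∀ φ : EuclideanSpace ℝ (Fin N) × ℝ → ℝ, ContDiff ℝ 2 φ →
    ∀ x ∈ Ω, ∀ t ∈ Set.Ioi (0:ℝ),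
      IsLocalMaxOn (fun q : EuclideanSpace ℝ (Fin N) × ℝ => u q.1 q.2 - φ q)
        (Ω ×ˢ Set.Ioi 0) (x, t) →
      deriv (fun s => φ (x, s)) t ≤
        Fupper p (gradient (fun y => φ (y, t)) x) (hess (fun y => φ (y, t)) x)) ∧
  (∀ φ : EuclideanSpace ℝ (Fin N) × ℝ → ℝ, ContDiff ℝ 2 φ →
    ∀ x ∈ Ω, ∀ t ∈ Set.Ioi (0:ℝ),
      IsLocalMinOn (fun q : EuclideanSpace ℝ (Fin N) × ℝ => u q.1 q.2 - φ q)
        (Ω ×ˢ Set.Ioi 0) (x, t) →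
      Flower p (gradient (fun y => φ (y, t)) x) (hess (fun y => φ (y, t)) x) ≤
        deriv (fun s => φ (x, s)) t)

/-- Bounded (viscosity) solution of problem (P): `u_t = Δ_p^G u` in `Ω × (0,∞)`,
`u = 0` on `Ω × {0}`, `u = 1` on `Γ × (0,∞)`; continuous away from `Γ × {0}`. -/
def IsSolP {N : ℕ} (p : ℝ) (Ω : Set (EuclideanSpace ℝ (Fin N)))
    (u : EuclideanSpace ℝ (Fin N) → ℝ → ℝ) : Prop :=
  (∃ M : ℝ, ∀ x ∈ closure Ω, ∀ t : ℝ, 0 ≤ t → |u x t| ≤ M) ∧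
  (∀ x ∈ closure Ω, ∀ t : ℝ, 0 ≤ t → ¬(x ∈ frontier Ω ∧ t = 0) →
    ContinuousWithinAt (fun q : EuclideanSpace ℝ (Fin N) × ℝ => u q.1 q.2)
      (closure Ω ×ˢ Set.Ici 0) (x, t)) ∧
  IsViscositySol p Ω u ∧
  (∀ x ∈ Ω, u x 0 = 0) ∧
  (∀ y ∈ frontier Ω, ∀ t : ℝ, 0 < t → u y t = 1)

/-- Viscosity solution of the elliptic equation `u − ε² Δ_p^G u = 0` in `Ω`. -/
def IsEllipticViscositySol {N : ℕ} (p ε : ℝ) (Ω : Set (EuclideanSpace ℝ (Fin N)))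
    (u : EuclideanSpace ℝ (Fin N) → ℝ) : Prop :=
  ContinuousOn u Ω ∧
  (∀ φ : EuclideanSpace ℝ (Fin N) → ℝ, ContDiff ℝ 2 φ → ∀ x ∈ Ω,
      IsLocalMaxOn (fun y => u y - φ y) Ω x →
      φ x - ε^2 * Fupper p (gradient φ x) (hess φ x) ≤ 0) ∧
  (∀ φ : EuclideanSpace ℝ (Fin N) → ℝ, ContDiff ℝ 2 φ → ∀ x ∈ Ω,
      IsLocalMinOn (fun y => u y - φ y) Ω x →
      0 ≤ φ x - ε^2 * Flower p (gradient φ x) (hess φ x))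

/-- The complementary error function. -/
noncomputable def Erfc (σ : ℝ) : ℝ := (2 / Real.sqrt π) * ∫ τ in Set.Ioi σ, Real.exp (-τ^2)

/-- The explicit radially symmetric solution `u^ε` of the elliptic problem in the ball `B_R`. -/
noncomputable def uEps (N : ℕ) (p R ε : ℝ) (x : EuclideanSpace ℝ (Fin N)) : ℝ :=
  (∫ θ in (0:ℝ)..π,
      Real.exp (Real.sqrt (p/(p-1)) * (‖x‖/ε) * Real.cos θ) * (Real.sin θ) ^ (((N:ℝ) - p)/(p-1))) /
  (∫ θ in (0:ℝ)..π,
      Real.exp (Real.sqrt (p/(p-1)) * (R/ε) * Real.cos θ) * (Real.sin θ) ^ (((N:ℝ) - p)/(p-1)))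

local notation "⟪" x ", " y "⟫" => inner ℝ x y

/-- A point where a Lipschitz `P`, inverting the maximizer correspondence of the linear
perturbations of `Θ`, has a nonpositive derivative. -/
theorem exists_maximizer_hasFDerivAt_nonpos {V : Type*} [NormedAddCommGroup V]
    [InnerProductSpace ℝ V] [FiniteDimensional ℝ V] {Θ : V → ℝ} (hΘ : Continuous Θ)
    {P : V → V} {K : ℝ≥0} (hP : LipschitzWith K P) {r R : ℝ} (hr : 0 < r)
    (hex : ∀ q ∈ ball (0 : V) r, ∃ z, ∀ y, Θ y - ⟪q, y⟫ ≤ Θ z - ⟪q, z⟫)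
    (hb : ∀ q ∈ ball (0 : V) r, ∀ z, (∀ y, Θ y - ⟪q, y⟫ ≤ Θ z - ⟪q, z⟫) → ‖z‖ ≤ R ∧ P z = q) :
    ∃ q ∈ ball (0 : V) r, ∃ z, (∀ y, Θ y - ⟪q, y⟫ ≤ Θ z - ⟪q, z⟫) ∧
      ∃ B : V →L[ℝ] V, HasFDerivAt P B z ∧ ∀ v, ⟪B v, v⟫ ≤ 0 := by
  let _ : MeasurableSpace V := borel V
  have _ : BorelSpace V := ⟨rfl⟩
  let μ : Measure V := μH[Module.finrank ℝ V]
  choose! g hg using hex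
  let m : V → ℝ := fun q => Θ (g q) - ⟪q, g q⟫
  have hm : ∀ q ∈ ball (0 : V) r, ∀ z, (∀ y, Θ y - ⟪q, y⟫ ≤ Θ z - ⟪q, z⟫) →
      ∀ q' ∈ ball (0 : V) r, m q - ⟪q' - q, z⟫ ≤ m q' := by
    intro q hq z hz q' hq'
    have h1 := hz (g q)
    have h2 := hg q' hq' z
    simp only [m, inner_sub_left]
    linarith
  have hmlip : LipschitzOnWith R.toNNReal m (ball 0 r) := by
    apply LipschitzOnWith.of_le_add_mul
    intro q hq q' hq'
    have h := hm q hq (g q) (hg q hq) q' hq'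
    have h1 := (hb q hq (g q) (hg q hq)).1
    have h2 : ⟪q' - q, g q⟫ ≤ R * dist q q' := by
      calc ⟪q' - q, g q⟫ ≤ ‖q' - q‖ * ‖g q‖ := real_inner_le_norm _ _
        _ ≤ ‖q' - q‖ * R := by gcongr
        _ = R * dist q q' := by rw [dist_comm, dist_eq_norm, mul_comm]
    have hR : 0 ≤ R := (norm_nonneg _).trans h1
    rw [Real.coe_toNNReal _ hR]
    linarith
  have h1 : ∀ᵐ q ∂μ, q ∈ ball (0 : V) r → DifferentiableWithinAt ℝ m (ball 0 r) q :=
    hmlip.ae_differentiableWithinAt_of_mem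
  have h2 : ∀ᵐ q ∂μ, q ∉ P '' {z | ¬ DifferentiableAt ℝ P z} := by
    have h0 : μ {z | ¬ DifferentiableAt ℝ P z} = 0 := hP.ae_differentiableAt (μ := μ)
    have h3 : μ (P '' {z | ¬ DifferentiableAt ℝ P z}) = 0 := by
      have := hP.hausdorffMeasure_image_le (d := Module.finrank ℝ V) (by positivity)
        {z | ¬ DifferentiableAt ℝ P z}
      change μ _ ≤ _ * μ _ at this
      rw [h0, mul_zero] at this
      exact le_antisymm this bot_le
    exact measure_eq_zero_iff_ae_notMem.1 h3
  have h3 : ∀ᵐ q ∂μ, q ∉ P '' {z | DifferentiableAt ℝ P z ∧ (fderiv ℝ P z).det = 0} := by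
    refine measure_eq_zero_iff_ae_notMem.1 ?_
    exact addHaar_image_eq_zero_of_det_fderivWithin_eq_zero μ
      (fun x hx => hx.1.hasFDerivAt.hasFDerivWithinAt) (fun x hx => hx.2)
  obtain ⟨q, hq, hq1, hq2, hq3⟩ : ∃ q ∈ ball (0 : V) r,
      DifferentiableWithinAt ℝ m (ball 0 r) q ∧ q ∉ P '' {z | ¬ DifferentiableAt ℝ P z} ∧
      q ∉ P '' {z | DifferentiableAt ℝ P z ∧ (fderiv ℝ P z).det = 0} := by
    have hpos : μ (ball (0 : V) r) ≠ 0 := (measure_ball_pos μ 0 hr).ne'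
    by_contra! hcon
    refine hpos (measure_eq_zero_iff_ae_notMem.2 ?_)
    filter_upwards [h1, h2, h3] with q h1 h2 h3 hq
    exact h3 (hcon q hq (h1 hq) h2)
  have hnhds : ball (0 : V) r ∈ 𝓝 q := isOpen_ball.mem_nhds hq
  have hmd : DifferentiableAt ℝ m q := hq1.differentiableAt hnhds
  have huniq : ∀ z, (∀ y, Θ y - ⟪q, y⟫ ≤ Θ z - ⟪q, z⟫) → z = g q := by
    have key : ∀ z, (∀ y, Θ y - ⟪q, y⟫ ≤ Θ z - ⟪q, z⟫) → ∀ v, fderiv ℝ m q v = - ⟪v, z⟫ := by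
      intro z hz v
      have hmin : IsLocalMin (fun q' => m q' + ⟪q' - q, z⟫) q := by
        filter_upwards [hnhds] with q' hq'
        have := hm q hq z hz q' hq'
        simp only [sub_self, inner_zero_left, add_zero]
        linarith
      have hd : HasFDerivAt (fun q' => m q' + ⟪q' - q, z⟫)
          (fderiv ℝ m q + (innerSL ℝ z)) q := by
        refine hmd.hasFDerivAt.add ?_
        have : HasFDerivAt (fun q' => innerSL ℝ z (q' - q)) ((innerSL ℝ z).comp
          (ContinuousLinearMap.id ℝ V)) q :=
          (innerSL ℝ z).hasFDerivAt.comp q ((hasFDerivAt_id q).sub_const q)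
        simpa [real_inner_comm] using this
      have h0 := hmin.hasFDerivAt_eq_zero hd
      have := congrArg (fun l => l v) h0
      simp only [add_apply, innerSL_apply_apply,
        zero_apply] at this
      rw [real_inner_comm z v]
      linarith
    intro z hz
    refine ext_inner_left ℝ fun v => ?_
    have e1 := key z hz v
    have e2 := key (g q) (hg q hq) v
    linarith
  have hcont : ContinuousAt g q := by
    refine (isCompact_closedBall (0 : V) R).tendsto_nhds_of_unique_mapClusterPt ?_ ?_
    · filter_upwards [hnhds] with q' hq'
      simpa using (hb q' hq' _ (hg q' hq')).1
    · intro z _ hz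
      obtain ⟨U, hU, hUz⟩ := mapClusterPt_iff_ultrafilter.1 hz
      refine huniq z fun y => ?_
      have hUq : Tendsto (fun q' : V => q') U (𝓝 q) := hU
      refine le_of_tendsto_of_tendsto (tendsto_const_nhds.sub (hUq.inner tendsto_const_nhds))
        (((hΘ.tendsto z).comp hUz).sub (hUq.inner hUz)) ?_
      filter_upwards [hU hnhds] with q' hq'
      exact hg q' hq' y
  have hPg : ∀ q' ∈ ball (0 : V) r, P (g q') = q' := fun q' hq' => (hb q' hq' _ (hg q' hq')).2
  have hPd : DifferentiableAt ℝ P (g q) := by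
    by_contra h
    exact hq2 ⟨g q, h, hPg q hq⟩
  have hdet : (fderiv ℝ P (g q)).det ≠ 0 := fun h => hq3 ⟨g q, ⟨hPd, h⟩, hPg q hq⟩
  refine ⟨q, hq, g q, hg q hq, fderiv ℝ P (g q), hPd.hasFDerivAt, fun v => ?_⟩
  let B' : V ≃L[ℝ] V := (fderiv ℝ P (g q)).toContinuousLinearEquivOfDetNeZero hdet
  have hB' : ∀ w, B' w = fderiv ℝ P (g q) w := fun w => rfl
  have hgd : HasFDerivAt g (B'.symm : V →L[ℝ] V) q := by
    refine HasFDerivAt.of_local_left_inverse hcont ?_ ?_ (f := P)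
    · exact hPd.hasFDerivAt
    · filter_upwards [hnhds] with q' hq' using hPg q' hq'
  rw [← hB']
  have hline : HasDerivAt (fun t : ℝ => ⟪B' v, g (q + t • B' v)⟫) ⟪B' v, v⟫ 0 := by
    have hl : HasDerivAt (fun t : ℝ => q + t • B' v) (B' v) 0 := by
      simpa using ((hasDerivAt_id (0 : ℝ)).smul_const (B' v)).const_add q
    have hgd' : HasFDerivAt g (B'.symm : V →L[ℝ] V) (q + (0 : ℝ) • B' v) := by simpa using hgd
    have h4 := hgd'.comp_hasDerivAt (0 : ℝ) hl
    have h5 := (innerSL ℝ (B' v)).hasFDerivAt.comp_hasDerivAt (0 : ℝ) h4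
    simpa [Function.comp_def] using h5
  refine le_of_tendsto hline.tendsto_slope_zero_right ?_
  have hev : ∀ᶠ t : ℝ in 𝓝[>] 0, q + t • B' v ∈ ball (0 : V) r := by
    have : Tendsto (fun t : ℝ => q + t • B' v) (𝓝 0) (𝓝 q) := by
      have hc : Continuous (fun t : ℝ => q + t • B' v) := by fun_prop
      simpa using hc.tendsto 0
    exact (this.mono_left nhdsWithin_le_nhds) hnhds
  filter_upwards [hev, self_mem_nhdsWithin] with t ht ht0
  have ht0 : 0 < t := ht0
  have e1 := hg q hq (g (q + t • B' v))
  have e2 := hg _ ht (g q)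
  have e3 : t * ⟪B' v, g (q + t • B' v)⟫ ≤ t * ⟪B' v, g q⟫ := by
    simp only [inner_add_left, real_inner_smul_left] at e1 e2
    linarith
  have e4 := le_of_mul_le_mul_left e3 ht0
  simp only [zero_add, zero_smul, add_zero, smul_eq_mul]
  have : 0 ≤ t⁻¹ := by positivity
  nlinarith

section Regularization

variable {H : Type*} [NormedAddCommGroup H]

theorem norm_add_sq_div_add_le (x y : H) {α β : ℝ} (hα : 0 < α) (hβ : 0 < β) :
    ‖x + y‖ ^ 2 / (α + β) ≤ ‖x‖ ^ 2 / α + ‖y‖ ^ 2 / β := by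
  have h1 : ‖x + y‖ ^ 2 ≤ (‖x‖ + ‖y‖) ^ 2 := by
    gcongr
    exact norm_add_le x y
  have h2 : (‖x‖ + ‖y‖) ^ 2 / (α + β) ≤ ‖x‖ ^ 2 / α + ‖y‖ ^ 2 / β := by
    rw [div_add_div _ _ hα.ne' hβ.ne', div_le_div_iff₀ (by positivity) (by positivity)]
    nlinarith [sq_nonneg (β * ‖x‖ - α * ‖y‖)]
  exact (div_le_div_of_nonneg_right h1 (by positivity)).trans h2

/-- The quadratic sup-convolution over a compact set. -/
theorem exists_supConvolution {f : H → ℝ} {B : Set H} (hB : IsCompact B) (hne : B.Nonempty)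
    (hf : ContinuousOn f B) (ε : ℝ) :
    ∃ g : H → ℝ, Continuous g ∧ (∀ a, ∃ y ∈ B, g a = f y - ‖a - y‖ ^ 2 / (2 * ε)) ∧
      ∀ a, ∀ y ∈ B, f y - ‖a - y‖ ^ 2 / (2 * ε) ≤ g a := by
  have hcs : CompactSpace B := isCompact_iff_compactSpace.1 hB
  have hns : Nonempty B := hne.to_subtype
  let F : H → B → ℝ := fun a y => f y - ‖a - y‖ ^ 2 / (2 * ε)
  have hF : Continuous (fun q : H × B => F q.1 q.2) := by
    have h1 : Continuous (fun q : H × B => f q.2) :=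
      (continuousOn_iff_continuous_domRestrict.1 hf).comp continuous_snd
    have h2 : Continuous (fun q : H × B => ‖q.1 - (q.2 : H)‖ ^ 2 / (2 * ε)) := by fun_prop
    exact h1.sub h2
  have hmax : ∀ a, ∃ y : B, ∀ y', F a y' ≤ F a y := fun a => by
    have hc : Continuous (F a) := hF.comp (by fun_prop : Continuous fun y : B => (a, y))
    obtain ⟨y, -, hy⟩ := isCompact_univ.exists_isMaxOn univ_nonempty hc.continuousOn
    exact ⟨y, fun y' => hy (mem_univ y')⟩
  have hsup : ∀ a (y : B), (∀ y', F a y' ≤ F a y) → sSup (F a '' univ) = F a y := by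
    intro a y hy
    refine IsGreatest.csSup_eq ⟨⟨y, mem_univ _, rfl⟩, ?_⟩
    rintro _ ⟨y', -, rfl⟩
    exact hy y'
  refine ⟨fun a => sSup (F a '' univ), isCompact_univ.continuous_sSup hF, fun a => ?_,
    fun a y hy => ?_⟩
  · obtain ⟨y, hy⟩ := hmax a
    exact ⟨y, y.2, hsup a y hy⟩
  · obtain ⟨y', hy'⟩ := hmax a
    simp only [hsup a y' hy']
    exact hy' ⟨y, hy⟩

variable [InnerProductSpace ℝ H]

/-- A function with two-sided quadratic bounds on its first order expansions has a Lipschitz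
gradient. -/
theorem lipschitzWith_of_abs_sub_sub_inner_le {G : H → ℝ} {s : H → H} {C : ℝ≥0}
    (h : ∀ a a', |G a' - G a - ⟪s a, a' - a⟫| ≤ C * ‖a' - a‖ ^ 2) : LipschitzWith (6 * C) s := by
  refine LipschitzWith.of_dist_le_mul fun a b => ?_
  rw [dist_comm, dist_comm a b, dist_eq_norm, dist_eq_norm]
  set r := ‖b - a‖ with hr
  by_cases hs : s b - s a = 0
  · rw [hs, norm_zero]; positivity
  have hs0 : 0 < ‖s b - s a‖ := norm_pos_iff.2 hs
  by_cases hr0 : r = 0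
  · have : b = a := by rwa [hr, norm_eq_zero, sub_eq_zero] at hr0
    simp [this] at hs
  have hr0 : 0 < r := lt_of_le_of_ne (norm_nonneg _) (Ne.symm hr0)
  set w : H := (r / ‖s b - s a‖) • (s b - s a) with hw
  have hwn : ‖w‖ = r := by
    rw [hw, norm_smul, Real.norm_of_nonneg (by positivity)]
    field_simp
  have hwi : ⟪s b, w⟫ - ⟪s a, w⟫ = r * ‖s b - s a‖ := by
    rw [← inner_sub_left, hw, real_inner_smul_right, real_inner_self_eq_norm_sq]
    field_simp
  have e1 := abs_le.1 (h a (b + w))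
  have e2 := abs_le.1 (h a b)
  have e3 := abs_le.1 (h b (b + w))
  have hn : ‖b + w - a‖ ^ 2 ≤ (2 * r) ^ 2 := by
    gcongr
    calc ‖b + w - a‖ = ‖(b - a) + w‖ := by congr 1; abel
      _ ≤ ‖b - a‖ + ‖w‖ := norm_add_le _ _
      _ = 2 * r := by rw [hwn]; ring
  have hC : (C : ℝ) * ‖b + w - a‖ ^ 2 ≤ C * (2 * r) ^ 2 := by gcongr
  have hi : ⟪s a, b + w - a⟫ = ⟪s a, b - a⟫ + ⟪s a, w⟫ := by
    rw [← inner_add_right]; congr 1; abel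
  rw [add_sub_cancel_left, hwn] at e3
  rw [hi] at e1
  have : r * ‖s b - s a‖ ≤ r * (6 * C * r) := by
    rw [← hwi]
    nlinarith [e1.1, e1.2, e2.1, e2.2, e3.1, e3.2]
  push_cast
  exact le_of_mul_le_mul_left this hr0

variable [FiniteDimensional ℝ H]

/-- Sup-convolution `g` of `f` on a compact set together with a `C^{1,1}` majorant `G`, with
gradient `s`, which touches `g` at each point where `g` is touched from above by a paraboloid of
opening `1 / δ`. -/
theorem exists_supConvolution_majorant {f : H → ℝ} {B : Set H} (hB : IsCompact B)
    (hne : B.Nonempty) (hf : ContinuousOn f B) {ε δ : ℝ} (hε : 0 < ε) (hδ : 0 < δ) :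
    ∃ (g G : H → ℝ) (s : H → H) (C : ℝ≥0), Continuous g ∧
      (∀ a, ∃ y ∈ B, g a = f y - ‖a - y‖ ^ 2 / (2 * ε)) ∧
      (∀ a, ∀ y ∈ B, f y - ‖a - y‖ ^ 2 / (2 * ε) ≤ g a) ∧
      (∀ a, g a ≤ G a) ∧
      (∀ a a', |G a' - G a - ⟪s a, a' - a⟫| ≤ C * ‖a' - a‖ ^ 2) ∧
      (∀ a s₀, (∀ a', g a' ≤ g a + ⟪s₀, a' - a⟫ + ‖a' - a‖ ^ 2 / (2 * δ)) →
        G a = g a ∧ s a = s₀) := by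
  obtain ⟨g, hgc, hg1, hg2⟩ := exists_supConvolution hB hne hf ε
  obtain ⟨k, hkc, hk1, hk2⟩ := exists_supConvolution hB hne hf (δ + ε)
  have hmin : ∀ a, ∃ y, ∀ y', k y + ‖a - y‖ ^ 2 / (2 * δ) ≤ k y' + ‖a - y'‖ ^ 2 / (2 * δ) := by
    intro a
    obtain ⟨b, hb⟩ := hne
    have hc : Continuous (fun y => k y + ‖a - y‖ ^ 2 / (2 * δ)) := by fun_prop
    refine hc.exists_forall_le' a ?_
    have hκ : 0 < 1 / (2 * δ) - 1 / (2 * δ + ε) := by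
      rw [sub_pos]
      exact one_div_lt_one_div_of_lt (by positivity) (by linarith)
    have hlow : ∀ y, f b - ‖a - b‖ ^ 2 / ε + (1 / (2 * δ) - 1 / (2 * δ + ε)) * ‖a - y‖ ^ 2
        ≤ k y + ‖a - y‖ ^ 2 / (2 * δ) := by
      intro y
      have e1 := hk2 y b hb
      have e2 := norm_add_sq_div_add_le (y - a) (a - b) (α := 2 * δ + ε) (β := ε)
        (by positivity) hε
      rw [sub_add_sub_cancel, show 2 * δ + ε + ε = 2 * (δ + ε) by ring, norm_sub_rev y a] at e2
      have e3 : (1 / (2 * δ) - 1 / (2 * δ + ε)) * ‖a - y‖ ^ 2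
        = ‖a - y‖ ^ 2 / (2 * δ) - ‖a - y‖ ^ 2 / (2 * δ + ε) := by ring
      linarith
    have ht : Tendsto (fun y => f b - ‖a - b‖ ^ 2 / ε +
        (1 / (2 * δ) - 1 / (2 * δ + ε)) * ‖a - y‖ ^ 2) (cocompact H) atTop := by
      refine tendsto_atTop_add_const_left _ _ (Tendsto.const_mul_atTop hκ ?_)
      refine (tendsto_pow_atTop (two_ne_zero)).comp ?_
      have := tendsto_norm_cocompact_atTop (E := H)
      refine tendsto_atTop_mono (f := fun y => ‖y‖ - ‖a‖) (fun y => ?_)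
        (tendsto_atTop_add_const_right _ _ this)
      rw [norm_sub_rev]
      exact norm_sub_norm_le y a
    filter_upwards [ht.eventually_ge_atTop (k a + ‖a - a‖ ^ 2 / (2 * δ))] with y hy
    exact hy.trans (hlow y)
  choose m hm using hmin
  let G : H → ℝ := fun a => k (m a) + ‖a - m a‖ ^ 2 / (2 * δ)
  let s : H → H := fun a => (1 / δ) • (a - m a)
  have hGle : ∀ a y, G a ≤ k y + ‖a - y‖ ^ 2 / (2 * δ) := hm
  have hexp : ∀ a a' y : H, ‖a' - y‖ ^ 2 / (2 * δ) = ‖a - y‖ ^ 2 / (2 * δ) +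
      ⟪(1 / δ) • (a - y), a' - a⟫ + ‖a' - a‖ ^ 2 / (2 * δ) := by
    intro a a' y
    rw [show a' - y = (a - y) + (a' - a) by abel, norm_add_sq_real, real_inner_smul_left]
    field_simp
  have hup : ∀ a a', G a' ≤ G a + ⟪s a, a' - a⟫ + ‖a' - a‖ ^ 2 / (2 * δ) := by
    intro a a'
    have e1 := hGle a' (m a)
    rw [hexp a a' (m a)] at e1
    simp only [G, s]
    linarith
  have hkmid : ∀ y l, 2 * k y - ‖l‖ ^ 2 / (δ + ε) ≤ k (y + l) + k (y - l) := by
    intro y l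
    obtain ⟨b, hb, hkb⟩ := hk1 y
    have e1 := hk2 (y + l) b hb
    have e2 := hk2 (y - l) b hb
    have e3 := parallelogram_law_with_norm ℝ (y - b) l
    rw [show y + l - b = y - b + l by abel] at e1
    rw [show y - l - b = y - b - l by abel] at e2
    have e4 : ‖y - b + l‖ ^ 2 / (2 * (δ + ε)) + ‖y - b - l‖ ^ 2 / (2 * (δ + ε))
        = 2 * (‖y - b‖ ^ 2 / (2 * (δ + ε))) + ‖l‖ ^ 2 / (δ + ε) := by
      field_simp
      linarith
    linarith
  have hmid : ∀ a h, 2 * G a - ‖h‖ ^ 2 / ε ≤ G (a + h) + G (a - h) := by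
    intro a h
    set y₁ := m (a + h) with hy₁
    set y₂ := m (a - h) with hy₂
    set y : H := (1 / 2 : ℝ) • (y₁ + y₂) with hy
    set l : H := (1 / 2 : ℝ) • (y₁ - y₂) with hl
    have hyl : y + l = y₁ := by rw [hy, hl]; module
    have hyl' : y - l = y₂ := by rw [hy, hl]; module
    have e1 := hkmid y l
    rw [hyl, hyl'] at e1
    have e2 := hGle a y
    have e3 := parallelogram_law_with_norm ℝ (a - y) (h - l)
    rw [show a - y + (h - l) = a + h - y₁ by rw [← hyl]; abel,
      show a - y - (h - l) = a - h - y₂ by rw [← hyl']; abel] at e3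
    have e4 : ‖a + h - y₁‖ ^ 2 / (2 * δ) + ‖a - h - y₂‖ ^ 2 / (2 * δ)
        = 2 * (‖a - y‖ ^ 2 / (2 * δ)) + ‖h - l‖ ^ 2 / δ := by
      field_simp
      linarith
    have e5 := norm_add_sq_div_add_le (l - h) h hδ hε
    rw [sub_add_cancel, norm_sub_rev] at e5
    simp only [G, ← hy₁, ← hy₂]
    simp only [G] at e2
    linarith
  have hlow : ∀ a a', G a + ⟪s a, a' - a⟫ - (1 / ε + 1 / (2 * δ)) * ‖a' - a‖ ^ 2 ≤ G a' := by
    intro a a'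
    have e1 := hmid a (a' - a)
    have e2 := hup a (a - (a' - a))
    rw [show a - (a' - a) - a = -(a' - a) by abel, inner_neg_right, norm_neg] at e2
    rw [add_sub_cancel] at e1
    have e3 : (1 / ε + 1 / (2 * δ)) * ‖a' - a‖ ^ 2 = ‖a' - a‖ ^ 2 / ε + ‖a' - a‖ ^ 2 / (2 * δ) := by
      ring
    linarith
  have hgG : ∀ a, g a ≤ G a := by
    intro a
    obtain ⟨b, hb, hgb⟩ := hg1 a
    have e1 := hk2 (m a) b hb
    have e2 := norm_add_sq_div_add_le (m a - a) (a - b) (α := 2 * δ) (β := 2 * ε)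
      (by positivity) (by positivity)
    rw [sub_add_sub_cancel, norm_sub_rev (m a) a, ← mul_add] at e2
    simp only [G]
    linarith
  refine ⟨g, G, s, NNReal.mk (1 / ε + 1 / (2 * δ)) (by positivity), hgc, hg1, hg2, hgG, fun a a' => ?_,
    fun a s₀ hs₀ => ?_⟩
  · have e1 := hup a a'
    have e2 := hlow a a'
    have e3 : (1 / ε + 1 / (2 * δ)) * ‖a' - a‖ ^ 2 = ‖a' - a‖ ^ 2 / ε + ‖a' - a‖ ^ 2 / (2 * δ) := by
      ring
    have e4 : 0 ≤ ‖a' - a‖ ^ 2 / ε := by positivity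
    rw [NNReal.coe_mk, abs_le]
    constructor <;> linarith
  · set y : H := a - δ • s₀ with hy
    have hay : a - y = δ • s₀ := by rw [hy]; abel
    have hky : k y + ‖a - y‖ ^ 2 / (2 * δ) ≤ g a := by
      obtain ⟨b, hb, hkb⟩ := hk1 y
      set a' : H := y + (δ / (δ + ε)) • (b - y) with ha'
      have e1 := hs₀ a'
      have e2 := hg2 a' b hb
      have e3 := hexp a a' y
      rw [hay, smul_smul, one_div_mul_cancel hδ.ne', one_smul, ← hay] at e3
      have e4 : ‖a' - y‖ ^ 2 / (2 * δ) + ‖a' - b‖ ^ 2 / (2 * ε) = ‖y - b‖ ^ 2 / (2 * (δ + ε)) := by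
        have f1 : a' - y = (δ / (δ + ε)) • (b - y) := by rw [ha']; abel
        have f2 : a' - b = -(ε / (δ + ε)) • (b - y) := by
          have : (ε / (δ + ε)) = 1 - δ / (δ + ε) := by field_simp; ring
          rw [ha', this]; module
        rw [f1, f2, norm_smul, norm_smul, norm_neg, Real.norm_of_nonneg (by positivity),
          Real.norm_of_nonneg (by positivity), norm_sub_rev b y]
        field_simp
      linarith
    have hGa : G a = g a := le_antisymm ((hGle a y).trans hky) (hgG a)
    refine ⟨hGa, ?_⟩
    have hup' : ∀ h, G (a + h) ≤ G a + ⟪s₀, h⟫ + ‖h‖ ^ 2 / (2 * δ) := by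
      intro h
      have e1 := hGle (a + h) y
      have e2 := hexp a (a + h) y
      rw [hay, smul_smul, one_div_mul_cancel hδ.ne', one_smul, ← hay, add_sub_cancel_left] at e2
      linarith
    by_contra hne'
    have hpos : 0 < ‖s a - s₀‖ ^ 2 := by
      have := norm_pos_iff.2 (sub_ne_zero.2 hne')
      positivity
    have key : ∀ t : ℝ, t * ‖s a - s₀‖ ^ 2 ≤ (1 / ε + 1 / δ) * (t ^ 2 * ‖s a - s₀‖ ^ 2) := by
      intro t
      have e1 := hup' (t • (s a - s₀))
      have e2 := hlow a (a + t • (s a - s₀))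
      rw [add_sub_cancel_left] at e2
      have e3 : ⟪s a, t • (s a - s₀)⟫ - ⟪s₀, t • (s a - s₀)⟫ = t * ‖s a - s₀‖ ^ 2 := by
        rw [← inner_sub_left, real_inner_smul_right, real_inner_self_eq_norm_sq]
      have e4 : ‖t • (s a - s₀)‖ ^ 2 = t ^ 2 * ‖s a - s₀‖ ^ 2 := by
        rw [norm_smul, mul_pow, Real.norm_eq_abs, sq_abs]
      rw [e4] at e1 e2
      have e5 : (1 / ε + 1 / (2 * δ)) * (t ^ 2 * ‖s a - s₀‖ ^ 2) +
        t ^ 2 * ‖s a - s₀‖ ^ 2 / (2 * δ) = (1 / ε + 1 / δ) * (t ^ 2 * ‖s a - s₀‖ ^ 2) := by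
        field_simp; ring
      linarith
    set c := 1 / ε + 1 / δ with hc
    have hcpos : 0 < c := by positivity
    have := key (1 / (2 * c))
    have e : c * ((1 / (2 * c)) ^ 2 * ‖s a - s₀‖ ^ 2) = 1 / (4 * c) * ‖s a - s₀‖ ^ 2 := by
      field_simp; ring
    rw [e] at this
    have h5 := le_of_mul_le_mul_right this hpos
    have h6 : 1 / (4 * c) < 1 / (2 * c) := by
      apply one_div_lt_one_div_of_lt <;> linarith
    linarith

end Regularization

section SumTheorem

variable {H : Type*} [NormedAddCommGroup H] [InnerProductSpace ℝ H]

theorem hasFDerivAt_of_abs_sub_sub_inner_le {G : H → ℝ} {s : H → H} {C : ℝ≥0}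
    (h : ∀ a a', |G a' - G a - ⟪s a, a' - a⟫| ≤ C * ‖a' - a‖ ^ 2) (a : H) :
    HasFDerivAt G (innerSL ℝ (s a)) a := by
  rw [hasFDerivAt_iff_isLittleO_nhds_zero]
  have h1 : (fun v : H => G (a + v) - G a - innerSL ℝ (s a) v) =O[𝓝 0] fun v => ‖v‖ ^ 2 := by
    refine Asymptotics.IsBigO.of_bound C (Eventually.of_forall fun v => ?_)
    have := h a (a + v)
    rw [add_sub_cancel_left] at this
    simpa using this
  refine h1.trans_isLittleO ?_
  have : (fun v : H => ‖v‖ ^ 2) =o[𝓝 0] fun v => ‖v‖ :=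
    (Asymptotics.isLittleO_pow_id one_lt_two).comp_tendsto (tendsto_norm_zero (E := H))
  exact this.of_norm_right

/-- Second order Taylor bound for a function whose gradient is differentiable at a point. -/
theorem eventually_le_taylor_two {G : H → ℝ} {s : H → H} {C : ℝ≥0}
    (h : ∀ a a', |G a' - G a - ⟪s a, a' - a⟫| ≤ C * ‖a' - a‖ ^ 2) {a : H} {A : H →L[ℝ] H}
    (hA : HasFDerivAt s A a) {η : ℝ} (hη : 0 < η) :
    ∀ᶠ v in 𝓝 (0 : H), G (a + v) ≤ G a + ⟪s a, v⟫ + ⟪A v, v⟫ / 2 + η * ‖v‖ ^ 2 := by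
  have h1 := (hasFDerivAt_iff_isLittleO_nhds_zero.1 hA).bound hη
  obtain ⟨ρ, hρ, hball⟩ := Metric.eventually_nhds_iff_ball.1 h1
  filter_upwards [ball_mem_nhds (0 : H) hρ] with v hv
  let φ : ℝ → ℝ := fun t => G (a + t • v) - t * ⟪s a, v⟫ - t ^ 2 / 2 * ⟪A v, v⟫
  have hφ : ∀ t, HasDerivAt φ (⟪s (a + t • v), v⟫ - ⟪s a, v⟫ - t * ⟪A v, v⟫) t := by
    intro t
    have e1 : HasDerivAt (fun t : ℝ => a + t • v) v t := by
      simpa using ((hasDerivAt_id t).smul_const v).const_add a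
    have e2 := (hasFDerivAt_of_abs_sub_sub_inner_le h (a + t • v)).comp_hasDerivAt t e1
    have e3 : HasDerivAt (fun t : ℝ => t * ⟪s a, v⟫) ⟪s a, v⟫ t := by
      simpa using (hasDerivAt_id t).mul_const ⟪s a, v⟫
    have e4 : HasDerivAt (fun t : ℝ => t ^ 2 / 2 * ⟪A v, v⟫) (t * ⟪A v, v⟫) t := by
      have := ((hasDerivAt_pow 2 t).div_const 2).mul_const ⟪A v, v⟫
      have e : ((2 : ℕ) : ℝ) * t ^ (2 - 1) / 2 * ⟪A v, v⟫ = t * ⟪A v, v⟫ := by norm_num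
      rwa [e] at this
    exact (e2.sub e3).sub e4
  obtain ⟨t, ht, hslope⟩ := exists_hasDerivAt_eq_slope φ _ zero_lt_one
    (fun t _ => (hφ t).continuousAt.continuousWithinAt) (fun t _ => hφ t)
  have htv : t • v ∈ ball (0 : H) ρ := by
    rw [mem_ball_zero_iff] at hv ⊢
    rw [norm_smul, Real.norm_of_nonneg ht.1.le]
    exact (mul_le_of_le_one_left (norm_nonneg _) ht.2.le).trans_lt hv
  have e1 := hball _ htv
  have e2 : ⟪s (a + t • v), v⟫ - ⟪s a, v⟫ - t * ⟪A v, v⟫ ≤ η * ‖v‖ ^ 2 := by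
    have : ⟪s (a + t • v), v⟫ - ⟪s a, v⟫ - t * ⟪A v, v⟫ =
        ⟪s (a + t • v) - s a - A (t • v), v⟫ := by
      rw [inner_sub_left, inner_sub_left, map_smul, real_inner_smul_left]
    rw [this]
    calc _ ≤ ‖s (a + t • v) - s a - A (t • v)‖ * ‖v‖ := real_inner_le_norm _ _
      _ ≤ (η * ‖t • v‖) * ‖v‖ := by gcongr
      _ ≤ (η * ‖v‖) * ‖v‖ := by
        gcongr
        rw [norm_smul, Real.norm_of_nonneg ht.1.le]
        exact mul_le_of_le_one_left (norm_nonneg _) ht.2.le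
      _ = η * ‖v‖ ^ 2 := by ring
  simp only [φ, sub_zero, div_one, one_smul, zero_smul, add_zero] at hslope
  linarith

variable [FiniteDimensional ℝ H]

/-- Crandall–Ishii type theorem on sums for a quadratic cost `⟪l, z⟫ + ⟪T z, z⟫ / 2`. -/
theorem exists_superjets_of_sum {f₁ f₂ : H → ℝ} {B : Set H} (hB : IsCompact B)
    (hne : B.Nonempty) (hf₁ : ContinuousOn f₁ B) (hf₂ : ContinuousOn f₂ B)
    (l : WithLp 2 (H × H)) (T : WithLp 2 (H × H) →L[ℝ] WithLp 2 (H × H))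
    (hT : ∀ x y, ⟪T x, y⟫ = ⟪x, T y⟫) {ε r : ℝ} (hε : 0 < ε) (hTε : ‖T‖ * ε ≤ 1 / 4)
    (hr : 0 < r) :
    ∃ (q z : WithLp 2 (H × H)) (y₁ y₂ : H) (A₁ A₂ : H →L[ℝ] H), ‖q‖ < r ∧ y₁ ∈ B ∧ y₂ ∈ B ∧
      (∀ z' : WithLp 2 (H × H), ∀ y₁' ∈ B, ∀ y₂' ∈ B,
        f₁ y₁' - ‖z'.fst - y₁'‖ ^ 2 / (2 * ε) + (f₂ y₂' - ‖z'.snd - y₂'‖ ^ 2 / (2 * ε))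
          - (⟪l, z'⟫ + ⟪T z', z'⟫ / 2) - ⟪q, z'⟫ ≤
        f₁ y₁ - ‖z.fst - y₁‖ ^ 2 / (2 * ε) + (f₂ y₂ - ‖z.snd - y₂‖ ^ 2 / (2 * ε))
          - (⟪l, z⟫ + ⟪T z, z⟫ / 2) - ⟪q, z⟫) ∧
      (∀ η > 0, ∀ᶠ h in 𝓝 (0 : H), y₁ + h ∈ B →
        f₁ (y₁ + h) ≤ f₁ y₁ + ⟪(l + T z + q).fst, h⟫ + ⟪A₁ h, h⟫ / 2 + η * ‖h‖ ^ 2) ∧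
      (∀ η > 0, ∀ᶠ h in 𝓝 (0 : H), y₂ + h ∈ B →
        f₂ (y₂ + h) ≤ f₂ y₂ + ⟪(l + T z + q).snd, h⟫ + ⟪A₂ h, h⟫ / 2 + η * ‖h‖ ^ 2) ∧
      ∀ v : WithLp 2 (H × H), ⟪A₁ v.fst, v.fst⟫ + ⟪A₂ v.snd, v.snd⟫ ≤ ⟪T v, v⟫ := by
  set δ : ℝ := 1 / (‖T‖ + 1) with hδdef
  have hTn : 0 ≤ ‖T‖ := norm_nonneg T
  have hδ : 0 < δ := by positivity
  obtain ⟨g₁, G₁, s₁, C₁, hg₁c, hg₁y, hg₁le, hgG₁, hG₁, hcon₁⟩ :=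
    exists_supConvolution_majorant hB hne hf₁ hε hδ
  obtain ⟨g₂, G₂, s₂, C₂, hg₂c, hg₂y, hg₂le, hgG₂, hG₂, hcon₂⟩ :=
    exists_supConvolution_majorant hB hne hf₂ hε hδ
  let Q : WithLp 2 (H × H) → ℝ := fun z => ⟪l, z⟫ + ⟪T z, z⟫ / 2
  have hQ : ∀ z z', Q z' = Q z + ⟪l + T z, z' - z⟫ + ⟪T (z' - z), z' - z⟫ / 2 := by
    intro z z'
    have e := hT z' z
    simp only [Q, map_sub, inner_sub_left, inner_sub_right, inner_add_left]
    have e' := real_inner_comm z' (T z)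
    linarith
  have hTle : ∀ v : WithLp 2 (H × H), ⟪T v, v⟫ ≤ ‖T‖ * ‖v‖ ^ 2 := fun v => by
    calc ⟪T v, v⟫ ≤ ‖T v‖ * ‖v‖ := real_inner_le_norm _ _
      _ ≤ (‖T‖ * ‖v‖) * ‖v‖ := by gcongr; exact T.le_opNorm v
      _ = _ := by ring
  have hTδ : ∀ v : WithLp 2 (H × H), ⟪T v, v⟫ / 2 ≤ ‖v‖ ^ 2 / (2 * δ) := fun v => by
    have e : ‖v‖ ^ 2 / (2 * δ) = (‖T‖ + 1) * ‖v‖ ^ 2 / 2 := by rw [hδdef]; field_simp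
    nlinarith [hTle v, sq_nonneg ‖v‖]
  let Θ : WithLp 2 (H × H) → ℝ := fun z => g₁ z.fst + g₂ z.snd - Q z
  have hfstc : Continuous (fun z : WithLp 2 (H × H) => z.fst) := WithLp.continuous_fst 2 H H
  have hsndc : Continuous (fun z : WithLp 2 (H × H) => z.snd) := WithLp.continuous_snd 2 H H
  have hΘc : Continuous Θ := by
    have : Continuous Q := by fun_prop
    exact ((hg₁c.comp hfstc).add (hg₂c.comp hsndc)).sub this
  let 𝒢 : WithLp 2 (H × H) → ℝ := fun z => G₁ z.fst + G₂ z.snd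
  let S : WithLp 2 (H × H) → WithLp 2 (H × H) := fun z => WithLp.toLp 2 (s₁ z.fst, s₂ z.snd)
  have h𝒢 : ∀ z z' : WithLp 2 (H × H), |𝒢 z' - 𝒢 z - ⟪S z, z' - z⟫| ≤ (C₁ + C₂ : ℝ≥0) * ‖z' - z‖ ^ 2 := by
    intro z z'
    have e1 := hG₁ z.fst z'.fst
    have e2 := hG₂ z.snd z'.snd
    have e3 : ‖z' - z‖ ^ 2 = ‖z'.fst - z.fst‖ ^ 2 + ‖z'.snd - z.snd‖ ^ 2 :=
      WithLp.prod_norm_sq_eq_of_L2 _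
    have e4 : ⟪S z, z' - z⟫ = ⟪s₁ z.fst, z'.fst - z.fst⟫ + ⟪s₂ z.snd, z'.snd - z.snd⟫ := rfl
    rw [e3, e4]
    have e5 : 𝒢 z' - 𝒢 z - (⟪s₁ z.fst, z'.fst - z.fst⟫ + ⟪s₂ z.snd, z'.snd - z.snd⟫) =
      (G₁ z'.fst - G₁ z.fst - ⟪s₁ z.fst, z'.fst - z.fst⟫) +
      (G₂ z'.snd - G₂ z.snd - ⟪s₂ z.snd, z'.snd - z.snd⟫) := by simp only [𝒢]; ring
    rw [e5]
    refine (abs_add_le _ _).trans ((add_le_add e1 e2).trans ?_)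
    push_cast
    have := mul_nonneg C₁.2 (sq_nonneg ‖z'.snd - z.snd‖)
    have := mul_nonneg C₂.2 (sq_nonneg ‖z'.fst - z.fst‖)
    simp only [NNReal.val_eq_coe] at *
    linarith
  have hSlip := lipschitzWith_of_abs_sub_sub_inner_le h𝒢
  let P : WithLp 2 (H × H) → WithLp 2 (H × H) := fun z => S z - (l + T z)
  have hPlip : LipschitzWith (6 * (C₁ + C₂) + (0 + ‖T‖₊)) P :=
    hSlip.sub ((LipschitzWith.const l).add T.lipschitz)
  -- coercivity
  obtain ⟨R₀, hR₀⟩ := hB.isBounded.exists_norm_le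
  obtain ⟨b₁, -, hb₁⟩ := hB.exists_isMaxOn hne hf₁
  obtain ⟨b₂, -, hb₂⟩ := hB.exists_isMaxOn hne hf₂
  have hgup : ∀ (f g : H → ℝ) (M : ℝ), (∀ y ∈ B, f y ≤ M) →
      (∀ a, ∃ y ∈ B, g a = f y - ‖a - y‖ ^ 2 / (2 * ε)) →
      ∀ a, g a ≤ M + R₀ ^ 2 / (2 * ε) - ‖a‖ ^ 2 / (4 * ε) := by
    intro f g M hM hg a
    obtain ⟨y, hy, hgy⟩ := hg a
    have e1 := hM y hy
    have e2 : ‖y‖ ^ 2 ≤ R₀ ^ 2 := by gcongr; exact hR₀ y hy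
    have e3 := norm_add_sq_div_add_le (a - y) y one_pos one_pos
    rw [sub_add_cancel] at e3
    have e4 : ‖a‖ ^ 2 / (4 * ε) ≤ ‖a - y‖ ^ 2 / (2 * ε) + R₀ ^ 2 / (2 * ε) := by
      rw [← add_div, div_le_div_iff₀ (by positivity) (by positivity)]
      nlinarith
    rw [hgy]
    linarith
  set M : ℝ := f₁ b₁ + f₂ b₂ + R₀ ^ 2 / ε with hM
  have hΘup : ∀ z, Θ z ≤ M + ‖l‖ * ‖z‖ - ‖z‖ ^ 2 / (8 * ε) := by
    intro z
    have e1 := hgup f₁ g₁ _ (fun y hy => hb₁ hy) hg₁y z.fst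
    have e2 := hgup f₂ g₂ _ (fun y hy => hb₂ hy) hg₂y z.snd
    have e3 : ‖z‖ ^ 2 = ‖z.fst‖ ^ 2 + ‖z.snd‖ ^ 2 := WithLp.prod_norm_sq_eq_of_L2 _
    have e4 : -(‖l‖ * ‖z‖) ≤ ⟪l, z⟫ := (abs_le.1 (abs_real_inner_le_norm l z)).1
    have e5 : -(‖T‖ * ‖z‖ ^ 2) ≤ ⟪T z, z⟫ := by
      have := (abs_le.1 (abs_real_inner_le_norm (T z) z)).1
      have h6 : ‖T z‖ * ‖z‖ ≤ (‖T‖ * ‖z‖) * ‖z‖ := by gcongr; exact T.le_opNorm z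
      nlinarith
    have e6 : ‖T‖ * ‖z‖ ^ 2 / 2 ≤ ‖z‖ ^ 2 / (8 * ε) := by
      rw [div_le_div_iff₀ (by positivity) (by positivity)]
      nlinarith [sq_nonneg ‖z‖]
    have e7 : ‖z‖ ^ 2 / (4 * ε) = ‖z.fst‖ ^ 2 / (4 * ε) + ‖z.snd‖ ^ 2 / (4 * ε) := by
      rw [e3, add_div]
    have e8 : ‖z‖ ^ 2 / (4 * ε) = 2 * (‖z‖ ^ 2 / (8 * ε)) := by field_simp; ring
    have e9 : R₀ ^ 2 / ε = 2 * (R₀ ^ 2 / (2 * ε)) := by field_simp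
    simp only [Θ, Q]
    linarith
  set R : ℝ := 8 * ε * (‖l‖ + r + |M - Θ 0|) + 1 with hR
  have hfar : ∀ q ∈ ball (0 : WithLp 2 (H × H)) r, ∀ z, R < ‖z‖ → Θ z - ⟪q, z⟫ < Θ 0 := by
    intro q hq z hz
    rw [mem_ball_zero_iff] at hq
    have e1 := hΘup z
    have e2 : -(r * ‖z‖) ≤ ⟪q, z⟫ := by
      have := (abs_le.1 (abs_real_inner_le_norm q z)).1
      nlinarith [norm_nonneg z]
    have hz1 : 1 ≤ ‖z‖ := by
      have : 0 ≤ 8 * ε * (‖l‖ + r + |M - Θ 0|) := by positivity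
      linarith
    have e3 : (‖l‖ + r + |M - Θ 0|) * ‖z‖ < ‖z‖ ^ 2 / (8 * ε) := by
      rw [lt_div_iff₀ (by positivity)]
      nlinarith
    have e4 : M - Θ 0 ≤ |M - Θ 0| * ‖z‖ :=
      (le_abs_self _).trans (le_mul_of_one_le_right (abs_nonneg _) hz1)
    nlinarith
  have hex : ∀ q ∈ ball (0 : WithLp 2 (H × H)) r, ∃ z, ∀ y, Θ y - ⟪q, y⟫ ≤ Θ z - ⟪q, z⟫ := by
    intro q hq
    have hc : Continuous (fun z => Θ z - ⟪q, z⟫) := by fun_prop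
    refine hc.exists_forall_ge' 0 ?_
    have hinf := (tendsto_norm_cocompact_atTop (E := WithLp 2 (H × H))).eventually_gt_atTop R
    filter_upwards [hinf] with z hz
    have := hfar q hq z hz
    simpa using this.le
  have hpull : ∀ q z : WithLp 2 (H × H), (∀ y, Θ y - ⟪q, y⟫ ≤ Θ z - ⟪q, z⟫) →
      (G₁ z.fst = g₁ z.fst ∧ s₁ z.fst = (l + T z + q).fst) ∧
      (G₂ z.snd = g₂ z.snd ∧ s₂ z.snd = (l + T z + q).snd) := by
    intro q z hz
    have key : ∀ v : WithLp 2 (H × H), g₁ (z.fst + v.fst) + g₂ (z.snd + v.snd) ≤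
        g₁ z.fst + g₂ z.snd + ⟪l + T z + q, v⟫ + ‖v‖ ^ 2 / (2 * δ) := by
      intro v
      have e1 := hz (z + v)
      have e2 := hQ z (z + v)
      rw [add_sub_cancel_left] at e2
      have e3 := hTδ v
      have e4 : Θ (z + v) = g₁ (z.fst + v.fst) + g₂ (z.snd + v.snd) - Q (z + v) := rfl
      have e5 : Θ z = g₁ z.fst + g₂ z.snd - Q z := rfl
      rw [inner_add_left (l + T z) q v]
      rw [inner_add_right] at e1
      linarith
    constructor
    · refine hcon₁ _ _ fun a' => ?_
      have e := key (WithLp.toLp 2 (a' - z.fst, 0))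
      have e' : ⟪l + T z + q, WithLp.toLp 2 (a' - z.fst, 0)⟫ =
        ⟪(l + T z + q).fst, a' - z.fst⟫ + ⟪(l + T z + q).snd, (0 : H)⟫ := rfl
      rw [WithLp.norm_toLp_fst, e'] at e
      simp only [WithLp.toLp_fst, WithLp.toLp_snd, add_sub_cancel, add_zero, inner_zero_right] at e
      linarith
    · refine hcon₂ _ _ fun a' => ?_
      have e := key (WithLp.toLp 2 (0, a' - z.snd))
      have e' : ⟪l + T z + q, WithLp.toLp 2 (0, a' - z.snd)⟫ =
        ⟪(l + T z + q).fst, (0 : H)⟫ + ⟪(l + T z + q).snd, a' - z.snd⟫ := rfl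
      rw [WithLp.norm_toLp_snd, e'] at e
      simp only [WithLp.toLp_fst, WithLp.toLp_snd, add_sub_cancel, add_zero, zero_add,
        inner_zero_right] at e
      linarith
  have hmax : ∀ q ∈ ball (0 : WithLp 2 (H × H)) r, ∀ z, (∀ y, Θ y - ⟪q, y⟫ ≤ Θ z - ⟪q, z⟫) →
      ‖z‖ ≤ R ∧ P z = q := by
    intro q hq z hz
    constructor
    · by_contra! hcon
      have := hfar q hq z hcon
      have h0 := hz 0
      simp only [inner_zero_right, sub_zero] at h0
      linarith
    · obtain ⟨⟨-, e1⟩, -, e2⟩ := hpull q z hz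
      simp only [P, S, e1, e2]
      change l + T z + q - (l + T z) = q
      abel
  obtain ⟨q, hq, z, hz, D, hD, hDneg⟩ :=
    exists_maximizer_hasFDerivAt_nonpos hΘc hPlip hr hex hmax
  obtain ⟨⟨hGg₁, hs₁⟩, hGg₂, hs₂⟩ := hpull q z hz
  have hS : HasFDerivAt S (D + T) z := by
    have e1 : HasFDerivAt (fun z => P z + (l + T z)) (D + T) z :=
      hD.add ((T.hasFDerivAt).const_add l)
    have e2 : (fun z => P z + (l + T z)) = S := by
      funext z; simp only [P]; abel
    rwa [e2] at e1
  obtain ⟨y₁, hy₁, hgy₁⟩ := hg₁y z.fst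
  obtain ⟨y₂, hy₂, hgy₂⟩ := hg₂y z.snd
  let i₁ : H →L[ℝ] WithLp 2 (H × H) := (WithLp.prodContinuousLinearEquiv 2 ℝ H H).symm.toContinuousLinearMap.comp
    (ContinuousLinearMap.inl ℝ H H)
  let i₂ : H →L[ℝ] WithLp 2 (H × H) := (WithLp.prodContinuousLinearEquiv 2 ℝ H H).symm.toContinuousLinearMap.comp
    (ContinuousLinearMap.inr ℝ H H)
  let π₁ : WithLp 2 (H × H) →L[ℝ] H := WithLp.fstL 2 ℝ H H
  let π₂ : WithLp 2 (H × H) →L[ℝ] H := WithLp.sndL 2 ℝ H H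
  have hi₁ : ∀ h, i₁ h = WithLp.toLp 2 (h, 0) := fun h => rfl
  have hi₂ : ∀ h, i₂ h = WithLp.toLp 2 (0, h) := fun h => rfl
  have hcross₁ : ∀ h, ((D + T) (i₁ h)).snd = 0 := by
    intro h
    have e1 : HasDerivAt (fun t : ℝ => z + t • i₁ h) (i₁ h) 0 := by
      have := ((hasDerivAt_id (0 : ℝ)).smul_const (i₁ h)).const_add z
      rw [one_smul] at this
      exact this
    have e2 : HasFDerivAt S (D + T) (z + (0 : ℝ) • i₁ h) := by simpa using hS
    have e3 := π₂.hasFDerivAt.comp_hasDerivAt (0 : ℝ) (e2.comp_hasDerivAt (0 : ℝ) e1)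
    have e4 : (π₂ ∘ S ∘ fun t : ℝ => z + t • i₁ h) = fun _ => s₂ z.snd := by
      funext t
      change s₂ (z.snd + t • (0 : H)) = _
      simp
    rw [e4] at e3
    exact e3.unique (hasDerivAt_const _ _)
  have hcross₂ : ∀ h, ((D + T) (i₂ h)).fst = 0 := by
    intro h
    have e1 : HasDerivAt (fun t : ℝ => z + t • i₂ h) (i₂ h) 0 := by
      have := ((hasDerivAt_id (0 : ℝ)).smul_const (i₂ h)).const_add z
      rw [one_smul] at this
      exact this
    have e2 : HasFDerivAt S (D + T) (z + (0 : ℝ) • i₂ h) := by simpa using hS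
    have e3 := π₁.hasFDerivAt.comp_hasDerivAt (0 : ℝ) (e2.comp_hasDerivAt (0 : ℝ) e1)
    have e4 : (π₁ ∘ S ∘ fun t : ℝ => z + t • i₂ h) = fun _ => s₁ z.fst := by
      funext t
      change s₁ (z.fst + t • (0 : H)) = _
      simp
    rw [e4] at e3
    exact e3.unique (hasDerivAt_const _ _)
  refine ⟨q, z, y₁, y₂, π₁.comp ((D + T).comp i₁), π₂.comp ((D + T).comp i₂),
    by simpa using hq, hy₁, hy₂, ?_, ?_, ?_, ?_⟩
  · intro z' y₁' hy₁' y₂' hy₂'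
    have e1 := hz z'
    have e2 := hg₁le z'.fst y₁' hy₁'
    have e3 := hg₂le z'.snd y₂' hy₂'
    simp only [Θ, Q] at e1
    rw [← hgy₁, ← hgy₂]
    linarith
  · intro η hη
    have ht := eventually_le_taylor_two h𝒢 hS hη
    have hi : Tendsto i₁ (𝓝 0) (𝓝 0) := by simpa using i₁.continuous.tendsto 0
    filter_upwards [hi.eventually ht] with h hh hB'
    have e1 := hg₁le (z.fst + h) (y₁ + h) hB'
    rw [add_sub_add_right_eq_sub] at e1
    have e2 := hgG₁ (z.fst + h)
    have e3 : 𝒢 (z + i₁ h) = G₁ (z.fst + h) + G₂ (z.snd + 0) := rfl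
    have e4 : ⟪S z, i₁ h⟫ = ⟪s₁ z.fst, h⟫ + ⟪s₂ z.snd, (0 : H)⟫ := rfl
    have e5 : ⟪(D + T) (i₁ h), i₁ h⟫ = ⟪((D + T) (i₁ h)).fst, h⟫ +
      ⟪((D + T) (i₁ h)).snd, (0 : H)⟫ := rfl
    have e6 : ‖i₁ h‖ = ‖h‖ := WithLp.norm_toLp_fst 2 H H h
    rw [e3, e4, e5, e6] at hh
    simp only [inner_zero_right, add_zero] at hh
    simp only [𝒢] at hh
    rw [hs₁] at hh
    change f₁ (y₁ + h) ≤ f₁ y₁ + ⟪(l + T z + q).fst, h⟫ + ⟪((D + T) (i₁ h)).fst, h⟫ / 2 + _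
    linarith
  · intro η hη
    have ht := eventually_le_taylor_two h𝒢 hS hη
    have hi : Tendsto i₂ (𝓝 0) (𝓝 0) := by simpa using i₂.continuous.tendsto 0
    filter_upwards [hi.eventually ht] with h hh hB'
    have e1 := hg₂le (z.snd + h) (y₂ + h) hB'
    rw [add_sub_add_right_eq_sub] at e1
    have e2 := hgG₂ (z.snd + h)
    have e3 : 𝒢 (z + i₂ h) = G₁ (z.fst + 0) + G₂ (z.snd + h) := rfl
    have e4 : ⟪S z, i₂ h⟫ = ⟪s₁ z.fst, (0 : H)⟫ + ⟪s₂ z.snd, h⟫ := rfl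
    have e5 : ⟪(D + T) (i₂ h), i₂ h⟫ = ⟪((D + T) (i₂ h)).fst, (0 : H)⟫ +
      ⟪((D + T) (i₂ h)).snd, h⟫ := rfl
    have e6 : ‖i₂ h‖ = ‖h‖ := WithLp.norm_toLp_snd 2 H H h
    rw [e3, e4, e5, e6] at hh
    simp only [inner_zero_right, add_zero, zero_add] at hh
    simp only [𝒢] at hh
    rw [hs₂] at hh
    change f₂ (y₂ + h) ≤ f₂ y₂ + ⟪(l + T z + q).snd, h⟫ + ⟪((D + T) (i₂ h)).snd, h⟫ / 2 + _
    linarith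
  · intro v
    have hv : v = i₁ v.fst + i₂ v.snd := by
      refine WithLp.ofLp_injective 2 ?_
      change v.ofLp = (v.fst + 0, 0 + v.snd)
      rw [add_zero, zero_add]
      rfl
    have e1 : ⟪(D + T) v, v⟫ = ⟪((D + T) v).fst, v.fst⟫ + ⟪((D + T) v).snd, v.snd⟫ := rfl
    have e2 : ((D + T) v).fst = ((D + T) (i₁ v.fst)).fst := by
      conv_lhs => rw [hv, map_add, WithLp.add_fst, hcross₂, add_zero]
    have e3 : ((D + T) v).snd = ((D + T) (i₂ v.snd)).snd := by
      conv_lhs => rw [hv, map_add, WithLp.add_snd, hcross₁, zero_add]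
    rw [e2, e3] at e1
    change ⟪((D + T) (i₁ v.fst)).fst, v.fst⟫ + ⟪((D + T) (i₂ v.snd)).snd, v.snd⟫ ≤ _
    rw [← e1, add_apply, inner_add_left]
    linarith [hDneg v]

end SumTheorem

section LocalizedSum

variable {H : Type*} [NormedAddCommGroup H] [InnerProductSpace ℝ H] [FiniteDimensional ℝ H]

/-- The theorem on sums at a strict maximum, with a part `n • T'` of the cost pushed to infinity. -/
theorem exists_superjets_near {f₁ f₂ : H → ℝ} {B : Set H} (hB : IsCompact B) (hB0 : B ∈ 𝓝 (0 : H))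
    (hf₁ : ContinuousOn f₁ B) (hf₂ : ContinuousOn f₂ B)
    (l : WithLp 2 (H × H)) (T₀ T' : WithLp 2 (H × H) →L[ℝ] WithLp 2 (H × H))
    (hT₀ : ∀ x y, ⟪T₀ x, y⟫ = ⟪x, T₀ y⟫) (hT' : ∀ x y, ⟪T' x, y⟫ = ⟪x, T' y⟫)
    (hT'nn : ∀ z, 0 ≤ ⟪T' z, z⟫)
    (hstrict : ∀ z : WithLp 2 (H × H), z.fst ∈ B → z.snd ∈ B → ⟪T' z, z⟫ = 0 →
      f₁ 0 + f₂ 0 ≤ f₁ z.fst + f₂ z.snd - (⟪l, z⟫ + ⟪T₀ z, z⟫ / 2) → z = 0)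
    {δ : ℝ} (hδ : 0 < δ) :
    ∃ (n : ℕ) (q z : WithLp 2 (H × H)) (y₁ y₂ : H) (A₁ A₂ : H →L[ℝ] H),
      ‖q‖ < δ ∧ ‖z‖ < δ ∧ ‖y₁‖ < δ ∧ ‖y₂‖ < δ ∧
      (∀ η > 0, ∀ᶠ h in 𝓝 (0 : H), f₁ (y₁ + h) ≤ f₁ y₁ +
        ⟪(l + (T₀ + (n : ℝ) • T') z + q).fst, h⟫ + ⟪A₁ h, h⟫ / 2 + η * ‖h‖ ^ 2) ∧
      (∀ η > 0, ∀ᶠ h in 𝓝 (0 : H), f₂ (y₂ + h) ≤ f₂ y₂ +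
        ⟪(l + (T₀ + (n : ℝ) • T') z + q).snd, h⟫ + ⟪A₂ h, h⟫ / 2 + η * ‖h‖ ^ 2) ∧
      ∀ v : WithLp 2 (H × H), ⟪A₁ v.fst, v.fst⟫ + ⟪A₂ v.snd, v.snd⟫ ≤
        ⟪(T₀ + (n : ℝ) • T') v, v⟫ := by
  have h0B : (0 : H) ∈ B := mem_of_mem_nhds hB0
  let T : ℕ → WithLp 2 (H × H) →L[ℝ] WithLp 2 (H × H) := fun n => T₀ + (n : ℝ) • T'
  have hT : ∀ n x y, ⟪T n x, y⟫ = ⟪x, T n y⟫ := by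
    intro n x y
    simp only [T, add_apply, smul_apply, inner_add_left, inner_add_right, real_inner_smul_left,
      real_inner_smul_right, hT₀, hT']
  let ε : ℕ → ℝ := fun n => 1 / (4 * ((n : ℝ) + 1) * (‖T n‖ + 1))
  have hε : ∀ n, 0 < ε n := fun n => by positivity
  have hTε : ∀ n, ‖T n‖ * ε n ≤ 1 / 4 * (1 / ((n : ℝ) + 1)) := fun n => by
    have e : 1 / 4 * (1 / ((n : ℝ) + 1)) - ‖T n‖ * ε n = ε n := by
      simp only [ε]; field_simp; ring
    linarith [hε n]
  have hn1 : ∀ n : ℕ, 1 / ((n : ℝ) + 1) ≤ 1 := fun n => by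
    rw [div_le_one (by positivity)]; linarith [Nat.cast_nonneg (α := ℝ) n]
  have hεle : ∀ n, ε n ≤ 1 / ((n : ℝ) + 1) := fun n => by
    have : 0 ≤ ‖T n‖ * ε n := by have := hε n; positivity
    have e : 1 / 4 * (1 / ((n : ℝ) + 1)) - ‖T n‖ * ε n = ε n := by
      simp only [ε]; field_simp; ring
    have : 0 ≤ 1 / ((n : ℝ) + 1) := by positivity
    linarith
  choose q z y₁ y₂ A₁ A₂ hq hy₁ hy₂ hmax hjet₁ hjet₂ hA using fun n =>
    exists_superjets_of_sum hB ⟨0, h0B⟩ hf₁ hf₂ l (T n) (hT n) (hε n)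
      (by linarith [hTε n, hn1 n]) (by positivity : 0 < 1 / ((n : ℝ) + 1))
  let Y : ℕ → WithLp 2 (H × H) := fun n => WithLp.toLp 2 (y₁ n, y₂ n)
  obtain ⟨⟨a₁, a₂⟩, ⟨ha₁, ha₂⟩, φ, hφ, hlim⟩ := (hB.prod hB).tendsto_subseq
    (x := fun n => (y₁ n, y₂ n)) fun n => ⟨hy₁ n, hy₂ n⟩
  have hYlim : Tendsto (Y ∘ φ) atTop (𝓝 (WithLp.toLp 2 (a₁, a₂))) :=
    ((WithLp.prod_continuous_toLp 2 H H).tendsto _).comp hlim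
  set a : WithLp 2 (H × H) := WithLp.toLp 2 (a₁, a₂) with ha
  have hinv : Tendsto (fun n => 1 / ((φ n : ℝ) + 1)) atTop (𝓝 0) :=
    tendsto_one_div_add_atTop_nhds_zero_nat.comp hφ.tendsto_atTop
  have hqlim : Tendsto (q ∘ φ) atTop (𝓝 0) :=
    squeeze_zero_norm (fun n => (hq (φ n)).le) hinv
  have hzY : ∀ n, ‖z n - Y n‖ ≤ (3 * ‖l‖ + 3 + ‖Y n‖) * (1 / ((n : ℝ) + 1)) := by
    intro n
    have e1 := hmax n (Y n) (y₁ n) (hy₁ n) (y₂ n) (hy₂ n)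
    simp only [Y, WithLp.toLp_fst, WithLp.toLp_snd, sub_self, norm_zero] at e1
    set d := z n - Y n with hd
    have e2 : ‖d‖ ^ 2 = ‖(z n).fst - y₁ n‖ ^ 2 + ‖(z n).snd - y₂ n‖ ^ 2 :=
      WithLp.prod_norm_sq_eq_of_L2 _
    have hz : z n = Y n + d := by rw [hd]; abel
    have e3 : ⟪T n (z n), z n⟫ = ⟪T n (Y n), Y n⟫ + 2 * ⟪T n (Y n), d⟫ + ⟪T n d, d⟫ := by
      have := hT n d (Y n)
      have := real_inner_comm d (T n (Y n))
      rw [hz]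
      simp only [map_add, inner_add_left, inner_add_right]
      linarith
    have e4 : ⟪l, z n⟫ = ⟪l, Y n⟫ + ⟪l, d⟫ := by rw [hz, inner_add_right]
    have e5 : ⟪q n, z n⟫ = ⟪q n, Y n⟫ + ⟪q n, d⟫ := by rw [hz, inner_add_right]
    have i1 := (abs_le.1 (abs_real_inner_le_norm l d)).1
    have i2 := (abs_le.1 (abs_real_inner_le_norm (q n) d)).1
    have i3 := (abs_le.1 (abs_real_inner_le_norm (T n (Y n)) d)).1
    have i4 := (abs_le.1 (abs_real_inner_le_norm (T n d) d)).1
    have j2 : ‖q n‖ * ‖d‖ ≤ 1 * ‖d‖ := by gcongr; exact (hq n).le.trans (hn1 n)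
    have j3 : ‖T n (Y n)‖ * ‖d‖ ≤ (‖T n‖ * ‖Y n‖) * ‖d‖ := by gcongr; exact (T n).le_opNorm _
    have j4 : ‖T n d‖ * ‖d‖ ≤ (‖T n‖ * ‖d‖) * ‖d‖ := by gcongr; exact (T n).le_opNorm _
    have key : ‖d‖ ^ 2 / (2 * ε n) ≤
        (‖l‖ + ‖T n‖ * ‖Y n‖ + 1) * ‖d‖ + ‖T n‖ * ‖d‖ ^ 2 / 2 := by
      have : ‖d‖ ^ 2 / (2 * ε n) = ‖(z n).fst - y₁ n‖ ^ 2 / (2 * ε n)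
        + ‖(z n).snd - y₂ n‖ ^ 2 / (2 * ε n) := by rw [e2, add_div]
      have e0 : (0 : ℝ) ^ 2 / (2 * ε n) = 0 := by simp
      change f₁ (y₁ n) - 0 ^ 2 / (2 * ε n) + (f₂ (y₂ n) - 0 ^ 2 / (2 * ε n)) -
        (⟪l, Y n⟫ + ⟪T n (Y n), Y n⟫ / 2) - ⟪q n, Y n⟫ ≤ _ at e1
      linarith
    rcases (norm_nonneg d).eq_or_lt with h0 | h0
    · rw [← h0]; positivity
    rw [div_le_iff₀ (by linarith [hε n])] at key
    have k1 : ‖T n‖ * ε n * ‖d‖ ≤ 1 / 4 * ‖d‖ := by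
      gcongr; linarith [hTε n, hn1 n]
    have k2 : ‖d‖ ≤ 2 * ε n * (‖l‖ + ‖T n‖ * ‖Y n‖ + 1) + ‖T n‖ * ε n * ‖d‖ := by
      refine le_of_mul_le_mul_right ?_ h0
      nlinarith
    have k3 : ‖T n‖ * ε n * ‖Y n‖ ≤ 1 / 4 * (1 / ((n : ℝ) + 1)) * ‖Y n‖ := by
      exact mul_le_mul_of_nonneg_right (hTε n) (norm_nonneg _)
    have k4 : ε n * (‖l‖ + 1) ≤ 1 / ((n : ℝ) + 1) * (‖l‖ + 1) := by
      gcongr; exact hεle n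
    have k5 : 0 ≤ 1 / ((n : ℝ) + 1) * (‖l‖ + 1) := by positivity
    have k6 : 0 ≤ 1 / ((n : ℝ) + 1) * ‖Y n‖ := by positivity
    nlinarith
  have hzlim : Tendsto (z ∘ φ) atTop (𝓝 a) := by
    have e1 : Tendsto (fun n => z (φ n) - Y (φ n)) atTop (𝓝 0) := by
      refine squeeze_zero_norm (fun n => hzY (φ n)) ?_
      have := ((hYlim.norm.const_add (3 * ‖l‖ + 3)).mul hinv)
      rw [mul_zero] at this
      exact this
    have e2 := e1.add hYlim
    rw [zero_add] at e2
    refine e2.congr fun n => ?_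
    simp
  let g : ℕ → ℝ := fun n => f₁ (y₁ n) + f₂ (y₂ n) - f₁ 0 - f₂ 0 - (⟪l, z n⟫ + ⟪T₀ (z n), z n⟫ / 2)
    - ⟪q n, z n⟫
  have hg : ∀ n : ℕ, n * ⟪T' (z n), z n⟫ / 2 ≤ g n := by
    intro n
    have e1 := hmax n 0 0 h0B 0 h0B
    simp only [WithLp.zero_fst, WithLp.zero_snd, sub_self, norm_zero, inner_zero_right, map_zero]
      at e1
    have e2 : ⟪T n (z n), z n⟫ = ⟪T₀ (z n), z n⟫ + n * ⟪T' (z n), z n⟫ := by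
      simp only [T, add_apply, smul_apply, inner_add_left, real_inner_smul_left]
    have e3 : 0 ≤ ‖(z n).fst - y₁ n‖ ^ 2 / (2 * ε n) := div_nonneg (sq_nonneg _) (by linarith [hε n])
    have e4 : 0 ≤ ‖(z n).snd - y₂ n‖ ^ 2 / (2 * ε n) := div_nonneg (sq_nonneg _) (by linarith [hε n])
    have e0 : (0 : ℝ) ^ 2 / (2 * ε n) = 0 := by simp
    simp only [g]
    linarith
  have hy₁lim : Tendsto (y₁ ∘ φ) atTop (𝓝 a₁) := (continuous_fst.tendsto _).comp hlim
  have hy₂lim : Tendsto (y₂ ∘ φ) atTop (𝓝 a₂) := (continuous_snd.tendsto _).comp hlim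
  have hglim : Tendsto (g ∘ φ) atTop
      (𝓝 (f₁ a₁ + f₂ a₂ - f₁ 0 - f₂ 0 - (⟪l, a⟫ + ⟪T₀ a, a⟫ / 2) - ⟪(0 : WithLp 2 (H × H)), a⟫)) := by
    have l1 : Tendsto (fun n => f₁ (y₁ (φ n))) atTop (𝓝 (f₁ a₁)) :=
      (hf₁ a₁ ha₁).tendsto.comp (tendsto_nhdsWithin_iff.2 ⟨hy₁lim, Eventually.of_forall fun n => hy₁ _⟩)
    have l2 : Tendsto (fun n => f₂ (y₂ (φ n))) atTop (𝓝 (f₂ a₂)) :=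
      (hf₂ a₂ ha₂).tendsto.comp (tendsto_nhdsWithin_iff.2 ⟨hy₂lim, Eventually.of_forall fun n => hy₂ _⟩)
    have l3 : Tendsto (fun n => ⟪l, z (φ n)⟫) atTop (𝓝 ⟪l, a⟫) := tendsto_const_nhds.inner hzlim
    have l4 : Tendsto (fun n => ⟪T₀ (z (φ n)), z (φ n)⟫ / 2) atTop (𝓝 (⟪T₀ a, a⟫ / 2)) :=
      (((T₀.continuous.tendsto a).comp hzlim).inner hzlim).div_const 2
    have l5 : Tendsto (fun n => ⟪q (φ n), z (φ n)⟫) atTop (𝓝 ⟪(0 : WithLp 2 (H × H)), a⟫) :=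
      hqlim.inner hzlim
    exact ((((l1.add l2).sub_const _).sub_const _).sub (l3.add l4)).sub l5
  have hT'lim : Tendsto (fun n => ⟪T' (z (φ n)), z (φ n)⟫) atTop (𝓝 ⟪T' a, a⟫) :=
    ((T'.continuous.tendsto a).comp hzlim).inner hzlim
  have hT'a : ⟪T' a, a⟫ = 0 := by
    refine le_antisymm ?_ (hT'nn a)
    have e1 : Tendsto (fun n => (2 * g (φ n) + ⟪T' (z (φ n)), z (φ n)⟫) * (1 / ((φ n : ℝ) + 1))) atTop
        (𝓝 0) := by
      have := ((hglim.const_mul 2).add hT'lim).mul hinv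
      rwa [mul_zero] at this
    refine le_of_tendsto_of_tendsto' hT'lim e1 fun n => ?_
    have := hg (φ n)
    rw [mul_one_div, le_div_iff₀ (by positivity)]
    linarith
  have ha0 : a = 0 := by
    refine hstrict a ha₁ ha₂ hT'a ?_
    have : 0 ≤ f₁ a₁ + f₂ a₂ - f₁ 0 - f₂ 0 - (⟪l, a⟫ + ⟪T₀ a, a⟫ / 2)
        - ⟪(0 : WithLp 2 (H × H)), a⟫ := by
      refine ge_of_tendsto' hglim fun n => le_trans ?_ (hg (φ n))
      have := hT'nn (z (φ n))
      positivity
    rw [inner_zero_left] at this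
    change f₁ 0 + f₂ 0 ≤ f₁ a₁ + f₂ a₂ - _
    linarith
  have ha₁0 : a₁ = 0 := congrArg WithLp.fst ha0
  have ha₂0 : a₂ = 0 := congrArg WithLp.snd ha0
  rw [ha0] at hzlim
  rw [ha₁0] at hy₁lim
  rw [ha₂0] at hy₂lim
  have hBe : ∀ᶠ y in 𝓝 (0 : H), B ∈ 𝓝 y := eventually_eventually_nhds.2 hB0
  have n1 := hzlim.eventually (ball_mem_nhds _ hδ)
  have n2 := hqlim.eventually (ball_mem_nhds _ hδ)
  have n3 := hy₁lim.eventually (inter_mem (ball_mem_nhds _ hδ) hBe)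
  have n4 := hy₂lim.eventually (inter_mem (ball_mem_nhds _ hδ) hBe)
  obtain ⟨k, h1, h2, ⟨h3, h3'⟩, h4, h4'⟩ := (n1.and (n2.and (n3.and n4))).exists
  simp only [Function.comp, mem_ball, dist_zero_right] at h1 h2 h3 h4
  have hshift : ∀ y : H, B ∈ 𝓝 y → ∀ᶠ h in 𝓝 (0 : H), y + h ∈ B := fun y hy => by
    have : Tendsto (fun h => y + h) (𝓝 (0 : H)) (𝓝 y) := by
      simpa using (continuous_const_add y).tendsto 0
    exact this.eventually hy
  refine ⟨φ k, q (φ k), z (φ k), y₁ (φ k), y₂ (φ k), A₁ (φ k), A₂ (φ k), h2, h1, h3, h4, ?_, ?_,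
    hA (φ k)⟩
  · intro η hη
    filter_upwards [hjet₁ (φ k) η hη, hshift _ h3'] with h e1 e2 using e1 e2
  · intro η hη
    filter_upwards [hjet₂ (φ k) η hη, hshift _ h4'] with h e1 e2 using e1 e2

end LocalizedSum

section Jets

variable {E : Type*} [NormedAddCommGroup E] [InnerProductSpace ℝ E]

/-- The square root of `1 + (p - 2) ν ⊗ ν` for a unit vector `ν`. -/
def sqrtDiff (p : ℝ) (ν v : E) : E := v + ((√(p - 1) - 1) * ⟪ν, v⟫) • ν

/-- The subsolution property of the game-theoretic `p`-parabolic equation at a point, in terms of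
second order jets. -/
def IsJetSub (p : ℝ) (w : E → ℝ → ℝ) (x : E) (t : ℝ) : Prop :=
  ∀ (ξ : E) (τ : ℝ) (X : E →L[ℝ] E) (C : ℝ),
    (∀ᶠ q in 𝓝 (x, t), w q.1 q.2 ≤ w x t + ⟪ξ, q.1 - x⟫ + τ * (q.2 - t)
      + ⟪X (q.1 - x), q.1 - x⟫ / 2 + C * (q.2 - t) ^ 2) →
    ∃ ν : E, ‖ν‖ = 1 ∧ (ξ ≠ 0 → ν = ‖ξ‖⁻¹ • ξ) ∧
      p * τ ≤ LinearMap.trace ℝ E X + (p - 2) * ⟪X ν, ν⟫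

variable {ι : Type*} [Fintype ι]

theorem sum_inner_sqrtDiff {p : ℝ} (hp : 1 < p) (b : OrthonormalBasis ι ℝ E) (X : E →L[ℝ] E)
    (ν : E) (hν : ‖ν‖ = 1) :
    ∑ k, ⟪X (sqrtDiff p ν (b k)), sqrtDiff p ν (b k)⟫ =
      LinearMap.trace ℝ E X + (p - 2) * ⟪X ν, ν⟫ := by
  have hs : √(p - 1) ^ 2 = p - 1 := Real.sq_sqrt (by linarith)
  set a := √(p - 1) - 1 with ha
  have h1 : ∑ k, ⟪ν, b k⟫ • b k = ν := by
    simpa [real_inner_comm] using b.sum_repr' ν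
  have h2 : ∑ k, ⟪ν, b k⟫ * ⟪X ν, b k⟫ = ⟪X ν, ν⟫ := by
    have : ⟪X ν, ν⟫ = ⟪X ν, ∑ k, ⟪ν, b k⟫ • b k⟫ := by rw [h1]
    rw [this, inner_sum]
    simp only [real_inner_smul_right]
  have h3 : ∑ k, ⟪ν, b k⟫ * ⟪X (b k), ν⟫ = ⟪X ν, ν⟫ := by
    have : X ν = ∑ k, ⟪ν, b k⟫ • X (b k) := by
      conv_lhs => rw [← h1]
      simp
    rw [this, sum_inner]
    simp [real_inner_smul_left]
  have h4 : ∑ k, ⟪ν, b k⟫ ^ 2 = 1 := by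
    rw [b.sum_sq_inner_left, hν, one_pow]
  have h5 : LinearMap.trace ℝ E X = ∑ k, ⟪X (b k), b k⟫ := by
    rw [LinearMap.trace_eq_sum_inner _ b]
    exact Finset.sum_congr rfl fun k _ => real_inner_comm _ _
  have h6 : ∀ k, ⟪X (sqrtDiff p ν (b k)), sqrtDiff p ν (b k)⟫ = ⟪X (b k), b k⟫ +
      a * (⟪ν, b k⟫ * ⟪X ν, b k⟫) + a * (⟪ν, b k⟫ * ⟪X (b k), ν⟫) +
      a ^ 2 * ⟪X ν, ν⟫ * ⟪ν, b k⟫ ^ 2 := by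
    intro k
    simp only [sqrtDiff, map_add, map_smul, inner_add_left, inner_add_right, real_inner_smul_left,
      real_inner_smul_right, ← ha]
    ring
  simp only [h6, Finset.sum_add_distrib, ← Finset.mul_sum, h2, h3, h4, ← h5]
  have : a ^ 2 + 2 * a = p - 2 := by rw [ha]; nlinarith
  linear_combination ⟪X ν, ν⟫ * this

theorem sum_norm_sqrtDiff {p : ℝ} (hp : 1 < p) (b : OrthonormalBasis ι ℝ E)
    (ν : E) (hν : ‖ν‖ = 1) :
    ∑ k, ‖sqrtDiff p ν (b k)‖ ^ 2 = Module.finrank ℝ E + p - 2 := by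
  have h := sum_inner_sqrtDiff hp b (ContinuousLinearMap.id ℝ E) ν hν
  have : FiniteDimensional ℝ E := b.toBasis.finiteDimensional_of_finite
  have e : LinearMap.trace ℝ E (ContinuousLinearMap.id ℝ E : E →L[ℝ] E) = Module.finrank ℝ E :=
    LinearMap.trace_id ℝ E
  rw [e] at h
  simp only [ContinuousLinearMap.id_apply, real_inner_self_eq_norm_sq, hν] at h
  linarith

/-- A space-time second order superjet gives the subsolution inequality. -/
theorem IsJetSub.of_superjet {p : ℝ} (hp : 1 < p) {w : E → ℝ → ℝ} {x₀ : E} {t₀ : ℝ}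
    {y m : WithLp 2 (E × ℝ)} {A : WithLp 2 (E × ℝ) →L[ℝ] WithLp 2 (E × ℝ)} {η : ℝ} (hη : 0 < η)
    (hw : IsJetSub p w (x₀ + y.fst) (t₀ + y.snd))
    (h : ∀ᶠ h in 𝓝 (0 : WithLp 2 (E × ℝ)), w (x₀ + (y + h).fst) (t₀ + (y + h).snd) ≤
      w (x₀ + y.fst) (t₀ + y.snd) + ⟪m, h⟫ + ⟪A h, h⟫ / 2 + η * ‖h‖ ^ 2) :
    ∃ ν : E, ‖ν‖ = 1 ∧ (m.fst ≠ 0 → ν = ‖m.fst‖⁻¹ • m.fst) ∧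
      ∀ b : OrthonormalBasis ι ℝ E, p * m.snd ≤
        ∑ k, ⟪A (WithLp.toLp 2 (sqrtDiff p ν (b k), 0)), WithLp.toLp 2 (sqrtDiff p ν (b k), 0)⟫
          + 4 * η * (Module.finrank ℝ E + p - 2) := by
  let i : E →L[ℝ] WithLp 2 (E × ℝ) :=
    (WithLp.prodContinuousLinearEquiv 2 ℝ E ℝ).symm.toContinuousLinearMap.comp
      (ContinuousLinearMap.inl ℝ E ℝ)
  let j : ℝ →L[ℝ] WithLp 2 (E × ℝ) :=
    (WithLp.prodContinuousLinearEquiv 2 ℝ E ℝ).symm.toContinuousLinearMap.comp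
      (ContinuousLinearMap.inr ℝ E ℝ)
  let X : E →L[ℝ] E := (WithLp.fstL 2 ℝ E ℝ).comp (A.comp i) + (4 * η) • ContinuousLinearMap.id ℝ E
  have hX : ∀ v, ⟪X v, v⟫ = ⟪A (i v), i v⟫ + 4 * η * ‖v‖ ^ 2 := by
    intro v
    have e1 : ⟪A (i v), i v⟫ = ⟪(A (i v)).fst, v⟫ + ⟪(A (i v)).snd, (0 : ℝ)⟫ := rfl
    have e2 : X v = (A (i v)).fst + (4 * η) • v := rfl
    rw [e1, e2, inner_add_left, real_inner_smul_left, real_inner_self_eq_norm_sq, inner_zero_right]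
    ring
  have hshift : Tendsto (fun q : E × ℝ => (WithLp.toLp 2 (q.1 - (x₀ + y.fst), q.2 - (t₀ + y.snd)) :
      WithLp 2 (E × ℝ))) (𝓝 (x₀ + y.fst, t₀ + y.snd)) (𝓝 0) := by
    have hc : Continuous fun q : E × ℝ =>
        (WithLp.toLp 2 (q.1 - (x₀ + y.fst), q.2 - (t₀ + y.snd)) : WithLp 2 (E × ℝ)) :=
      (WithLp.prod_continuous_toLp 2 E ℝ).comp (by fun_prop)
    have := hc.tendsto (x₀ + y.fst, t₀ + y.snd)
    simp only [sub_self] at this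
    exact this
  obtain ⟨ν, hν, hνξ, hle⟩ := hw m.fst m.snd X (η + ‖A‖ ^ 2 / (4 * η) + ‖A‖ / 2) (by
    filter_upwards [hshift.eventually h] with q hq
    set v := q.1 - (x₀ + y.fst) with hv
    set s := q.2 - (t₀ + y.snd) with hs
    have e1 : x₀ + (y + WithLp.toLp 2 (v, s)).fst = q.1 := by
      change x₀ + (y.fst + (q.1 - (x₀ + y.fst))) = q.1
      abel
    have e2 : t₀ + (y + WithLp.toLp 2 (v, s)).snd = q.2 := by
      change t₀ + (y.snd + (q.2 - (t₀ + y.snd))) = q.2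
      ring
    have e3 : ⟪m, WithLp.toLp 2 (v, s)⟫ = ⟪m.fst, v⟫ + s * m.snd := rfl
    have e4 : ‖(WithLp.toLp 2 (v, s) : WithLp 2 (E × ℝ))‖ ^ 2 = ‖v‖ ^ 2 + ‖s‖ ^ 2 :=
      WithLp.prod_norm_sq_eq_of_L2 _
    have e5 : (WithLp.toLp 2 (v, s) : WithLp 2 (E × ℝ)) = i v + j s := by
      refine WithLp.ofLp_injective 2 ?_
      change (v, s) = (v + 0, 0 + s)
      rw [add_zero, zero_add]
    have hi : ‖i v‖ = ‖v‖ := WithLp.norm_toLp_fst 2 E ℝ v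
    have hj : ‖j s‖ = ‖s‖ := WithLp.norm_toLp_snd 2 E ℝ s
    have c1 : ⟪A (i v), j s⟫ ≤ ‖A‖ * ‖v‖ * ‖s‖ := by
      refine (real_inner_le_norm _ _).trans ?_
      rw [hj, ← hi]; gcongr; exact A.le_opNorm _
    have c2 : ⟪A (j s), i v⟫ ≤ ‖A‖ * ‖s‖ * ‖v‖ := by
      refine (real_inner_le_norm _ _).trans ?_
      rw [hi, ← hj]; gcongr; exact A.le_opNorm _
    have c3 : ⟪A (j s), j s⟫ ≤ ‖A‖ * ‖s‖ * ‖s‖ := by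
      refine (real_inner_le_norm _ _).trans ?_
      rw [← hj]; gcongr; exact A.le_opNorm _
    rw [e1, e2, e3, e4, e5] at hq
    simp only [map_add, inner_add_left, inner_add_right] at hq
    rw [hX v]
    have hs2 : ‖s‖ ^ 2 = s ^ 2 := sq_abs s
    have c4 : ‖A‖ * ‖v‖ * ‖s‖ ≤ η * ‖v‖ ^ 2 + ‖A‖ ^ 2 / (4 * η) * s ^ 2 := by
      have : 0 ≤ (2 * η * ‖v‖ - ‖A‖ * ‖s‖) ^ 2 / (4 * η) := by positivity
      have e : (2 * η * ‖v‖ - ‖A‖ * ‖s‖) ^ 2 / (4 * η) =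
        η * ‖v‖ ^ 2 + ‖A‖ ^ 2 / (4 * η) * ‖s‖ ^ 2 - ‖A‖ * ‖v‖ * ‖s‖ := by field_simp; ring
      rw [← hs2]; linarith
    rw [hs2] at hq
    have c5 : ‖A‖ * ‖s‖ * ‖s‖ = ‖A‖ * s ^ 2 := by rw [← hs2]; ring
    nlinarith)
  refine ⟨ν, hν, hνξ, fun b => ?_⟩
  rw [← sum_inner_sqrtDiff hp b X ν hν] at hle
  simp only [hX, Finset.sum_add_distrib, ← Finset.mul_sum, sum_norm_sqrtDiff hp b ν hν] at hle
  exact hle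

end Jets

section Doubling

variable {E : Type*} [NormedAddCommGroup E] [InnerProductSpace ℝ E] {ι : Type*} [Fintype ι]

/-- The Hessian form `⟪S (v - v'), v - v'⟫ + 2 κ (|v|² + |v'|²)` of a doubled cost. -/
def doubledForm (S : E →L[ℝ] E) (κ : ℝ) (v v' : E) : ℝ :=
  ⟪S (v - v'), v - v'⟫ + 2 * κ * (‖v‖ ^ 2 + ‖v'‖ ^ 2)

set_option maxHeartbeats 1000000 in
theorem exists_inclusion_approx [FiniteDimensional ℝ E] {p : ℝ} (hp : 1 < p) {w₁ w₂ : E → ℝ → ℝ}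
    {x₀ y₀ : E} {t₀ : ℝ}
    (hw₁ : ∀ᶠ q in 𝓝 (x₀, t₀), ContinuousAt (fun q : E × ℝ => w₁ q.1 q.2) q ∧
      IsJetSub p w₁ q.1 q.2)
    (hw₂ : ∀ᶠ q in 𝓝 (y₀, t₀), ContinuousAt (fun q : E × ℝ => w₂ q.1 q.2) q ∧
      IsJetSub p w₂ q.1 q.2)
    {S : E →L[ℝ] E} (hS : ∀ v v', ⟪S v, v'⟫ = ⟪v, S v'⟫) {κ τ : ℝ} {p₁ p₂ : E} {η C : ℝ}
    (hη : 0 < η)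
    (hmax : ∀ᶠ q : E × E × ℝ in 𝓝 (x₀, y₀, t₀), w₁ q.1 q.2.2 + w₂ q.2.1 q.2.2 ≤
      w₁ x₀ t₀ + w₂ y₀ t₀ + ⟪p₁, q.1 - x₀⟫ + ⟪p₂, q.2.1 - y₀⟫ + τ * (q.2.2 - t₀) +
      doubledForm S κ (q.1 - x₀) (q.2.1 - y₀) / 2 +
      η * (‖q.1 - x₀‖ ^ 2 + ‖q.2.1 - y₀‖ ^ 2) + C * (q.2.2 - t₀) ^ 2)
    {δ : ℝ} (hδ : 0 < δ) :
    ∃ ν₁ ν₂ m₁ m₂ : E, ‖ν₁‖ = 1 ∧ ‖ν₂‖ = 1 ∧ ‖m₁ - p₁‖ < δ ∧ ‖m₂ - p₂‖ < δ ∧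
      (m₁ ≠ 0 → ν₁ = ‖m₁‖⁻¹ • m₁) ∧ (m₂ ≠ 0 → ν₂ = ‖m₂‖⁻¹ • m₂) ∧
      ∀ b c : OrthonormalBasis ι ℝ E, p * (τ - δ) ≤
        ∑ k, doubledForm S κ (sqrtDiff p ν₁ (b k)) (sqrtDiff p ν₂ (c k)) +
          16 * η * (Module.finrank ℝ E + p - 2) := by
  obtain ⟨r₁, hr₁, hb₁⟩ := Metric.eventually_nhds_iff_ball.1 hw₁
  obtain ⟨r₂, hr₂, hb₂⟩ := Metric.eventually_nhds_iff_ball.1 hw₂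
  obtain ⟨r₃, hr₃, hb₃⟩ := Metric.eventually_nhds_iff_ball.1 hmax
  set r := min r₁ (min r₂ r₃) / 2 with hr
  have hr0 : 0 < r := by positivity
  have hrr₁ : r < r₁ := by
    have := min_le_left r₁ (min r₂ r₃); rw [hr]; linarith
  have hrr₂ : r < r₂ := by
    have := (min_le_right r₁ (min r₂ r₃)).trans (min_le_left _ _); rw [hr]; linarith
  have hrr₃ : r < r₃ := by
    have := (min_le_right r₁ (min r₂ r₃)).trans (min_le_right _ _); rw [hr]; linarith
  let B : Set (WithLp 2 (E × ℝ)) := closedBall 0 r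
  have hBc : IsCompact B := isCompact_closedBall 0 r
  have hB0 : B ∈ 𝓝 (0 : WithLp 2 (E × ℝ)) := closedBall_mem_nhds 0 hr0
  have hBle : ∀ h ∈ B, ‖h.fst‖ ≤ r ∧ ‖h.snd‖ ≤ r := by
    intro h hh
    rw [mem_closedBall, dist_zero_right] at hh
    have e : ‖h‖ ^ 2 = ‖h.fst‖ ^ 2 + ‖h.snd‖ ^ 2 := WithLp.prod_norm_sq_eq_of_L2 _
    have e' : ‖h‖ ^ 2 ≤ r ^ 2 := by gcongr
    exact ⟨abs_le_of_sq_le_sq' (by nlinarith [sq_nonneg ‖h.snd‖]) hr0.le |>.2,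
      abs_le_of_sq_le_sq' (by nlinarith [sq_nonneg ‖h.fst‖]) hr0.le |>.2⟩
  have hmem : ∀ (a : E) (r' : ℝ), r < r' → ∀ h ∈ B, (a + h.fst, t₀ + h.snd) ∈ ball (a, t₀) r' := by
    intro a r' hr' h hh
    obtain ⟨e1, e2⟩ := hBle h hh
    rw [mem_ball, Prod.dist_eq, max_lt_iff, dist_eq_norm, dist_eq_norm]
    simp only [add_sub_cancel_left]
    exact ⟨e1.trans_lt hr', e2.trans_lt hr'⟩
  let f : (E → ℝ → ℝ) → E → WithLp 2 (E × ℝ) → ℝ := fun w a h => w (a + h.fst) (t₀ + h.snd)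
  have hfc : ∀ (w : E → ℝ → ℝ) (a : E) (r' : ℝ), r < r' →
      (∀ q ∈ ball (a, t₀) r', ContinuousAt (fun q : E × ℝ => w q.1 q.2) q) →
      ContinuousOn (f w a) B := by
    intro w a r' hr' hc h hh
    have e1 : Continuous fun h : WithLp 2 (E × ℝ) => (a + h.fst, t₀ + h.snd) := by
      have := WithLp.continuous_fst 2 E ℝ
      have := WithLp.continuous_snd 2 E ℝ
      fun_prop
    exact ((hc _ (hmem a r' hr' h hh)).comp
      (f := fun h : WithLp 2 (E × ℝ) => (a + h.fst, t₀ + h.snd)) e1.continuousAt).continuousWithinAt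
  set c₀ := 2 * κ + 4 * η with hc₀
  set C₀ := |C| + 1 with hC₀
  let T₀ : WithLp 2 (WithLp 2 (E × ℝ) × WithLp 2 (E × ℝ)) →L[ℝ]
      WithLp 2 (WithLp 2 (E × ℝ) × WithLp 2 (E × ℝ)) := LinearMap.toContinuousLinearMap
    { toFun := fun z => WithLp.toLp 2
        (WithLp.toLp 2 (S (z.fst.fst - z.snd.fst) + c₀ • z.fst.fst, C₀ * z.fst.snd),
         WithLp.toLp 2 (S (z.snd.fst - z.fst.fst) + c₀ • z.snd.fst, C₀ * z.snd.snd))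
      map_add' := fun z z' => by
        refine WithLp.ofLp_injective 2 (Prod.ext (WithLp.ofLp_injective 2 (Prod.ext ?_ ?_))
          (WithLp.ofLp_injective 2 (Prod.ext ?_ ?_)))
        · change S (z.fst.fst + z'.fst.fst - (z.snd.fst + z'.snd.fst)) +
            c₀ • (z.fst.fst + z'.fst.fst) = (S (z.fst.fst - z.snd.fst) + c₀ • z.fst.fst) +
            (S (z'.fst.fst - z'.snd.fst) + c₀ • z'.fst.fst)
          simp only [map_sub, map_add]; module
        · change C₀ * (z.fst.snd + z'.fst.snd) = C₀ * z.fst.snd + C₀ * z'.fst.snd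
          ring
        · change S (z.snd.fst + z'.snd.fst - (z.fst.fst + z'.fst.fst)) +
            c₀ • (z.snd.fst + z'.snd.fst) = (S (z.snd.fst - z.fst.fst) + c₀ • z.snd.fst) +
            (S (z'.snd.fst - z'.fst.fst) + c₀ • z'.snd.fst)
          simp only [map_sub, map_add]; module
        · change C₀ * (z.snd.snd + z'.snd.snd) = C₀ * z.snd.snd + C₀ * z'.snd.snd
          ring
      map_smul' := fun s z => by
        refine WithLp.ofLp_injective 2 (Prod.ext (WithLp.ofLp_injective 2 (Prod.ext ?_ ?_))
          (WithLp.ofLp_injective 2 (Prod.ext ?_ ?_)))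
        · change S (s • z.fst.fst - s • z.snd.fst) + c₀ • (s • z.fst.fst) =
            s • (S (z.fst.fst - z.snd.fst) + c₀ • z.fst.fst)
          simp only [map_sub, map_smul]; module
        · change C₀ * (s * z.fst.snd) = s * (C₀ * z.fst.snd)
          ring
        · change S (s • z.snd.fst - s • z.fst.fst) + c₀ • (s • z.snd.fst) =
            s • (S (z.snd.fst - z.fst.fst) + c₀ • z.snd.fst)
          simp only [map_sub, map_smul]; module
        · change C₀ * (s * z.snd.snd) = s * (C₀ * z.snd.snd)
          ring }
  let T' : WithLp 2 (WithLp 2 (E × ℝ) × WithLp 2 (E × ℝ)) →L[ℝ]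
      WithLp 2 (WithLp 2 (E × ℝ) × WithLp 2 (E × ℝ)) := LinearMap.toContinuousLinearMap
    { toFun := fun z => WithLp.toLp 2
        (WithLp.toLp 2 (0, z.fst.snd - z.snd.snd), WithLp.toLp 2 (0, z.snd.snd - z.fst.snd))
      map_add' := fun z z' => by
        refine WithLp.ofLp_injective 2 (Prod.ext (WithLp.ofLp_injective 2 (Prod.ext ?_ ?_))
          (WithLp.ofLp_injective 2 (Prod.ext ?_ ?_)))
        · exact (add_zero (0 : E)).symm
        · exact add_sub_add_comm z.fst.snd z'.fst.snd z.snd.snd z'.snd.snd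
        · exact (add_zero (0 : E)).symm
        · exact add_sub_add_comm z.snd.snd z'.snd.snd z.fst.snd z'.fst.snd
      map_smul' := fun s z => by
        refine WithLp.ofLp_injective 2 (Prod.ext (WithLp.ofLp_injective 2 (Prod.ext ?_ ?_))
          (WithLp.ofLp_injective 2 (Prod.ext ?_ ?_)))
        · exact (smul_zero s).symm
        · exact (mul_sub s z.fst.snd z.snd.snd).symm
        · exact (smul_zero s).symm
        · exact (mul_sub s z.snd.snd z.fst.snd).symm }
  have hT₀i : ∀ z z', ⟪T₀ z, z'⟫ = ⟪S (z.fst.fst - z.snd.fst), z'.fst.fst - z'.snd.fst⟫ +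
      c₀ * (⟪z.fst.fst, z'.fst.fst⟫ + ⟪z.snd.fst, z'.snd.fst⟫) +
      C₀ * (z.fst.snd * z'.fst.snd + z.snd.snd * z'.snd.snd) := by
    intro z z'
    have e : ⟪T₀ z, z'⟫ = ⟪S (z.fst.fst - z.snd.fst) + c₀ • z.fst.fst, z'.fst.fst⟫ +
      z'.fst.snd * (C₀ * z.fst.snd) + (⟪S (z.snd.fst - z.fst.fst) + c₀ • z.snd.fst, z'.snd.fst⟫ +
      z'.snd.snd * (C₀ * z.snd.snd)) := rfl
    have e' : S (z.snd.fst - z.fst.fst) = - S (z.fst.fst - z.snd.fst) := by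
      rw [← map_neg, neg_sub]
    rw [e, e']
    simp only [inner_add_left, inner_sub_right, inner_neg_left, real_inner_smul_left]
    ring
  have hT'i : ∀ z z', ⟪T' z, z'⟫ = (z.fst.snd - z.snd.snd) * (z'.fst.snd - z'.snd.snd) := by
    intro z z'
    have e : ⟪T' z, z'⟫ = ⟪(0 : E), z'.fst.fst⟫ + z'.fst.snd * (z.fst.snd - z.snd.snd) +
      (⟪(0 : E), z'.snd.fst⟫ + z'.snd.snd * (z.snd.snd - z.fst.snd)) := rfl
    rw [e, inner_zero_left, inner_zero_left]
    ring
  let l : WithLp 2 (WithLp 2 (E × ℝ) × WithLp 2 (E × ℝ)) :=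
    WithLp.toLp 2 (WithLp.toLp 2 (p₁, τ / 2), WithLp.toLp 2 (p₂, τ / 2))
  have hl : ∀ z, ⟪l, z⟫ = ⟪p₁, z.fst.fst⟫ + ⟪p₂, z.snd.fst⟫ + τ / 2 * (z.fst.snd + z.snd.snd) := by
    intro z
    have e : ⟪l, z⟫ = ⟪p₁, z.fst.fst⟫ + z.fst.snd * (τ / 2) +
      (⟪p₂, z.snd.fst⟫ + z.snd.snd * (τ / 2)) := rfl
    rw [e]; ring
  obtain ⟨n, q, z, y₁, y₂, A₁, A₂, hq, hz, hy₁, hy₂, hj₁, hj₂, hA⟩ := exists_superjets_near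
    (f₁ := f w₁ x₀) (f₂ := f w₂ y₀) hBc hB0
    (hfc w₁ x₀ r₁ hrr₁ fun q hq => (hb₁ q hq).1) (hfc w₂ y₀ r₂ hrr₂ fun q hq => (hb₂ q hq).1)
    l T₀ T'
    (fun z z' => by
      rw [← real_inner_comm z, hT₀i, hT₀i, hS, ← real_inner_comm (S _),
        ← real_inner_comm z.fst.fst, ← real_inner_comm z.snd.fst]
      ring)
    (fun z z' => by rw [← real_inner_comm z, hT'i, hT'i]; ring)
    (fun z => by rw [hT'i]; exact mul_self_nonneg _)
    (fun z hz₁ hz₂ hzT hle => by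
      rw [hT'i, mul_self_eq_zero, sub_eq_zero] at hzT
      have e1 := hb₃ (x₀ + z.fst.fst, y₀ + z.snd.fst, t₀ + z.fst.snd) (by
        obtain ⟨e1, e2⟩ := hBle _ hz₁
        obtain ⟨e3, e4⟩ := hBle _ hz₂
        rw [mem_ball, Prod.dist_eq, Prod.dist_eq, max_lt_iff, max_lt_iff, dist_eq_norm,
          dist_eq_norm, dist_eq_norm]
        simp only [add_sub_cancel_left]
        exact ⟨e1.trans_lt hrr₃, e3.trans_lt hrr₃, e2.trans_lt hrr₃⟩)
      simp only [add_sub_cancel_left] at e1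
      have e2 : f w₁ x₀ 0 = w₁ x₀ t₀ := by
        change w₁ (x₀ + 0) (t₀ + 0) = _
        rw [add_zero, add_zero]
      have e3 : f w₂ y₀ 0 = w₂ y₀ t₀ := by
        change w₂ (y₀ + 0) (t₀ + 0) = _
        rw [add_zero, add_zero]
      have e4 : f w₂ y₀ z.snd = w₂ (y₀ + z.snd.fst) (t₀ + z.fst.snd) := by
        rw [hzT]
      have e5 : f w₁ x₀ z.fst = w₁ (x₀ + z.fst.fst) (t₀ + z.fst.snd) := rfl
      rw [e2, e3, e4, e5, hl, hT₀i, ← hzT, real_inner_self_eq_norm_sq,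
        real_inner_self_eq_norm_sq] at hle
      simp only [doubledForm] at e1
      have e6 : C * z.fst.snd ^ 2 ≤ |C| * z.fst.snd ^ 2 := by
        gcongr; exact le_abs_self C
      have e7 : η * (‖z.fst.fst‖ ^ 2 + ‖z.snd.fst‖ ^ 2) + z.fst.snd ^ 2 ≤ 0 := by
        rw [hc₀, hC₀] at hle
        nlinarith
      have e8 : 0 ≤ η * ‖z.fst.fst‖ ^ 2 := by positivity
      have e9 : 0 ≤ η * ‖z.snd.fst‖ ^ 2 := by positivity
      have s1 : z.fst.fst = 0 := by
        have : η * ‖z.fst.fst‖ ^ 2 = 0 := by nlinarith [sq_nonneg z.fst.snd]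
        simpa [hη.ne'] using this
      have s2 : z.snd.fst = 0 := by
        have : η * ‖z.snd.fst‖ ^ 2 = 0 := by nlinarith [sq_nonneg z.fst.snd]
        simpa [hη.ne'] using this
      have s3 : z.fst.snd = 0 := by
        have : z.fst.snd ^ 2 = 0 := by nlinarith [sq_nonneg z.fst.snd]
        simpa using this
      refine WithLp.ofLp_injective 2 (Prod.ext (WithLp.ofLp_injective 2 (Prod.ext s1 s3))
          (WithLp.ofLp_injective 2 (Prod.ext s2 (hzT.symm.trans s3)))))
    (δ := min r (δ / (2 * (‖T₀‖ + 1)))) (by positivity)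
  have hqr := hq.trans_le (min_le_right _ _)
  have hzr := hz.trans_le (min_le_right _ _)
  have hy₁B : y₁ ∈ B := by
    rw [mem_closedBall, dist_zero_right]; exact hy₁.le.trans (min_le_left _ _)
  have hy₂B : y₂ ∈ B := by
    rw [mem_closedBall, dist_zero_right]; exact hy₂.le.trans (min_le_left _ _)
  obtain ⟨ν₁, hν₁, hνm₁, hi₁⟩ := IsJetSub.of_superjet (ι := ι) hp hη
    (hb₁ _ (hmem x₀ r₁ hrr₁ y₁ hy₁B)).2 (hj₁ η hη)
  obtain ⟨ν₂, hν₂, hνm₂, hi₂⟩ := IsJetSub.of_superjet (ι := ι) hp hη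
    (hb₂ _ (hmem y₀ r₂ hrr₂ y₂ hy₂B)).2 (hj₂ η hη)
  set m := l + (T₀ + (n : ℝ) • T') z + q with hm
  have hsmall : ‖T₀ z + q‖ < δ / 2 := by
    calc ‖T₀ z + q‖ ≤ ‖T₀‖ * ‖z‖ + ‖q‖ := (norm_add_le _ _).trans (by gcongr; exact T₀.le_opNorm z)
      _ < ‖T₀‖ * (δ / (2 * (‖T₀‖ + 1))) + δ / (2 * (‖T₀‖ + 1)) :=
        add_lt_add_of_le_of_lt (by gcongr) hqr
      _ = δ / 2 := by field_simp
  have hfst : ∀ v : WithLp 2 (WithLp 2 (E × ℝ) × WithLp 2 (E × ℝ)), ‖v.fst‖ ≤ ‖v‖ :=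
    fun v => WithLp.norm_fst_le _ v
  have hsnd : ∀ v : WithLp 2 (WithLp 2 (E × ℝ) × WithLp 2 (E × ℝ)), ‖v.snd‖ ≤ ‖v‖ :=
    fun v => WithLp.norm_snd_le _ v
  have hfst' : ∀ v : WithLp 2 (E × ℝ), ‖v.fst‖ ≤ ‖v‖ := fun v => WithLp.norm_fst_le _ v
  have hsnd' : ∀ v : WithLp 2 (E × ℝ), ‖v.snd‖ ≤ ‖v‖ := fun v => WithLp.norm_snd_le _ v
  have m₁ : m.fst.fst = p₁ + ((T₀ z).fst.fst + (n : ℝ) • (0 : E)) + q.fst.fst := rfl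
  have m₂ : m.snd.fst = p₂ + ((T₀ z).snd.fst + (n : ℝ) • (0 : E)) + q.snd.fst := rfl
  have m₃ : m.fst.snd = τ / 2 + ((T₀ z).fst.snd + n * (z.fst.snd - z.snd.snd)) + q.fst.snd := rfl
  have m₄ : m.snd.snd = τ / 2 + ((T₀ z).snd.snd + n * (z.snd.snd - z.fst.snd)) + q.snd.snd := rfl
  refine ⟨ν₁, ν₂, m.fst.fst, m.snd.fst, hν₁, hν₂, ?_, ?_, hνm₁, hνm₂, fun b c => ?_⟩
  · have e : m.fst.fst - p₁ = (T₀ z + q).fst.fst := by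
      rw [m₁, smul_zero]
      change _ = (T₀ z).fst.fst + q.fst.fst
      abel
    rw [e]
    linarith [hfst (T₀ z + q), hfst' (T₀ z + q).fst]
  · have e : m.snd.fst - p₂ = (T₀ z + q).snd.fst := by
      rw [m₂, smul_zero]
      change _ = (T₀ z).snd.fst + q.snd.fst
      abel
    rw [e]
    linarith [hsnd (T₀ z + q), hfst' (T₀ z + q).snd]
  · have e : m.fst.snd + m.snd.snd = τ + (T₀ z + q).fst.snd + (T₀ z + q).snd.snd := by
      rw [m₃, m₄]
      change _ = τ + ((T₀ z).fst.snd + q.fst.snd) + ((T₀ z).snd.snd + q.snd.snd)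
      ring
    have g₁ := (abs_le.1 (hsnd' (T₀ z + q).fst)).1
    have g₂ := (abs_le.1 (hsnd' (T₀ z + q).snd)).1
    have g₃ := hfst (T₀ z + q)
    have g₄ := hsnd (T₀ z + q)
    have hle : τ - δ ≤ m.fst.snd + m.snd.snd := by rw [e]; linarith
    have key := add_le_add (hi₁ b) (hi₂ c)
    rw [add_add_add_comm, ← Finset.sum_add_distrib] at key
    have hk : ∀ k, ⟪A₁ (WithLp.toLp 2 (sqrtDiff p ν₁ (b k), 0)),
          WithLp.toLp 2 (sqrtDiff p ν₁ (b k), 0)⟫ +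
        ⟪A₂ (WithLp.toLp 2 (sqrtDiff p ν₂ (c k), 0)), WithLp.toLp 2 (sqrtDiff p ν₂ (c k), 0)⟫ ≤
        doubledForm S κ (sqrtDiff p ν₁ (b k)) (sqrtDiff p ν₂ (c k)) +
        4 * η * (‖sqrtDiff p ν₁ (b k)‖ ^ 2 + ‖sqrtDiff p ν₂ (c k)‖ ^ 2) := by
      intro k
      set a := sqrtDiff p ν₁ (b k)
      set a' := sqrtDiff p ν₂ (c k)
      have := hA (WithLp.toLp 2 (WithLp.toLp 2 (a, 0), WithLp.toLp 2 (a', 0)))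
      refine this.trans (le_of_eq ?_)
      rw [add_apply, smul_apply, inner_add_left, real_inner_smul_left, hT₀i, hT'i]
      change ⟪S (a - a'), a - a'⟫ + c₀ * (⟪a, a⟫ + ⟪a', a'⟫) + C₀ * (0 * 0 + 0 * 0) +
        n * ((0 - 0) * (0 - 0)) = _
      rw [real_inner_self_eq_norm_sq, real_inner_self_eq_norm_sq, doubledForm]
      ring
    have hsum := Finset.sum_le_sum fun k (_ : k ∈ Finset.univ) => hk k
    simp only [Finset.sum_add_distrib, ← Finset.mul_sum, sum_norm_sqrtDiff hp b ν₁ hν₁,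
      sum_norm_sqrtDiff hp c ν₂ hν₂] at hsum
    have : p * (τ - δ) ≤ p * (m.fst.snd + m.snd.snd) := by gcongr
    simp only [Finset.sum_add_distrib] at key ⊢
    linarith

end Doubling

section Doubling

variable {E : Type*} [NormedAddCommGroup E] [InnerProductSpace ℝ E] {ι : Type*} [Fintype ι]

theorem direction_of_tendsto {P : E} {m ν : ℕ → E} {ν₀ : E} (hm : Tendsto m atTop (𝓝 P))
    (hν : Tendsto ν atTop (𝓝 ν₀)) (h : ∀ n, m n ≠ 0 → ν n = ‖m n‖⁻¹ • m n) (hP : P ≠ 0) :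
    ν₀ = ‖P‖⁻¹ • P := by
  have h1 : Tendsto (fun n => ‖m n‖⁻¹ • m n) atTop (𝓝 (‖P‖⁻¹ • P)) :=
    (hm.norm.inv₀ (norm_ne_zero_iff.2 hP)).smul hm
  refine tendsto_nhds_unique (hν.congr' ?_) h1
  filter_upwards [hm.eventually_ne hP] with n hn using h n hn

theorem continuous_sqrtDiff (p : ℝ) (v : E) : Continuous fun ν : E => sqrtDiff p ν v := by
  unfold sqrtDiff
  fun_prop

set_option maxHeartbeats 1000000 in
/-- Doubling of variables: the elliptic inclusion at a maximum of `w₁ + w₂` minus a cost with a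
given second order expansion. -/
theorem exists_inclusion [FiniteDimensional ℝ E] {p : ℝ} (hp : 1 < p) {w₁ w₂ : E → ℝ → ℝ}
    {x₀ y₀ : E} {t₀ : ℝ}
    (hw₁ : ∀ᶠ q in 𝓝 (x₀, t₀), ContinuousAt (fun q : E × ℝ => w₁ q.1 q.2) q ∧
      IsJetSub p w₁ q.1 q.2)
    (hw₂ : ∀ᶠ q in 𝓝 (y₀, t₀), ContinuousAt (fun q : E × ℝ => w₂ q.1 q.2) q ∧
      IsJetSub p w₂ q.1 q.2)
    {S : E →L[ℝ] E} (hS : ∀ v v', ⟪S v, v'⟫ = ⟪v, S v'⟫) {κ τ : ℝ} {p₁ p₂ : E}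
    (hmax : ∀ η > 0, ∃ C : ℝ, ∀ᶠ q : E × E × ℝ in 𝓝 (x₀, y₀, t₀), w₁ q.1 q.2.2 + w₂ q.2.1 q.2.2 ≤
      w₁ x₀ t₀ + w₂ y₀ t₀ + ⟪p₁, q.1 - x₀⟫ + ⟪p₂, q.2.1 - y₀⟫ + τ * (q.2.2 - t₀) +
      doubledForm S κ (q.1 - x₀) (q.2.1 - y₀) / 2 +
      η * (‖q.1 - x₀‖ ^ 2 + ‖q.2.1 - y₀‖ ^ 2) + C * (q.2.2 - t₀) ^ 2) :
    ∃ ν₁ ν₂ : E, ‖ν₁‖ = 1 ∧ ‖ν₂‖ = 1 ∧ (p₁ ≠ 0 → ν₁ = ‖p₁‖⁻¹ • p₁) ∧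
      (p₂ ≠ 0 → ν₂ = ‖p₂‖⁻¹ • p₂) ∧ ∀ b c : OrthonormalBasis ι ℝ E, p * τ ≤
        ∑ k, doubledForm S κ (sqrtDiff p ν₁ (b k)) (sqrtDiff p ν₂ (c k)) := by
  let η : ℕ → ℝ := fun n => 1 / ((n : ℝ) + 1)
  have hη : ∀ n, 0 < η n := fun n => by positivity
  have hη0 : Tendsto η atTop (𝓝 0) := tendsto_one_div_add_atTop_nhds_zero_nat
  choose! C hC using hmax
  choose ν₁ ν₂ m₁ m₂ hν₁ hν₂ hm₁ hm₂ hd₁ hd₂ hi using fun n =>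
    exists_inclusion_approx (ι := ι) hp hw₁ hw₂ hS (hη n) (hC (η n) (hη n)) (hη n)
  obtain ⟨⟨a₁, a₂⟩, ⟨ha₁, ha₂⟩, φ, hφ, hlim⟩ :=
    ((isCompact_sphere (0 : E) 1).prod (isCompact_sphere (0 : E) 1)).tendsto_subseq
      (x := fun n => (ν₁ n, ν₂ n)) fun n => ⟨by simpa using hν₁ n, by simpa using hν₂ n⟩
  have l₁ : Tendsto (fun n => ν₁ (φ n)) atTop (𝓝 a₁) := (continuous_fst.tendsto _).comp hlim
  have l₂ : Tendsto (fun n => ν₂ (φ n)) atTop (𝓝 a₂) := (continuous_snd.tendsto _).comp hlim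
  have hηφ := hη0.comp hφ.tendsto_atTop
  have hm : ∀ {m : ℕ → E} {P : E}, (∀ n, ‖m n - P‖ < η n) →
      Tendsto (fun n => m (φ n)) atTop (𝓝 P) := fun {m P} h => by
    rw [tendsto_iff_norm_sub_tendsto_zero]
    exact squeeze_zero (fun _ => norm_nonneg _) (fun n => (h (φ n)).le) hηφ
  refine ⟨a₁, a₂, by simpa using ha₁, by simpa using ha₂,
    direction_of_tendsto (hm hm₁) l₁ fun n => hd₁ (φ n),
    direction_of_tendsto (hm hm₂) l₂ fun n => hd₂ (φ n), fun b c => ?_⟩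
  have r₁ : Tendsto (fun n => p * (τ - η (φ n))) atTop (𝓝 (p * (τ - 0))) :=
    (hηφ.const_sub τ).const_mul p
  rw [sub_zero] at r₁
  have hc : Continuous fun z : E × E => doubledForm S κ z.1 z.2 := by
    unfold doubledForm; fun_prop
  have hk : ∀ k, Tendsto (fun n => doubledForm S κ (sqrtDiff p (ν₁ (φ n)) (b k))
      (sqrtDiff p (ν₂ (φ n)) (c k))) atTop
      (𝓝 (doubledForm S κ (sqrtDiff p a₁ (b k)) (sqrtDiff p a₂ (c k)))) := fun k =>
    (hc.tendsto (sqrtDiff p a₁ (b k), sqrtDiff p a₂ (c k))).comp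
      ((((continuous_sqrtDiff p (b k)).tendsto a₁).comp l₁).prodMk_nhds
        (((continuous_sqrtDiff p (c k)).tendsto a₂).comp l₂))
  have r₂ := (tendsto_finsetSum Finset.univ fun k _ => hk k).add
    ((hηφ.const_mul 16).mul_const (Module.finrank ℝ E + p - 2 : ℝ))
  rw [mul_zero, zero_mul, add_zero] at r₂
  exact le_of_tendsto_of_tendsto' r₁ r₂ fun n => hi (φ n) b c

end Doubling

section Taylor

theorem abs_sub_sub_le_of_hasDerivAt {f d : ℝ → ℝ} {a b c C : ℝ}
    (hd : ∀ s ∈ uIcc a b, HasDerivAt f (d s) s) (hC : ∀ s ∈ uIcc a b, |d s - c| ≤ C) :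
    |f b - f a - c * (b - a)| ≤ C * |b - a| := by
  have h := (convex_uIcc a b).norm_image_sub_le_of_norm_hasDerivWithin_le
    (f := fun s => f s - c * s) (f' := fun s => d s - c) (C := C)
    (fun s hs => ((hd s hs).sub (by simpa using (hasDerivAt_id s).const_mul c)).hasDerivWithinAt)
    (fun s hs => hC s hs) left_mem_uIcc right_mem_uIcc
  rw [Real.norm_eq_abs, Real.norm_eq_abs] at h
  convert h using 2
  ring

theorem eventually_uIcc_of_eventually {P : ℝ → Prop} {a : ℝ} (h : ∀ᶠ s in 𝓝 a, P s) :
    ∀ᶠ b in 𝓝 a, ∀ s ∈ uIcc a b, P s := by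
  obtain ⟨r, hr, hb⟩ := Metric.eventually_nhds_iff_ball.1 h
  filter_upwards [ball_mem_nhds a hr] with b hbr s hs
  refine hb s ?_
  rw [mem_ball, Real.dist_eq] at hbr ⊢
  exact (abs_sub_left_of_mem_uIcc hs).trans_lt hbr

theorem eventually_le_taylor_two_real {f d : ℝ → ℝ} {a c η : ℝ} (hη : 0 < η)
    (hf : ∀ᶠ s in 𝓝 a, HasDerivAt f (d s) s) (hd : HasDerivAt d c a) :
    ∀ᶠ b in 𝓝 a, f b ≤ f a + d a * (b - a) + c / 2 * (b - a) ^ 2 + η * (b - a) ^ 2 := by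
  have h1 := (hasDerivAt_iff_isLittleO.1 hd).bound hη
  filter_upwards [eventually_uIcc_of_eventually hf, eventually_uIcc_of_eventually h1] with b hb hb1
  have hder : ∀ s ∈ uIcc a b, HasDerivAt (fun s => f s - c / 2 * (s - a) ^ 2)
      (d s - c * (s - a)) s := fun s hs => by
    have e := ((((hasDerivAt_id s).sub_const a).pow 2).const_mul (c / 2))
    refine ((hb s hs).sub e).congr_deriv ?_
    simp only [id]; norm_num; ring
  have h2 := abs_sub_sub_le_of_hasDerivAt hder (c := d a) (C := η * |b - a|) (fun s hs => by
    have := hb1 s hs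
    rw [Real.norm_eq_abs, Real.norm_eq_abs, smul_eq_mul] at this
    have e : d s - c * (s - a) - d a = d s - d a - (s - a) * c := by ring
    rw [e]
    exact this.trans (by gcongr η * ?_; exact abs_sub_left_of_mem_uIcc hs))
  have h3 := (abs_le.1 h2).2
  have h4 : |b - a| * |b - a| = (b - a) ^ 2 := by rw [abs_mul_abs_self]; ring
  rw [mul_assoc, h4] at h3
  simp only [sub_self] at h3
  linarith

/-- Second order Taylor bound in the first variable and first order in the second one. -/
theorem exists_eventually_le_taylor {G : ℝ → ℝ → ℝ} {d : ℝ → ℝ} {g : ℝ × ℝ → ℝ} {a t c : ℝ}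
    (hd : ∀ᶠ s in 𝓝 a, HasDerivAt (fun r => G r t) (d s) s) (hc : HasDerivAt d c a)
    (hg : ∀ᶠ q in 𝓝 (a, t), HasDerivAt (fun s => G q.1 s) (g q) q.2)
    (hg' : DifferentiableAt ℝ g (a, t)) {η : ℝ} (hη : 0 < η) :
    ∃ C : ℝ, ∀ᶠ q : ℝ × ℝ in 𝓝 (a, t), G q.1 q.2 ≤ G a t + d a * (q.1 - a) +
      c / 2 * (q.1 - a) ^ 2 + g (a, t) * (q.2 - t) + η * (q.1 - a) ^ 2 + C * (q.2 - t) ^ 2 := by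
  have hη2 : 0 < η / 2 := by positivity
  have h1 := (continuous_fst.tendsto (a, t)).eventually (eventually_le_taylor_two_real hη2 hd hc)
  obtain ⟨L, hL⟩ := hg'.hasFDerivAt.isBigO_sub.bound
  obtain ⟨r, hr, hb⟩ := Metric.eventually_nhds_iff_ball.1 (hg.and hL)
  refine ⟨L ^ 2 / (2 * η) + |L|, ?_⟩
  filter_upwards [h1, ball_mem_nhds (a, t) hr] with q hq1 hq2
  have hseg : ∀ s ∈ uIcc t q.2, (q.1, s) ∈ ball (a, t) r := fun s hs => by
    rw [mem_ball, Prod.dist_eq, max_lt_iff] at hq2 ⊢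
    exact ⟨hq2.1, (abs_sub_left_of_mem_uIcc hs).trans_lt hq2.2⟩
  have h2 := abs_sub_sub_le_of_hasDerivAt (f := fun s => G q.1 s) (d := fun s => g (q.1, s))
    (c := g (a, t)) (C := |L| * (|q.1 - a| + |q.2 - t|)) (fun s hs => (hb _ (hseg s hs)).1)
    (fun s hs => by
      refine (hb _ (hseg s hs)).2.trans ?_
      have : ‖(q.1, s) - (a, t)‖ ≤ |q.1 - a| + |q.2 - t| := by
        refine (norm_prod_le_iff.2 ⟨?_, ?_⟩)
        · exact le_add_of_nonneg_right (abs_nonneg _)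
        · exact (abs_sub_left_of_mem_uIcc hs).trans (le_add_of_nonneg_left (abs_nonneg _))
      exact mul_le_mul (le_abs_self L) this (norm_nonneg _) (abs_nonneg _))
  have h3 := (abs_le.1 h2).2
  set δ := |q.1 - a| with hδ
  set θ := |q.2 - t| with hθ
  have e1 : δ ^ 2 = (q.1 - a) ^ 2 := sq_abs _
  have e2 : θ ^ 2 = (q.2 - t) ^ 2 := sq_abs _
  have h4 : |L| * δ * θ ≤ η / 2 * δ ^ 2 + L ^ 2 / (2 * η) * θ ^ 2 := by
    have : 0 ≤ (η * δ - |L| * θ) ^ 2 / (2 * η) := by positivity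
    have e : (η * δ - |L| * θ) ^ 2 / (2 * η) =
      η / 2 * δ ^ 2 + |L| ^ 2 / (2 * η) * θ ^ 2 - |L| * δ * θ := by field_simp; ring
    have e3 : |L| ^ 2 = L ^ 2 := sq_abs L
    rw [e3] at e
    linarith
  rw [← e1] at hq1
  rw [← e1, ← e2]
  nlinarith

end Taylor

section Radial

variable {E : Type*} [NormedAddCommGroup E] [InnerProductSpace ℝ E] {ι : Type*} [Fintype ι]

set_option maxHeartbeats 1000000 in
/-- Doubling of variables with a cost `G (|x - y|²) t + κ |x|² + κ |y|²`. -/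
theorem exists_inclusion_radial [FiniteDimensional ℝ E] {p : ℝ} (hp : 1 < p) {w₁ w₂ : E → ℝ → ℝ}
    {x₀ y₀ : E} {t₀ : ℝ}
    (hw₁ : ∀ᶠ q in 𝓝 (x₀, t₀), ContinuousAt (fun q : E × ℝ => w₁ q.1 q.2) q ∧
      IsJetSub p w₁ q.1 q.2)
    (hw₂ : ∀ᶠ q in 𝓝 (y₀, t₀), ContinuousAt (fun q : E × ℝ => w₂ q.1 q.2) q ∧
      IsJetSub p w₂ q.1 q.2)
    {G : ℝ → ℝ → ℝ} {κ h₁ h₂ τ : ℝ}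
    (hG : ∀ η > 0, ∃ C : ℝ, ∀ᶠ q : ℝ × ℝ in 𝓝 (‖x₀ - y₀‖ ^ 2, t₀), G q.1 q.2 ≤
      G (‖x₀ - y₀‖ ^ 2) t₀ + h₁ * (q.1 - ‖x₀ - y₀‖ ^ 2) + h₂ / 2 * (q.1 - ‖x₀ - y₀‖ ^ 2) ^ 2 +
      τ * (q.2 - t₀) + η * (q.1 - ‖x₀ - y₀‖ ^ 2) ^ 2 + C * (q.2 - t₀) ^ 2)
    (hmax : ∀ᶠ q : E × E × ℝ in 𝓝 (x₀, y₀, t₀), w₁ q.1 q.2.2 + w₂ q.2.1 q.2.2 -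
      G (‖q.1 - q.2.1‖ ^ 2) q.2.2 - κ * ‖q.1‖ ^ 2 - κ * ‖q.2.1‖ ^ 2 ≤
      w₁ x₀ t₀ + w₂ y₀ t₀ - G (‖x₀ - y₀‖ ^ 2) t₀ - κ * ‖x₀‖ ^ 2 - κ * ‖y₀‖ ^ 2) :
    ∃ ν₁ ν₂ : E, ‖ν₁‖ = 1 ∧ ‖ν₂‖ = 1 ∧
      ((2 * h₁) • (x₀ - y₀) + (2 * κ) • x₀ ≠ 0 →
        ν₁ = ‖(2 * h₁) • (x₀ - y₀) + (2 * κ) • x₀‖⁻¹ • ((2 * h₁) • (x₀ - y₀) + (2 * κ) • x₀)) ∧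
      (-(2 * h₁) • (x₀ - y₀) + (2 * κ) • y₀ ≠ 0 →
        ν₂ = ‖-(2 * h₁) • (x₀ - y₀) + (2 * κ) • y₀‖⁻¹ •
          (-(2 * h₁) • (x₀ - y₀) + (2 * κ) • y₀)) ∧
      ∀ b c : OrthonormalBasis ι ℝ E, p * τ ≤
        ∑ k, (2 * h₁ * ‖sqrtDiff p ν₁ (b k) - sqrtDiff p ν₂ (c k)‖ ^ 2 +
          4 * h₂ * ⟪x₀ - y₀, sqrtDiff p ν₁ (b k) - sqrtDiff p ν₂ (c k)⟫ ^ 2 +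
          2 * κ * (‖sqrtDiff p ν₁ (b k)‖ ^ 2 + ‖sqrtDiff p ν₂ (c k)‖ ^ 2)) := by
  set z := x₀ - y₀ with hz
  let S : E →L[ℝ] E := (2 * h₁) • ContinuousLinearMap.id ℝ E +
    (4 * h₂) • (innerSL ℝ z).smulRight z
  have hSv : ∀ v v', ⟪S v, v'⟫ = 2 * h₁ * ⟪v, v'⟫ + 4 * h₂ * (⟪z, v⟫ * ⟪z, v'⟫) := by
    intro v v'
    have e : S v = (2 * h₁) • v + (4 * h₂) • (⟪z, v⟫ • z) := rfl
    rw [e, inner_add_left, real_inner_smul_left, real_inner_smul_left, real_inner_smul_left]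
  have hform : ∀ v v', doubledForm S κ v v' = 2 * h₁ * ‖v - v'‖ ^ 2 +
      4 * h₂ * ⟪z, v - v'⟫ ^ 2 + 2 * κ * (‖v‖ ^ 2 + ‖v'‖ ^ 2) := by
    intro v v'
    rw [doubledForm, hSv, real_inner_self_eq_norm_sq]; ring
  have := exists_inclusion (ι := ι) hp hw₁ hw₂ (S := S) (κ := κ) (τ := τ)
    (p₁ := (2 * h₁) • z + (2 * κ) • x₀) (p₂ := -(2 * h₁) • z + (2 * κ) • y₀)
    (fun v v' => by
      rw [← real_inner_comm v, hSv, hSv, ← real_inner_comm v]; ring) ?_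
  · simpa only [hform] using this
  intro η hη
  obtain ⟨C, hC⟩ := hG (η / (64 * (‖z‖ ^ 2 + 1))) (by positivity)
  refine ⟨C, ?_⟩
  set η' := η / (64 * (‖z‖ ^ 2 + 1)) with hη'
  have hη'0 : 0 < η' := by positivity
  have hη'z : 16 * η' * ‖z‖ ^ 2 ≤ η / 4 := by
    have : η' * (64 * (‖z‖ ^ 2 + 1)) = η := by rw [hη']; field_simp
    nlinarith
  have hT : Tendsto (fun q : E × E × ℝ => (‖q.1 - q.2.1‖ ^ 2, q.2.2)) (𝓝 (x₀, y₀, t₀))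
      (𝓝 (‖z‖ ^ 2, t₀)) := by
    have : Continuous fun q : E × E × ℝ => (‖q.1 - q.2.1‖ ^ 2, q.2.2) := by fun_prop
    exact this.tendsto (x₀, y₀, t₀)
  have hsm : ∀ᶠ q : E × E × ℝ in 𝓝 (x₀, y₀, t₀), (|h₂| / 2 + η') * (4 * ‖z‖ *
      ‖q.1 - q.2.1 - z‖ + ‖q.1 - q.2.1 - z‖ ^ 2) < η / 8 := by
    have : Continuous fun q : E × E × ℝ => (|h₂| / 2 + η') * (4 * ‖z‖ *
      ‖q.1 - q.2.1 - z‖ + ‖q.1 - q.2.1 - z‖ ^ 2) := by fun_prop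
    refine this.tendsto (x₀, y₀, t₀) (Iio_mem_nhds ?_)
    simp only [← hz, sub_self, norm_zero]
    norm_num
    exact hη
  filter_upwards [hmax, hT.eventually hC, hsm] with q hq hq1 hq2
  set v := q.1 - x₀ with hv
  set v' := q.2.1 - y₀ with hv'
  set d := v - v' with hd
  have hx : q.1 = x₀ + v := by rw [hv]; abel
  have hy : q.2.1 = y₀ + v' := by rw [hv']; abel
  have hzd : q.1 - q.2.1 = z + d := by rw [hd, hx, hy, hz]; abel
  rw [hzd, add_sub_cancel_left] at hq2
  rw [hzd] at hq hq1
  have n1 : ‖z + d‖ ^ 2 = ‖z‖ ^ 2 + 2 * ⟪z, d⟫ + ‖d‖ ^ 2 := norm_add_sq_real z d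
  have n2 : ‖q.1‖ ^ 2 = ‖x₀‖ ^ 2 + 2 * ⟪x₀, v⟫ + ‖v‖ ^ 2 := by rw [hx, norm_add_sq_real]
  have n3 : ‖q.2.1‖ ^ 2 = ‖y₀‖ ^ 2 + 2 * ⟪y₀, v'⟫ + ‖v'‖ ^ 2 := by rw [hy, norm_add_sq_real]
  rw [n2, n3] at hq
  have n4 : ‖z + d‖ ^ 2 - ‖z‖ ^ 2 = 2 * ⟪z, d⟫ + ‖d‖ ^ 2 := by rw [n1]; ring
  simp only [n4] at hq1
  have hi : |⟪z, d⟫| ≤ ‖z‖ * ‖d‖ := abs_real_inner_le_norm z d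
  have hdd : ‖d‖ ^ 2 ≤ 2 * (‖v‖ ^ 2 + ‖v'‖ ^ 2) := by
    have := parallelogram_law_with_norm ℝ v v'
    rw [← hd] at this
    nlinarith [sq_nonneg ‖v + v'‖]
  have hcube : (h₂ / 2 + η') * (4 * ⟪z, d⟫ * ‖d‖ ^ 2 + (‖d‖ ^ 2) ^ 2) ≤ η / 8 * ‖d‖ ^ 2 := by
    have e1 : (h₂ / 2 + η') * (4 * ⟪z, d⟫ * ‖d‖ ^ 2 + (‖d‖ ^ 2) ^ 2) ≤
        |h₂ / 2 + η'| * (|4 * ⟪z, d⟫ + ‖d‖ ^ 2|) * ‖d‖ ^ 2 := by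
      rw [← abs_mul]
      have := le_abs_self ((h₂ / 2 + η') * (4 * ⟪z, d⟫ + ‖d‖ ^ 2))
      nlinarith [sq_nonneg ‖d‖]
    have e2 : |h₂ / 2 + η'| ≤ |h₂| / 2 + η' := by
      refine (abs_add_le _ _).trans ?_
      rw [abs_div, abs_of_pos hη'0, abs_two]
    have e3 : |4 * ⟪z, d⟫ + ‖d‖ ^ 2| ≤ 4 * ‖z‖ * ‖d‖ + ‖d‖ ^ 2 := by
      refine (abs_add_le _ _).trans ?_
      rw [abs_mul, abs_of_nonneg (sq_nonneg ‖d‖)]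
      norm_num
      linarith
    refine e1.trans (mul_le_mul_of_nonneg_right (le_trans ?_ hq2.le) (sq_nonneg _))
    exact mul_le_mul e2 e3 (abs_nonneg _) (by positivity)
  have hzd2 : ⟪z, d⟫ ^ 2 ≤ ‖z‖ ^ 2 * ‖d‖ ^ 2 := by
    rw [← mul_pow, ← sq_abs]; gcongr
  have hq3 : 4 * η' * ⟪z, d⟫ ^ 2 ≤ η / 16 * ‖d‖ ^ 2 := by
    have : 4 * η' * ⟪z, d⟫ ^ 2 ≤ 4 * η' * (‖z‖ ^ 2 * ‖d‖ ^ 2) := by gcongr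
    nlinarith [sq_nonneg ‖d‖]
  rw [hform, inner_add_left, inner_add_left, real_inner_smul_left, real_inner_smul_left,
    real_inner_smul_left, real_inner_smul_left]
  have n5 : ⟪z, d⟫ = ⟪z, v⟫ - ⟪z, v'⟫ := by rw [hd, inner_sub_right]
  have n6 : 2 * h₁ * ⟪z, v⟫ + -(2 * h₁) * ⟪z, v'⟫ = 2 * h₁ * ⟪z, d⟫ := by rw [n5]; ring
  have n7 : η / 8 * ‖d‖ ^ 2 + η / 16 * ‖d‖ ^ 2 ≤ η * (‖v‖ ^ 2 + ‖v'‖ ^ 2) := by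
    have := mul_le_mul_of_nonneg_left hdd hη.le
    have : 0 ≤ η * (‖v‖ ^ 2 + ‖v'‖ ^ 2) := by positivity
    linarith
  linarith

end Radial

section Solutions

variable {N : ℕ}

theorem continuous_qform (X : Matrix (Fin N) (Fin N) ℝ) : Continuous (qform X) := by
  unfold qform; fun_prop

theorem qform_smul (X : Matrix (Fin N) (Fin N) ℝ) (r : ℝ) (v : EuclideanSpace ℝ (Fin N)) :
    qform X (r • v) = r ^ 2 * qform X v := by
  simp only [qform, Finset.mul_sum]
  refine Finset.sum_congr rfl fun i _ => Finset.sum_congr rfl fun j _ => ?_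
  simp; ring

theorem exists_qform_eq_lamMax [NeZero N] (X : Matrix (Fin N) (Fin N) ℝ) :
    ∃ v : EuclideanSpace ℝ (Fin N), ‖v‖ = 1 ∧ qform X v = lamMax X := by
  have hne : (sphere (0 : EuclideanSpace ℝ (Fin N)) 1).Nonempty :=
    ⟨EuclideanSpace.single 0 1, by simp⟩
  obtain ⟨v, hv, hmax⟩ := (isCompact_sphere (0 : EuclideanSpace ℝ (Fin N)) 1).exists_isMaxOn hne
    (continuous_qform X).continuousOn
  refine ⟨v, by simpa using hv, ?_⟩
  have hg : IsGreatest {r | ∃ v : EuclideanSpace ℝ (Fin N), ‖v‖ = 1 ∧ r = qform X v} (qform X v) := by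
    refine ⟨⟨v, by simpa using hv, rfl⟩, ?_⟩
    rintro _ ⟨w, hw, rfl⟩
    exact hmax (by simpa using hw)
  exact hg.csSup_eq.symm

theorem exists_qform_eq_lamMin [NeZero N] (X : Matrix (Fin N) (Fin N) ℝ) :
    ∃ v : EuclideanSpace ℝ (Fin N), ‖v‖ = 1 ∧ qform X v = lamMin X := by
  have hne : (sphere (0 : EuclideanSpace ℝ (Fin N)) 1).Nonempty :=
    ⟨EuclideanSpace.single 0 1, by simp⟩
  obtain ⟨v, hv, hmin⟩ := (isCompact_sphere (0 : EuclideanSpace ℝ (Fin N)) 1).exists_isMinOn hne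
    (continuous_qform X).continuousOn
  refine ⟨v, by simpa using hv, ?_⟩
  have hg : IsLeast {r | ∃ v : EuclideanSpace ℝ (Fin N), ‖v‖ = 1 ∧ r = qform X v} (qform X v) := by
    refine ⟨⟨v, by simpa using hv, rfl⟩, ?_⟩
    rintro _ ⟨w, hw, rfl⟩
    exact hmin (by simpa using hw)
  exact hg.csInf_eq.symm

theorem mul_Fop {p : ℝ} (hp : 1 < p) (ξ : EuclideanSpace ℝ (Fin N))
    (X : Matrix (Fin N) (Fin N) ℝ) :
    p * Fop p ξ X = X.trace + (p - 2) * qform X (‖ξ‖⁻¹ • ξ) := by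
  have : p ≠ 0 := by positivity
  rw [Fop, qform_smul]
  field_simp

theorem exists_mul_Fupper_eq [NeZero N] {p : ℝ} (hp : 1 < p) (ξ : EuclideanSpace ℝ (Fin N))
    (X : Matrix (Fin N) (Fin N) ℝ) :
    ∃ ν : EuclideanSpace ℝ (Fin N), ‖ν‖ = 1 ∧ (ξ ≠ 0 → ν = ‖ξ‖⁻¹ • ξ) ∧
      p * Fupper p ξ X = X.trace + (p - 2) * qform X ν := by
  have hp0 : p ≠ 0 := by positivity
  by_cases hξ : ξ = 0
  · rcases le_total 2 p with h | h
    · obtain ⟨ν, hν, e⟩ := exists_qform_eq_lamMax X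
      refine ⟨ν, hν, fun h => absurd hξ h, ?_⟩
      rw [Fupper, if_pos hξ, min_eq_right (by linarith), max_eq_left (by linarith), e]
      field_simp; ring
    · obtain ⟨ν, hν, e⟩ := exists_qform_eq_lamMin X
      refine ⟨ν, hν, fun h => absurd hξ h, ?_⟩
      rw [Fupper, if_pos hξ, min_eq_left (by linarith), max_eq_right (by linarith), e]
      field_simp; ring
  · refine ⟨‖ξ‖⁻¹ • ξ, by rw [norm_smul, norm_inv, norm_norm, inv_mul_cancel₀ (by simpa)],
      fun _ => rfl, ?_⟩
    rw [Fupper, if_neg hξ, mul_Fop hp]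

theorem exists_mul_Flower_eq [NeZero N] {p : ℝ} (hp : 1 < p) (ξ : EuclideanSpace ℝ (Fin N))
    (X : Matrix (Fin N) (Fin N) ℝ) :
    ∃ ν : EuclideanSpace ℝ (Fin N), ‖ν‖ = 1 ∧ (ξ ≠ 0 → ν = ‖ξ‖⁻¹ • ξ) ∧
      p * Flower p ξ X = X.trace + (p - 2) * qform X ν := by
  have hp0 : p ≠ 0 := by positivity
  by_cases hξ : ξ = 0
  · rcases le_total 2 p with h | h
    · obtain ⟨ν, hν, e⟩ := exists_qform_eq_lamMin X
      refine ⟨ν, hν, fun h => absurd hξ h, ?_⟩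
      rw [Flower, if_pos hξ, min_eq_right (by linarith), max_eq_left (by linarith), e]
      field_simp; ring
    · obtain ⟨ν, hν, e⟩ := exists_qform_eq_lamMax X
      refine ⟨ν, hν, fun h => absurd hξ h, ?_⟩
      rw [Flower, if_pos hξ, min_eq_left (by linarith), max_eq_right (by linarith), e]
      field_simp; ring
  · refine ⟨‖ξ‖⁻¹ • ξ, by rw [norm_smul, norm_inv, norm_norm, inv_mul_cancel₀ (by simpa)],
      fun _ => rfl, ?_⟩
    rw [Flower, if_neg hξ, mul_Fop hp]

/-- The quadratic test function with prescribed space-time jet. -/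
def jetPoly (x : EuclideanSpace ℝ (Fin N)) (t : ℝ) (ξ : EuclideanSpace ℝ (Fin N)) (τ : ℝ)
    (X : EuclideanSpace ℝ (Fin N) →L[ℝ] EuclideanSpace ℝ (Fin N)) (C : ℝ)
    (q : EuclideanSpace ℝ (Fin N) × ℝ) : ℝ :=
  ⟪ξ, q.1 - x⟫ + τ * (q.2 - t) + ⟪X (q.1 - x), q.1 - x⟫ / 2 + C * (q.2 - t) ^ 2

variable (x : EuclideanSpace ℝ (Fin N)) (t : ℝ) (ξ : EuclideanSpace ℝ (Fin N)) (τ : ℝ)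
  (X : EuclideanSpace ℝ (Fin N) →L[ℝ] EuclideanSpace ℝ (Fin N)) (C : ℝ)

theorem contDiff_jetPoly : ContDiff ℝ 2 (jetPoly x t ξ τ X C) := by
  have h0 : ContDiff ℝ 2 fun q : EuclideanSpace ℝ (Fin N) × ℝ => q.1 - x := by fun_prop
  have h1 := (X.contDiff.comp h0).inner ℝ h0
  have h2 := (contDiff_const (c := ξ)).inner ℝ h0
  have h3 : ContDiff ℝ 2 fun q : EuclideanSpace ℝ (Fin N) × ℝ => q.2 - t := by fun_prop
  exact ((h2.add (contDiff_const.mul h3)).add (h1.div_const 2)).add (contDiff_const.mul (h3.pow 2))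

theorem deriv_jetPoly : deriv (fun s => jetPoly x t ξ τ X C (x, s)) t = τ := by
  have h1 := (((hasDerivAt_id t).sub_const t).const_mul τ)
  have h2 := ((((hasDerivAt_id t).sub_const t).pow 2).const_mul C)
  have h3 : HasDerivAt (fun s => jetPoly x t ξ τ X C (x, s)) τ t := by
    refine ((h1.add h2).congr_deriv ?_).congr_of_eventuallyEq (Eventually.of_forall fun s => ?_)
    · simp
    · simp [jetPoly]
  exact h3.deriv

/-- The symmetric bilinear form associated with an operator. -/
def symBilin : EuclideanSpace ℝ (Fin N) →L[ℝ] EuclideanSpace ℝ (Fin N) →L[ℝ] ℝ :=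
  let B : EuclideanSpace ℝ (Fin N) →L[ℝ] EuclideanSpace ℝ (Fin N) →L[ℝ] ℝ := (innerSL ℝ).comp X
  (2⁻¹ : ℝ) • (B + B.flip)

theorem symBilin_apply (v w : EuclideanSpace ℝ (Fin N)) :
    symBilin X v w = (⟪X v, w⟫ + ⟪X w, v⟫) / 2 := by
  change 2⁻¹ * (⟪X v, w⟫ + ⟪X w, v⟫) = _
  ring

theorem hasFDerivAt_jetPoly (y : EuclideanSpace ℝ (Fin N)) :
    HasFDerivAt (fun y => jetPoly x t ξ τ X C (y, t)) (innerSL ℝ ξ + symBilin X (y - x)) y := by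
  have h0 : HasFDerivAt (fun y : EuclideanSpace ℝ (Fin N) => y - x)
    (ContinuousLinearMap.id ℝ _) y := (hasFDerivAt_id y).sub_const x
  have h1 := (innerSL ℝ ξ).hasFDerivAt.comp y h0
  have h2 := ((X.hasFDerivAt.comp y h0).inner ℝ h0).mul_const (2⁻¹ : ℝ)
  refine ((h1.add h2).congr_fderiv ?_).congr_of_eventuallyEq (Eventually.of_forall fun s => ?_)
  · ext v
    rw [add_apply, add_apply, symBilin_apply]
    simp
    rw [real_inner_comm v]
    ring
  · simp [jetPoly]; ring

theorem gradient_jetPoly : gradient (fun y => jetPoly x t ξ τ X C (y, t)) x = ξ := by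
  have h := hasFDerivAt_jetPoly x t ξ τ X C x
  rw [sub_self, map_zero, add_zero] at h
  have : HasGradientAt (fun y => jetPoly x t ξ τ X C (y, t)) ξ x := h
  exact this.gradient

theorem hess_jetPoly (i j : Fin N) : hess (fun y => jetPoly x t ξ τ X C (y, t)) x i j =
    symBilin X (EuclideanSpace.single i 1) (EuclideanSpace.single j 1) := by
  have h : fderiv ℝ (fun y => jetPoly x t ξ τ X C (y, t)) =
      fun y => innerSL ℝ ξ + symBilin X (y - x) :=
    funext fun y => (hasFDerivAt_jetPoly x t ξ τ X C y).fderiv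
  have h2 : HasFDerivAt (fun y => innerSL ℝ ξ + symBilin X (y - x)) (symBilin X) x :=
    (HasFDerivAt.comp (f := fun y => y - x) x (symBilin X).hasFDerivAt
      ((hasFDerivAt_id x).sub_const x)).const_add _
  rw [hess, iteratedFDeriv_two_apply, h, h2.fderiv]
  rfl

theorem trace_hess_jetPoly :
    (hess (fun y => jetPoly x t ξ τ X C (y, t)) x).trace =
      LinearMap.trace ℝ (EuclideanSpace ℝ (Fin N)) X := by
  rw [LinearMap.trace_eq_sum_inner _ (EuclideanSpace.basisFun (Fin N) ℝ), Matrix.trace]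
  refine Finset.sum_congr rfl fun i _ => ?_
  rw [Matrix.diag_apply, hess_jetPoly, symBilin_apply, EuclideanSpace.basisFun_apply,
    add_self_div_two, real_inner_comm]
  rfl

theorem qform_hess_jetPoly (v : EuclideanSpace ℝ (Fin N)) :
    qform (hess (fun y => jetPoly x t ξ τ X C (y, t)) x) v = ⟪X v, v⟫ := by
  have hv : v = ∑ i, v i • EuclideanSpace.single i (1 : ℝ) := by
    simpa using ((EuclideanSpace.basisFun (Fin N) ℝ).sum_repr v).symm
  have h : symBilin X v v = ⟪X v, v⟫ := by rw [symBilin_apply]; ring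
  rw [← h]
  conv_rhs => rw [hv]
  simp only [map_sum, map_smul, sum_apply, smul_apply, Finset.smul_sum]
  simp only [qform, hess_jetPoly, smul_eq_mul]
  rw [Finset.sum_comm]
  exact Finset.sum_congr rfl fun i _ => Finset.sum_congr rfl fun j _ => by ring

theorem IsViscositySol.isJetSub [NeZero N] {p : ℝ} (hp : 1 < p)
    {Ω : Set (EuclideanSpace ℝ (Fin N))} {u : EuclideanSpace ℝ (Fin N) → ℝ → ℝ}
    (hu : IsViscositySol p Ω u) {x : EuclideanSpace ℝ (Fin N)} {t : ℝ} (hx : x ∈ Ω) (ht : 0 < t) :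
    IsJetSub p u x t := by
  intro ξ τ X C h
  have h1 := hu.2.1 _ (contDiff_jetPoly x t ξ τ X C) x hx t ht ?_
  · obtain ⟨ν, hν, hξ, e⟩ := exists_mul_Fupper_eq hp ξ
      (hess (fun y => jetPoly x t ξ τ X C (y, t)) x)
    refine ⟨ν, hν, hξ, ?_⟩
    rw [deriv_jetPoly, gradient_jetPoly] at h1
    rw [trace_hess_jetPoly, qform_hess_jetPoly] at e
    rw [← e]
    gcongr
  · refine (h.filter_mono nhdsWithin_le_nhds).mono fun q hq => ?_
    simp only [jetPoly, sub_self, map_zero, inner_zero_right, mul_zero]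
    linarith

theorem IsViscositySol.isJetSub_neg [NeZero N] {p : ℝ} (hp : 1 < p)
    {Ω : Set (EuclideanSpace ℝ (Fin N))} {u : EuclideanSpace ℝ (Fin N) → ℝ → ℝ}
    (hu : IsViscositySol p Ω u) {x : EuclideanSpace ℝ (Fin N)} {t : ℝ} (hx : x ∈ Ω) (ht : 0 < t) :
    IsJetSub p (fun x t => -u x t) x t := by
  intro ξ τ X C h
  have h1 := hu.2.2 _ (contDiff_jetPoly x t (-ξ) (-τ) (-X) (-C)) x hx t ht ?_
  · obtain ⟨ν, hν, hξ, e⟩ := exists_mul_Flower_eq hp (-ξ)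
      (hess (fun y => jetPoly x t (-ξ) (-τ) (-X) (-C) (y, t)) x)
    refine ⟨-ν, by rwa [norm_neg], fun h => ?_, ?_⟩
    · rw [hξ (neg_ne_zero.2 h), norm_neg, smul_neg, neg_neg]
    rw [deriv_jetPoly, gradient_jetPoly] at h1
    rw [trace_hess_jetPoly, qform_hess_jetPoly] at e
    have h2 := mul_le_mul_of_nonneg_left h1 (by linarith : 0 ≤ p)
    have e2 : LinearMap.trace ℝ (EuclideanSpace ℝ (Fin N)) (-X : _ →L[ℝ] _) =
      -LinearMap.trace ℝ (EuclideanSpace ℝ (Fin N)) X := map_neg _ _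
    rw [e, e2, neg_apply, inner_neg_left] at h2
    rw [map_neg, inner_neg_left, inner_neg_right, neg_neg]
    linarith
  · refine (h.filter_mono nhdsWithin_le_nhds).mono fun q hq => ?_
    simp only [jetPoly, sub_self, map_zero, inner_zero_right, mul_zero, neg_apply, inner_neg_left]
    linarith

end Solutions

section JetCalculus

variable {E : Type*} [NormedAddCommGroup E] [InnerProductSpace ℝ E] {p : ℝ} {w w' : E → ℝ → ℝ}
  {x : E} {t : ℝ}

theorem IsJetSub.of_le (hw : IsJetSub p w x t)
    (h : ∀ᶠ q in 𝓝 (x, t), w q.1 q.2 ≤ w' q.1 q.2) (he : w' x t = w x t) : IsJetSub p w' x t := by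
  intro ξ τ X C hq
  refine hw ξ τ X C ?_
  filter_upwards [h, hq] with q h1 h2
  rw [he] at h2
  exact h1.trans h2

theorem IsJetSub.add_const (hw : IsJetSub p w x t) (c : ℝ) :
    IsJetSub p (fun x t => w x t + c) x t := by
  intro ξ τ X C hq
  refine hw ξ τ X C (hq.mono fun q h => ?_)
  linarith

theorem nonneg_of_eventually_nonneg_quadratic {a b : ℝ} (h : ∀ᶠ s in 𝓝 (0 : ℝ), 0 ≤ a * s + b * s ^ 2) :
    a = 0 ∧ 0 ≤ b := by
  obtain ⟨r, hr, hb⟩ := Metric.eventually_nhds_iff_ball.1 h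
  have key : ∀ s, |s| < r → 0 ≤ a * s + b * s ^ 2 := fun s hs => hb s (by simpa using hs)
  have ha : a = 0 := by
    have h1 : Tendsto (fun s : ℝ => a + b * s) (𝓝[>] 0) (𝓝 a) := by
      have : Continuous fun s : ℝ => a + b * s := by fun_prop
      simpa using (this.tendsto 0).mono_left nhdsWithin_le_nhds
    have h2 : Tendsto (fun s : ℝ => a + b * s) (𝓝[<] 0) (𝓝 a) := by
      have : Continuous fun s : ℝ => a + b * s := by fun_prop
      simpa using (this.tendsto 0).mono_left nhdsWithin_le_nhds
    refine le_antisymm (le_of_tendsto h2 ?_) (ge_of_tendsto h1 ?_)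
    · filter_upwards [self_mem_nhdsWithin, nhdsWithin_le_nhds h] with s hs hs2
      have hs : s < 0 := hs
      by_contra! hc
      nlinarith
    · filter_upwards [self_mem_nhdsWithin, nhdsWithin_le_nhds h] with s hs hs2
      have hs : 0 < s := hs
      by_contra! hc
      nlinarith
  refine ⟨ha, ?_⟩
  have := key (r / 2) (by rw [abs_of_pos] <;> linarith)
  rw [ha] at this
  by_contra! hc
  nlinarith [sq_pos_of_pos (half_pos hr)]

theorem isJetSub_const [FiniteDimensional ℝ E] [Nontrivial E] (hp : 1 < p) (c : ℝ) :
    IsJetSub p (fun _ _ => c) x t := by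
  intro ξ τ X C hq
  have hline : ∀ v : E, ⟪ξ, v⟫ = 0 ∧ 0 ≤ ⟪X v, v⟫ / 2 := fun v => by
    have hc : Tendsto (fun s : ℝ => (x + s • v, t)) (𝓝 0) (𝓝 (x, t)) := by
      have : Continuous fun s : ℝ => (x + s • v, t) := by fun_prop
      simpa using this.tendsto 0
    refine nonneg_of_eventually_nonneg_quadratic ((hc.eventually hq).mono fun s hs => ?_)
    simp only [add_sub_cancel_left, map_smul, real_inner_smul_left, real_inner_smul_right,
      sub_self] at hs
    linarith
  have hτ : τ = 0 := by
    have hc : Tendsto (fun s : ℝ => (x, t + s)) (𝓝 0) (𝓝 (x, t)) := by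
      have : Continuous fun s : ℝ => (x, t + s) := by fun_prop
      simpa using this.tendsto 0
    refine (nonneg_of_eventually_nonneg_quadratic (b := C)
      ((hc.eventually hq).mono fun s hs => ?_)).1
    simp only [add_sub_cancel_left, map_zero, inner_zero_right, sub_self] at hs
    linarith
  obtain ⟨ν, hν⟩ := exists_norm_eq E zero_le_one
  refine ⟨ν, hν, fun h => absurd ((inner_self_eq_zero (𝕜 := ℝ)).1 (hline ξ).1) h, ?_⟩
  rw [hτ, mul_zero, ← sum_inner_sqrtDiff hp (stdOrthonormalBasis ℝ E) X ν hν]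
  exact Finset.sum_nonneg fun k _ => by linarith [(hline (sqrtDiff p ν (stdOrthonormalBasis ℝ E k))).2]

theorem IsJetSub.comp_scale {x₀ : E} {R h : ℝ} (hR : 0 < R)
    (hw : IsJetSub p w (x₀ + R • x) (h + R ^ 2 * t)) :
    IsJetSub p (fun x t => w (x₀ + R • x) (h + R ^ 2 * t)) x t := by
  intro ξ τ X C hq
  have hR0 : R ≠ 0 := hR.ne'
  have hc : Tendsto (fun q : E × ℝ => (R⁻¹ • (q.1 - x₀), (R ^ 2)⁻¹ * (q.2 - h)))
      (𝓝 (x₀ + R • x, h + R ^ 2 * t)) (𝓝 (x, t)) := by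
    have : Continuous fun q : E × ℝ => (R⁻¹ • (q.1 - x₀), (R ^ 2)⁻¹ * (q.2 - h)) := by fun_prop
    have := this.tendsto (x₀ + R • x, h + R ^ 2 * t)
    simpa [smul_smul, hR0] using this
  obtain ⟨ν, hν, hξ, hi⟩ := hw (R⁻¹ • ξ) ((R ^ 2)⁻¹ * τ) ((R ^ 2)⁻¹ • X) ((R ^ 2)⁻¹ ^ 2 * C) (by
    filter_upwards [hc.eventually hq] with q hq
    have e1 : x₀ + R • R⁻¹ • (q.1 - x₀) = q.1 := by rw [smul_smul, mul_inv_cancel₀ hR0]; simp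
    have e2 : h + R ^ 2 * ((R ^ 2)⁻¹ * (q.2 - h)) = q.2 := by field_simp; ring
    have e3 : R⁻¹ • (q.1 - x₀) - x = R⁻¹ • (q.1 - (x₀ + R • x)) := by
      rw [smul_sub, smul_sub, smul_add, smul_smul R⁻¹ R, inv_mul_cancel₀ hR0, one_smul]; abel
    have e4 : (R ^ 2)⁻¹ * (q.2 - h) - t = (R ^ 2)⁻¹ * (q.2 - (h + R ^ 2 * t)) := by
      field_simp; ring
    simp only [e1, e2, e3, e4, map_smul, real_inner_smul_left, real_inner_smul_right] at hq
    rw [smul_apply, real_inner_smul_left, real_inner_smul_left]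
    refine hq.trans (le_of_eq ?_)
    ring)
  refine ⟨ν, hν, fun h => ?_, ?_⟩
  · rw [hξ (smul_ne_zero (inv_ne_zero hR0) h), norm_smul, norm_inv, Real.norm_of_nonneg hR.le,
      smul_smul, mul_inv, inv_inv, mul_right_comm, mul_inv_cancel₀ hR0, one_mul]
  · have e : LinearMap.trace ℝ E ((R ^ 2)⁻¹ • X : E →L[ℝ] E) =
      (R ^ 2)⁻¹ * LinearMap.trace ℝ E X := map_smul (LinearMap.trace ℝ E) _ _
    rw [e, smul_apply, real_inner_smul_left] at hi
    have h2 : (R ^ 2)⁻¹ * (p * τ) ≤ (R ^ 2)⁻¹ *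
      (LinearMap.trace ℝ E X + (p - 2) * ⟪X ν, ν⟫) := by linarith
    exact le_of_mul_le_mul_left h2 (by positivity)

end JetCalculus

section Directions

theorem norm_le_two_mul_norm_add {F : Type*} [NormedAddCommGroup F] {P q : F} {k : ℝ}
    (hq : ‖q‖ ≤ k) (hP : 2 * k ≤ ‖P‖) :
    ‖P‖ ≤ 2 * ‖P + q‖ := by
  have := norm_sub_le (P + q) q
  rw [add_sub_cancel_right] at this
  linarith

variable {E : Type*} [NormedAddCommGroup E] [InnerProductSpace ℝ E]

theorem inner_sq_le_one {e f : E} (he : ‖e‖ = 1) (hf : ‖f‖ = 1) : ⟪e, f⟫ ^ 2 ≤ 1 := by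
  rw [sq_le_one_iff_abs_le_one]
  simpa [he, hf] using abs_real_inner_le_norm e f

theorem one_sub_inner_sq_mul_le {v ν e : E} (hν : v ≠ 0 → ν = ‖v‖⁻¹ • v) (he : ‖e‖ = 1) (r : ℝ) :
    (1 - ⟪ν, e⟫ ^ 2) * ‖v‖ ^ 2 ≤ ‖v - r • e‖ ^ 2 := by
  by_cases hv : v = 0
  · rw [hv]; simp
  have h1 : ⟪ν, e⟫ * ‖v‖ = ⟪v, e⟫ := by
    rw [hν hv, real_inner_smul_left]
    field_simp [norm_ne_zero_iff.2 hv]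
  rw [norm_sub_sq_real, norm_smul, he, real_inner_smul_right, mul_one, Real.norm_eq_abs, sq_abs]
  nlinarith [sq_nonneg (⟪v, e⟫ - r), congrArg (· ^ 2) h1]

theorem one_sub_inner_sq_mul_le_of_add {P q ν e : E} {k : ℝ} (hq : ‖q‖ ≤ k) (hP : 2 * k ≤ ‖P‖)
    (hν1 : ‖ν‖ = 1) (hν : P + q ≠ 0 → ν = ‖P + q‖⁻¹ • (P + q)) (he : ‖e‖ = 1) {r : ℝ}
    (hr : P = r • e) : (1 - ⟪ν, e⟫ ^ 2) * ‖P‖ ^ 2 ≤ 4 * k ^ 2 := by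
  have h1 := one_sub_inner_sq_mul_le hν he r
  rw [← hr, add_sub_cancel_left] at h1
  have h2 := norm_le_two_mul_norm_add hq hP
  have h3 : 0 ≤ 1 - ⟪ν, e⟫ ^ 2 := sub_nonneg.2 (inner_sq_le_one hν1 he)
  have h4 : ‖q‖ ^ 2 ≤ k ^ 2 := by gcongr
  have h5 : ‖P‖ ^ 2 ≤ (2 * ‖P + q‖) ^ 2 := by gcongr
  nlinarith [mul_le_mul_of_nonneg_left h5 h3]

theorem one_sub_inner_sq_mul_le_of_add_of_neg_add {P q₁ q₂ ν₁ ν₂ : E} {k : ℝ} (hq₁ : ‖q₁‖ ≤ k)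
    (hq₂ : ‖q₂‖ ≤ k) (hP : 2 * k ≤ ‖P‖) (h1 : ‖ν₁‖ = 1) (h2 : ‖ν₂‖ = 1)
    (hν₁ : P + q₁ ≠ 0 → ν₁ = ‖P + q₁‖⁻¹ • (P + q₁))
    (hν₂ : -P + q₂ ≠ 0 → ν₂ = ‖-P + q₂‖⁻¹ • (-P + q₂)) :
    (1 - ⟪ν₁, ν₂⟫ ^ 2) * ‖P‖ ^ 2 ≤ 16 * k ^ 2 := by
  have h3 := one_sub_inner_sq_mul_le hν₁ h2 (-‖-P + q₂‖)
  have h4 : P + q₁ - (-‖-P + q₂‖) • ν₂ = q₁ + q₂ := by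
    have : ‖-P + q₂‖ • ν₂ = -P + q₂ := by
      by_cases h : -P + q₂ = 0
      · simp [h]
      · rw [hν₂ h, smul_smul, mul_inv_cancel₀ (norm_ne_zero_iff.2 h), one_smul]
    rw [neg_smul, this]; abel
  rw [h4] at h3
  have h5 : ‖q₁ + q₂‖ ≤ 2 * k := (norm_add_le _ _).trans (by linarith)
  have h6 : ‖q₁ + q₂‖ ^ 2 ≤ (2 * k) ^ 2 := by gcongr
  have h7 : 0 ≤ 1 - ⟪ν₁, ν₂⟫ ^ 2 := sub_nonneg.2 (inner_sq_le_one h1 h2)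
  have h8 := norm_le_two_mul_norm_add hq₁ hP
  have h9 : ‖P‖ ^ 2 ≤ (2 * ‖P + q₁‖) ^ 2 := by gcongr
  nlinarith [mul_le_mul_of_nonneg_left h9 h7]

variable {ι : Type*} [Fintype ι]

theorem sum_norm_sqrtDiff_sub (p : ℝ) {ν₁ ν₂ : E} (h1 : ‖ν₁‖ = 1) (h2 : ‖ν₂‖ = 1)
    (b : OrthonormalBasis ι ℝ E) :
    ∑ k, ‖sqrtDiff p ν₁ (b k) - sqrtDiff p ν₂ (b k)‖ ^ 2 =
      2 * (√(p - 1) - 1) ^ 2 * (1 - ⟪ν₁, ν₂⟫ ^ 2) := by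
  set a := √(p - 1) - 1 with ha
  have h3 : ∀ k, ‖sqrtDiff p ν₁ (b k) - sqrtDiff p ν₂ (b k)‖ ^ 2 =
      a ^ 2 * (⟪ν₁, b k⟫ ^ 2 + ⟪ν₂, b k⟫ ^ 2 - 2 * ⟪ν₁, ν₂⟫ * (⟪ν₁, b k⟫ * ⟪b k, ν₂⟫)) := by
    intro k
    have : sqrtDiff p ν₁ (b k) - sqrtDiff p ν₂ (b k) =
        (a * ⟪ν₁, b k⟫) • ν₁ - (a * ⟪ν₂, b k⟫) • ν₂ := by
      simp only [sqrtDiff, ← ha]; abel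
    rw [this, norm_sub_sq_real, norm_smul, norm_smul, h1, h2, real_inner_smul_left,
      real_inner_smul_right, mul_one, mul_one, Real.norm_eq_abs, Real.norm_eq_abs, sq_abs, sq_abs,
      real_inner_comm ν₂ (b k)]
    ring
  simp only [h3, ← Finset.mul_sum, Finset.sum_sub_distrib, Finset.sum_add_distrib,
    b.sum_sq_inner_left, b.sum_inner_mul_inner, h1, h2]
  ring

theorem exists_basis_sum_le {p : ℝ} (hp : 1 < p) {ν₁ ν₂ e : E} (h1 : ‖ν₁‖ = 1) (h2 : ‖ν₂‖ = 1)
    (he : ‖e‖ = 1) (b : OrthonormalBasis ι ℝ E) :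
    ∃ c : OrthonormalBasis ι ℝ E, ∀ A B : ℝ, A ≤ 0 → 0 ≤ B →
      ∑ k, (A * ⟪e, sqrtDiff p ν₁ (b k) - sqrtDiff p ν₂ (c k)⟫ ^ 2 +
        B * (‖sqrtDiff p ν₁ (b k) - sqrtDiff p ν₂ (c k)‖ ^ 2 -
          ⟪e, sqrtDiff p ν₁ (b k) - sqrtDiff p ν₂ (c k)⟫ ^ 2)) ≤
      A * (4 * min 1 (p - 1)) +
        B * (2 * (√(p - 1) - 1) ^ 2 * ((1 - ⟪ν₁, e⟫ ^ 2) + (1 - ⟪ν₂, e⟫ ^ 2))) := by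
  set a := √(p - 1) - 1 with ha
  have hee : ⟪e, e⟫ = 1 := by rw [real_inner_self_eq_norm_sq, he, one_pow]
  refine ⟨b.map (Submodule.reflection (ℝ ∙ e)ᗮ), fun A B hA hB => ?_⟩
  set c := b.map (Submodule.reflection (ℝ ∙ e)ᗮ) with hc
  have hck : ∀ k, c k = b k - (2 * ⟪e, b k⟫) • e := fun k => by
    rw [hc, OrthonormalBasis.map_apply, Submodule.reflection_orthogonal_apply,
      Submodule.reflection_singleton_apply, he]
    simp only [RCLike.ofReal_real_eq_id, id, one_pow, div_one, neg_sub, two_smul, two_mul, add_smul]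
  set D : ι → E := fun k => sqrtDiff p ν₁ (b k) - sqrtDiff p ν₂ (c k) with hD
  have hDk : ∀ k, D k = (2 * ⟪e, b k⟫) • e + (a * ⟪ν₁, b k⟫) • ν₁ - (a * ⟪ν₂, c k⟫) • ν₂ := by
    intro k
    have h3 : b k - c k = (2 * ⟪e, b k⟫) • e := by rw [hck]; abel
    rw [← h3]
    simp only [hD, sqrtDiff, ← ha]
    abel
  set g : E := (2 + 2 * a * ⟪ν₂, e⟫ ^ 2) • e + (a * ⟪ν₁, e⟫) • ν₁ - (a * ⟪ν₂, e⟫) • ν₂ with hg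
  have hgk : ∀ k, ⟪e, D k⟫ = ⟪g, b k⟫ := by
    intro k
    rw [hDk, hck, hg]
    simp only [inner_sub_right, inner_add_right, inner_sub_left, inner_add_left,
      real_inner_smul_left, real_inner_smul_right, hee]
    rw [real_inner_comm ν₁ e, real_inner_comm ν₂ e]
    ring
  have hge : ⟪g, e⟫ = 2 + a * (⟪ν₁, e⟫ ^ 2 + ⟪ν₂, e⟫ ^ 2) := by
    rw [hg]
    simp only [inner_sub_left, inner_add_left, real_inner_smul_left, hee]
    ring
  have hpar : 4 * min 1 (p - 1) ≤ ∑ k, ⟪e, D k⟫ ^ 2 := by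
    simp only [hgk, b.sum_sq_inner_left]
    have h3 : ⟪g, e⟫ ^ 2 ≤ ‖g‖ ^ 2 := by
      have := abs_real_inner_le_norm g e
      rw [he, mul_one] at this
      rw [← sq_abs]; gcongr
    refine le_trans ?_ h3
    have hs : √(p - 1) ^ 2 = p - 1 := Real.sq_sqrt (by linarith)
    have hs0 : 0 < √(p - 1) := Real.sqrt_pos.2 (by linarith)
    have i1 := inner_sq_le_one h1 he
    have i2 := inner_sq_le_one h2 he
    rw [hge]
    set y := ⟪ν₁, e⟫ ^ 2 + ⟪ν₂, e⟫ ^ 2 with hy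
    have hy0 : 0 ≤ y := by positivity
    rcases le_total 0 a with h | h
    · nlinarith [min_le_left 1 (p - 1), mul_nonneg h hy0]
    · have : 2 * √(p - 1) ≤ 2 + a * y := by nlinarith
      have h5 : (2 * √(p - 1)) ^ 2 ≤ (2 + a * y) ^ 2 := by gcongr
      nlinarith [min_le_right 1 (p - 1)]
  have hn : ∀ ν : E, ‖ν‖ = 1 → ‖ν - ⟪ν, e⟫ • e‖ ^ 2 = 1 - ⟪ν, e⟫ ^ 2 := fun ν hν => by
    rw [norm_sub_sq_real, norm_smul, he, hν, real_inner_smul_right, mul_one, Real.norm_eq_abs,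
      sq_abs]
    ring
  have hperp : ∀ k, ‖D k‖ ^ 2 - ⟪e, D k⟫ ^ 2 ≤ 2 * a ^ 2 * ((1 - ⟪ν₁, e⟫ ^ 2) * ⟪ν₁, b k⟫ ^ 2 +
      (1 - ⟪ν₂, e⟫ ^ 2) * ⟪ν₂, c k⟫ ^ 2) := by
    intro k
    have e1 : ∀ v : E, ‖v‖ ^ 2 - ⟪e, v⟫ ^ 2 = ‖v - ⟪e, v⟫ • e‖ ^ 2 := fun v => by
      rw [norm_sub_sq_real, norm_smul, he, real_inner_smul_right, mul_one, Real.norm_eq_abs,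
        sq_abs, real_inner_comm e]
      ring
    have e2 : D k - ⟪e, D k⟫ • e = (a * ⟪ν₁, b k⟫) • (ν₁ - ⟪ν₁, e⟫ • e) -
        (a * ⟪ν₂, c k⟫) • (ν₂ - ⟪ν₂, e⟫ • e) := by
      rw [hDk]
      simp only [inner_sub_right, inner_add_right, real_inner_smul_right, hee,
        real_inner_comm ν₁ e, real_inner_comm ν₂ e]
      module
    have e3 : ∀ v v' : E, ‖v - v'‖ ^ 2 ≤ 2 * (‖v‖ ^ 2 + ‖v'‖ ^ 2) := fun v v' => by
      have := parallelogram_law_with_norm ℝ v v'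
      nlinarith [sq_nonneg ‖v + v'‖]
    rw [e1, e2]
    refine (e3 _ _).trans (le_of_eq ?_)
    rw [norm_smul, norm_smul, mul_pow, mul_pow, hn _ h1, hn _ h2, Real.norm_eq_abs,
      Real.norm_eq_abs, sq_abs, sq_abs]
    ring
  have hperp' : ∑ k, (‖D k‖ ^ 2 - ⟪e, D k⟫ ^ 2) ≤
      2 * a ^ 2 * ((1 - ⟪ν₁, e⟫ ^ 2) + (1 - ⟪ν₂, e⟫ ^ 2)) := by
    refine (Finset.sum_le_sum fun k _ => hperp k).trans (le_of_eq ?_)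
    rw [← Finset.mul_sum, Finset.sum_add_distrib, ← Finset.mul_sum, ← Finset.mul_sum,
      b.sum_sq_inner_left, c.sum_sq_inner_left, h1, h2]
    ring
  rw [Finset.sum_add_distrib, ← Finset.mul_sum, ← Finset.mul_sum]
  exact add_le_add (mul_le_mul_of_nonpos_left hpar hA) (mul_le_mul_of_nonneg_left hperp' hB)

end Directions

section RadialEstimates

theorem le_of_sq_mul_le {Q ρ h k ε : ℝ} (hQ : 0 ≤ Q) (hε : 0 < ε) (hh : h = Q * ρ)
    (hk : k ^ 2 * Q ≤ ε ^ 3) (h1 : h ^ 2 * ρ ≤ k ^ 2) : h ≤ ε := by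
  refine le_of_pow_le_pow_left₀ three_ne_zero hε.le (le_trans ?_ hk)
  have : h ^ 3 = h ^ 2 * ρ * Q := by rw [hh]; ring
  rw [this]; gcongr

theorem sq_le_mul_of_le_sq_mul {Q ρ h k ε : ℝ} (hQ : 0 ≤ Q) (hρ : 0 ≤ ρ) (hε : 0 < ε)
    (hh : h = Q * ρ) (hk : k ^ 2 * Q ≤ ε ^ 3) (h1 : k ^ 2 ≤ h ^ 2 * ρ) : k ^ 2 ≤ ε * (h * ρ) := by
  have hh0 : 0 ≤ h := by rw [hh]; positivity
  refine le_of_pow_le_pow_left₀ three_ne_zero (by positivity) ?_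
  calc (k ^ 2) ^ 3 = k ^ 2 * (k ^ 2) ^ 2 := by ring
    _ ≤ k ^ 2 * (h ^ 2 * ρ) ^ 2 := by gcongr
    _ = k ^ 2 * Q * (h * ρ) ^ 3 := by rw [hh]; ring
    _ ≤ ε ^ 3 * (h * ρ) ^ 3 := by gcongr
    _ = (ε * (h * ρ)) ^ 3 := by ring

variable {E : Type*} [NormedAddCommGroup E] [InnerProductSpace ℝ E] {ι : Type*} [Fintype ι]

theorem norm_two_mul_smul_sq (h : ℝ) (z : E) : ‖(2 * h) • z‖ ^ 2 = 4 * (h ^ 2 * ‖z‖ ^ 2) := by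
  rw [norm_smul, mul_pow, Real.norm_eq_abs, sq_abs]; ring

theorem two_mul_le_norm_smul {h k : ℝ} {z : E} (h1 : k ^ 2 ≤ h ^ 2 * ‖z‖ ^ 2) :
    2 * k ≤ ‖(2 * h) • z‖ := by
  refine le_of_pow_le_pow_left₀ two_ne_zero (norm_nonneg _) ?_
  rw [norm_two_mul_smul_sq]
  linarith

theorem sum_radial_le {p Q h₁ h₂ k ε : ℝ} {z q₁ q₂ ν₁ ν₂ : E} (hQ : 0 ≤ Q)
    (hε : 0 < ε) (hh : h₁ = Q * ‖z‖ ^ 2) (hkQ : k ^ 2 * Q ≤ ε ^ 3) (h21 : h₂ * ‖z‖ ^ 2 ≤ h₁)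
    (hk : 0 < k) (hq₁ : ‖q₁‖ ≤ k) (hq₂ : ‖q₂‖ ≤ k) (h1 : ‖ν₁‖ = 1) (h2 : ‖ν₂‖ = 1)
    (hν₁ : (2 * h₁) • z + q₁ ≠ 0 → ν₁ = ‖(2 * h₁) • z + q₁‖⁻¹ • ((2 * h₁) • z + q₁))
    (hν₂ : -(2 * h₁) • z + q₂ ≠ 0 → ν₂ = ‖-(2 * h₁) • z + q₂‖⁻¹ • (-(2 * h₁) • z + q₂))
    (b : OrthonormalBasis ι ℝ E) :
    ∑ k, (2 * h₁ * ‖sqrtDiff p ν₁ (b k) - sqrtDiff p ν₂ (b k)‖ ^ 2 +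
      4 * h₂ * ⟪z, sqrtDiff p ν₁ (b k) - sqrtDiff p ν₂ (b k)⟫ ^ 2) ≤
      48 * (√(p - 1) - 1) ^ 2 * ε := by
  have hh0 : 0 ≤ h₁ := by rw [hh]; positivity
  have hi : 0 ≤ 1 - ⟪ν₁, ν₂⟫ ^ 2 := sub_nonneg.2 (inner_sq_le_one h1 h2)
  have key : h₁ * (1 - ⟪ν₁, ν₂⟫ ^ 2) ≤ 4 * ε := by
    rcases le_total (h₁ ^ 2 * ‖z‖ ^ 2) (k ^ 2) with h | h
    · have := le_of_sq_mul_le hQ hε hh hkQ h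
      nlinarith [sq_nonneg ⟪ν₁, ν₂⟫]
    · have h3 := sq_le_mul_of_le_sq_mul hQ (sq_nonneg _) hε hh hkQ h
      rw [neg_smul] at hν₂
      have h4 := one_sub_inner_sq_mul_le_of_add_of_neg_add hq₁ hq₂ (two_mul_le_norm_smul h)
        h1 h2 hν₁ hν₂
      rw [norm_two_mul_smul_sq] at h4
      have h5 : 0 < h₁ * ‖z‖ ^ 2 := by
        have : 0 < k ^ 2 := by positivity
        by_contra! hc
        have : h₁ * (h₁ * ‖z‖ ^ 2) ≤ 0 := mul_nonpos_of_nonneg_of_nonpos hh0 hc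
        nlinarith
      refine le_of_mul_le_mul_right ?_ h5
      nlinarith
  have hterm : ∀ v : E, 2 * h₁ * ‖v‖ ^ 2 + 4 * h₂ * ⟪z, v⟫ ^ 2 ≤ 6 * h₁ * ‖v‖ ^ 2 := by
    intro v
    have h3 : ⟪z, v⟫ ^ 2 ≤ ‖z‖ ^ 2 * ‖v‖ ^ 2 := by
      rw [← mul_pow, ← sq_abs]; gcongr; exact abs_real_inner_le_norm z v
    rcases le_total h₂ 0 with h | h
    · nlinarith [sq_nonneg ⟪z, v⟫, mul_nonneg hh0 (sq_nonneg ‖v‖),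
        mul_nonneg (neg_nonneg.2 h) (sq_nonneg ⟪z, v⟫)]
    · nlinarith [mul_le_mul_of_nonneg_left h3 h, mul_le_mul_of_nonneg_right h21 (sq_nonneg ‖v‖)]
  refine (Finset.sum_le_sum fun k _ => hterm _).trans ?_
  rw [← Finset.mul_sum, sum_norm_sqrtDiff_sub p h1 h2 b]
  have := mul_le_mul_of_nonneg_left key (sq_nonneg (√(p - 1) - 1))
  linarith

theorem exists_basis_sum_radial_le {p Q h₁ h₂ k ε : ℝ} {z q₁ q₂ ν₁ ν₂ : E} (hp : 1 < p)
    (hQ : 0 ≤ Q) (hε : 0 < ε) (hh : h₁ = Q * ‖z‖ ^ 2) (hkQ : k ^ 2 * Q ≤ ε ^ 3)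
    (hneg : 2 * h₁ + 4 * h₂ * ‖z‖ ^ 2 ≤ 0) (hkh : k ^ 2 ≤ h₁ ^ 2 * ‖z‖ ^ 2)
    (hk : 0 < k) (hq₁ : ‖q₁‖ ≤ k) (hq₂ : ‖q₂‖ ≤ k) (h1 : ‖ν₁‖ = 1) (h2 : ‖ν₂‖ = 1)
    (hν₁ : (2 * h₁) • z + q₁ ≠ 0 → ν₁ = ‖(2 * h₁) • z + q₁‖⁻¹ • ((2 * h₁) • z + q₁))
    (hν₂ : -(2 * h₁) • z + q₂ ≠ 0 → ν₂ = ‖-(2 * h₁) • z + q₂‖⁻¹ • (-(2 * h₁) • z + q₂))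
    (b : OrthonormalBasis ι ℝ E) :
    ∃ c : OrthonormalBasis ι ℝ E,
      ∑ k, (2 * h₁ * ‖sqrtDiff p ν₁ (b k) - sqrtDiff p ν₂ (c k)‖ ^ 2 +
        4 * h₂ * ⟪z, sqrtDiff p ν₁ (b k) - sqrtDiff p ν₂ (c k)⟫ ^ 2) ≤
      (2 * h₁ + 4 * h₂ * ‖z‖ ^ 2) * (4 * min 1 (p - 1)) + 8 * (√(p - 1) - 1) ^ 2 * ε := by
  have hh0 : 0 ≤ h₁ := by rw [hh]; positivity
  have hk2 : 0 < k ^ 2 := by positivity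
  have hz : z ≠ 0 := by
    rintro rfl
    simp at hkh
    exact hk.ne' hkh
  have hz' : ‖z‖ ≠ 0 := norm_ne_zero_iff.2 hz
  have h5 : 0 < h₁ * ‖z‖ ^ 2 := by
    by_contra! hc
    have : h₁ * (h₁ * ‖z‖ ^ 2) ≤ 0 := mul_nonpos_of_nonneg_of_nonpos hh0 hc
    nlinarith
  set e := ‖z‖⁻¹ • z with he
  have he1 : ‖e‖ = 1 := by rw [he, norm_smul, norm_inv, norm_norm, inv_mul_cancel₀ hz']
  have hze : z = ‖z‖ • e := by rw [he, smul_smul, mul_inv_cancel₀ hz', one_smul]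
  obtain ⟨c, hc⟩ := exists_basis_sum_le hp h1 h2 he1 b
  refine ⟨c, le_trans (le_of_eq (Finset.sum_congr rfl fun k _ => ?_))
    ((hc (2 * h₁ + 4 * h₂ * ‖z‖ ^ 2) (2 * h₁) hneg (by positivity)).trans ?_)⟩
  · generalize sqrtDiff p ν₁ (b k) - sqrtDiff p ν₂ (c k) = v
    have : ⟪z, v⟫ = ‖z‖ * ⟪e, v⟫ := by
      conv_lhs => rw [hze]
      rw [real_inner_smul_left]
    rw [this]; ring
  · have h3 := sq_le_mul_of_le_sq_mul hQ (sq_nonneg _) hε hh hkQ hkh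
    have hP := two_mul_le_norm_smul hkh
    have g1 := one_sub_inner_sq_mul_le_of_add hq₁ hP h1 hν₁ he1 (r := 2 * h₁ * ‖z‖)
      (by rw [mul_smul (2 * h₁), ← hze])
    have g2 := one_sub_inner_sq_mul_le_of_add (P := -(2 * h₁) • z) hq₂
      (by rwa [neg_smul, norm_neg]) h2 hν₂ he1 (r := -(2 * h₁) * ‖z‖)
      (by rw [mul_smul (-(2 * h₁)), ← hze])
    rw [norm_two_mul_smul_sq] at g1
    rw [neg_smul, norm_neg, norm_two_mul_smul_sq] at g2
    have key : ∀ s : ℝ, s * (4 * (h₁ ^ 2 * ‖z‖ ^ 2)) ≤ 4 * k ^ 2 → h₁ * s ≤ ε := fun s hs => by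
      refine le_of_mul_le_mul_right ?_ h5
      nlinarith
    have k1 := mul_le_mul_of_nonneg_left (key _ g1) (sq_nonneg (√(p - 1) - 1))
    have k2 := mul_le_mul_of_nonneg_left (key _ g2) (sq_nonneg (√(p - 1) - 1))
    linarith

end RadialEstimates

section Cost

/-- The base `ρ² / t² + l⁸ √t` of the cost used when doubling variables. -/
def costBase (l ρ t : ℝ) : ℝ := ρ ^ 2 / t ^ 2 + l ^ 8 * √t

/-- The cost used when doubling variables, as a function of the squared distance and time. -/
def cost (K l a ϑ ρ t : ℝ) : ℝ :=
  K * costBase l ρ t ^ (1 / 8 : ℝ) + a * t ^ (1 / 16 : ℝ) + ϑ / (1 - t)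

variable {K l a ϑ ρ t : ℝ}

theorem costBase_pos (hl : 0 < l) (ht : 0 < t) : 0 < costBase l ρ t := by
  unfold costBase; positivity

theorem hasDerivAt_costBase_fst (s : ℝ) :
    HasDerivAt (fun r => costBase l r t) (2 * s / t ^ 2) s := by
  have := (((hasDerivAt_id s).pow 2).div_const (t ^ 2)).add_const (l ^ 8 * √t)
  exact this.congr_deriv (by simp)

theorem hasDerivAt_costBase_snd (ht : 0 < t) :
    HasDerivAt (fun s => costBase l ρ s) (-2 * ρ ^ 2 / t ^ 3 + l ^ 8 / (2 * √t)) t := by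
  have h1 := (((hasDerivAt_id t).pow 2).fun_inv (pow_ne_zero 2 ht.ne')).const_mul (ρ ^ 2)
  have h2 := (Real.hasDerivAt_sqrt ht.ne').const_mul (l ^ 8)
  refine ((h1.add h2).congr_deriv ?_).congr_of_eventuallyEq (Eventually.of_forall fun s => ?_)
  · simp; field_simp
  · simp [costBase, div_eq_mul_inv]

/-- The time derivative of the cost. -/
def costDerivSnd (K l a ϑ : ℝ) (q : ℝ × ℝ) : ℝ :=
  K * ((-2 * q.1 ^ 2 / q.2 ^ 3 + l ^ 8 / (2 * √q.2)) * (1 / 8) *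
    costBase l q.1 q.2 ^ (1 / 8 - 1 : ℝ)) + a * (1 / 16 * q.2 ^ (1 / 16 - 1 : ℝ)) +
    ϑ / (1 - q.2) ^ 2

theorem hasDerivAt_cost_snd (hl : 0 < l) (ht : 0 < t) (ht1 : t < 1) :
    HasDerivAt (fun s => cost K l a ϑ ρ s) (costDerivSnd K l a ϑ (ρ, t)) t := by
  have h1 := ((hasDerivAt_costBase_snd (l := l) (ρ := ρ) ht).rpow_const (p := 1 / 8)
    (Or.inl (costBase_pos hl ht).ne')).const_mul K
  have h2 := (Real.hasDerivAt_rpow_const (x := t) (p := 1 / 16) (Or.inl ht.ne')).const_mul a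
  have h3 := (((hasDerivAt_id t).const_sub 1).fun_inv (sub_pos.2 ht1).ne').const_mul ϑ
  refine (((h1.add h2).add h3).congr_deriv ?_).congr_of_eventuallyEq
    (Eventually.of_forall fun s => ?_)
  · simp [costDerivSnd, div_eq_mul_inv]
  · simp [cost, div_eq_mul_inv]

theorem hasDerivAt_cost_fst (hl : 0 < l) (ht : 0 < t) (s : ℝ) :
    HasDerivAt (fun r => cost K l a ϑ r t)
      (K * (2 * s / t ^ 2 * (1 / 8) * costBase l s t ^ (1 / 8 - 1 : ℝ))) s := by
  have h1 := ((hasDerivAt_costBase_fst (l := l) (t := t) s).rpow_const (p := 1 / 8)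
    (Or.inl (costBase_pos hl ht).ne')).const_mul K
  exact (h1.add_const _).add_const _

theorem hasDerivAt_costDerivFst (hl : 0 < l) (ht : 0 < t) (s : ℝ) :
    HasDerivAt (fun s => K * (2 * s / t ^ 2 * (1 / 8) * costBase l s t ^ (1 / 8 - 1 : ℝ)))
      (K * (2 / t ^ 2 * (1 / 8) * costBase l s t ^ (1 / 8 - 1 : ℝ) + 2 * s / t ^ 2 * (1 / 8) *
        (2 * s / t ^ 2 * (1 / 8 - 1) * costBase l s t ^ (1 / 8 - 1 - 1 : ℝ)))) s := by
  have h1 := (hasDerivAt_costBase_fst (l := l) (t := t) s).rpow_const (p := 1 / 8 - 1)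
    (Or.inl (costBase_pos hl ht).ne')
  have h2 : HasDerivAt (fun s => 2 * s / t ^ 2 * (1 / 8)) (2 / t ^ 2 * (1 / 8)) s := by
    have := (((hasDerivAt_id s).const_mul 2).div_const (t ^ 2)).mul_const (1 / 8)
    exact this.congr_deriv (by simp)
  exact (h2.fun_mul h1).const_mul K

theorem differentiableAt_costDerivSnd (hl : 0 < l) (ht : 0 < t) (ht1 : t < 1) :
    DifferentiableAt ℝ (costDerivSnd K l a ϑ) (ρ, t) := by
  have h1 : DifferentiableAt ℝ (fun q : ℝ × ℝ => q.1) (ρ, t) := differentiableAt_fst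
  have h2 : DifferentiableAt ℝ (fun q : ℝ × ℝ => q.2) (ρ, t) := differentiableAt_snd
  have h3 : DifferentiableAt ℝ (fun q : ℝ × ℝ => √q.2) (ρ, t) := h2.sqrt ht.ne'
  have n2 : t ^ 2 ≠ 0 := pow_ne_zero 2 ht.ne'
  have n3 : t ^ 3 ≠ 0 := pow_ne_zero 3 ht.ne'
  have n4 : 2 * √t ≠ 0 := by positivity
  have n5 : (1 - t) ^ 2 ≠ 0 := pow_ne_zero 2 (sub_pos.2 ht1).ne'
  have h4 : DifferentiableAt ℝ (fun q : ℝ × ℝ => costBase l q.1 q.2) (ρ, t) := by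
    simp only [costBase, div_eq_mul_inv]
    exact ((h1.fun_pow 2).fun_mul ((h2.fun_pow 2).fun_inv n2)).fun_add (h3.const_mul _)
  have h5 := h4.rpow_const (p := 1 / 8 - 1) (Or.inl (costBase_pos hl ht).ne')
  have h6 := h2.rpow_const (p := 1 / 16 - 1) (Or.inl ht.ne')
  have e1 := (((h1.fun_pow 2).const_mul (-2)).fun_mul ((h2.fun_pow 3).fun_inv n3)).fun_add
    (((h3.const_mul 2).fun_inv n4).const_mul (l ^ 8))
  have e2 := (((h2.const_sub 1).fun_pow 2).fun_inv n5).const_mul ϑ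
  have := ((((e1.mul_const (1 / 8)).fun_mul h5).const_mul K).fun_add
    ((h6.const_mul (1 / 16)).const_mul a)).fun_add e2
  exact this.congr_of_eventuallyEq (Eventually.of_forall fun q => by
    simp only [costDerivSnd, div_eq_mul_inv])

/-- The second order expansion of the cost, at `t = θ ^ 16`. -/
theorem exists_eventually_cost_le {θ Y Q : ℝ} (hl : 0 < l) (hθ : 0 < θ) (hθ1 : θ < 1)
    (hY : Y = costBase l ρ (θ ^ 16) ^ (1 / 8 : ℝ)) (hQ : Q = K / (4 * (θ ^ 16) ^ 2 * Y ^ 7))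
    {η : ℝ} (hη : 0 < η) :
    ∃ C : ℝ, ∀ᶠ q : ℝ × ℝ in 𝓝 (ρ, θ ^ 16), cost K l a ϑ q.1 q.2 ≤
      cost K l a ϑ ρ (θ ^ 16) + Q * ρ * (q.1 - ρ) +
      (Q * ((l * θ) ^ 8 - 3 / 4 * (ρ / θ ^ 16) ^ 2) / Y ^ 8) / 2 * (q.1 - ρ) ^ 2 +
      (K / (8 * Y ^ 7) * (-2 * (ρ / θ ^ 16) ^ 2 + (l * θ) ^ 8 / 2) / θ ^ 16 + a / 16 / θ ^ 15 +
        ϑ / (1 - θ ^ 16) ^ 2) * (q.2 - θ ^ 16) +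
      η * (q.1 - ρ) ^ 2 + C * (q.2 - θ ^ 16) ^ 2 := by
  have ht : 0 < θ ^ 16 := by positivity
  have ht1 : θ ^ 16 < 1 := pow_lt_one₀ hθ.le hθ1 (by norm_num)
  have hu := costBase_pos (ρ := ρ) hl ht
  have hY0 : 0 < Y := hY ▸ Real.rpow_pos_of_pos hu _
  have hsq : √(θ ^ 16) = θ ^ 8 := by
    rw [show θ ^ 16 = (θ ^ 8) ^ 2 by ring, Real.sqrt_sq (by positivity)]
  have hYu : Y ^ 8 = costBase l ρ (θ ^ 16) := by
    rw [hY, ← Real.rpow_natCast, ← Real.rpow_mul hu.le]; norm_num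
  have hY8 : Y ^ 8 = (ρ / θ ^ 16) ^ 2 + (l * θ) ^ 8 := by
    rw [hYu, costBase, hsq, div_pow, mul_pow]
  have r1 : costBase l ρ (θ ^ 16) ^ (1 / 8 - 1 : ℝ) = 1 / Y ^ 7 := by
    rw [Real.rpow_sub_one hu.ne', ← hY, ← hYu]; field_simp
  have r2 : costBase l ρ (θ ^ 16) ^ (1 / 8 - 1 - 1 : ℝ) = 1 / (Y ^ 7 * Y ^ 8) := by
    rw [Real.rpow_sub_one hu.ne', r1, ← hYu]; field_simp
  have r3 : (θ ^ 16) ^ (1 / 16 - 1 : ℝ) = 1 / θ ^ 15 := by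
    rw [Real.rpow_sub_one ht.ne', ← Real.rpow_natCast, ← Real.rpow_mul hθ.le]
    norm_num
    field_simp
  have hg : ∀ᶠ q : ℝ × ℝ in 𝓝 (ρ, θ ^ 16),
      HasDerivAt (fun s => cost K l a ϑ q.1 s) (costDerivSnd K l a ϑ q) q.2 := by
    filter_upwards [continuous_snd.tendsto (ρ, θ ^ 16) (Ioo_mem_nhds ht ht1)] with q hq
    exact hasDerivAt_cost_snd hl hq.1 hq.2
  obtain ⟨C, hC⟩ := exists_eventually_le_taylor
    (Eventually.of_forall fun s => hasDerivAt_cost_fst (K := K) (a := a) (ϑ := ϑ) hl ht s)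
    (hasDerivAt_costDerivFst hl ht ρ) hg (differentiableAt_costDerivSnd hl ht ht1) hη
  refine ⟨C, hC.mono fun q hq => hq.trans (le_of_eq ?_)⟩
  have s1 : K * (2 * ρ / (θ ^ 16) ^ 2 * (1 / 8) * costBase l ρ (θ ^ 16) ^ (1 / 8 - 1 : ℝ)) =
      Q * ρ := by
    rw [r1, hQ]; field_simp; ring
  have s2 : K * (2 / (θ ^ 16) ^ 2 * (1 / 8) * costBase l ρ (θ ^ 16) ^ (1 / 8 - 1 : ℝ) +
      2 * ρ / (θ ^ 16) ^ 2 * (1 / 8) * (2 * ρ / (θ ^ 16) ^ 2 * (1 / 8 - 1) *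
        costBase l ρ (θ ^ 16) ^ (1 / 8 - 1 - 1 : ℝ))) =
      Q * ((l * θ) ^ 8 - 3 / 4 * (ρ / θ ^ 16) ^ 2) / Y ^ 8 := by
    have : (l * θ) ^ 8 = Y ^ 8 - (ρ / θ ^ 16) ^ 2 := by rw [hY8]; ring
    rw [r1, r2, hQ, this]; field_simp; ring
  have s3 : costDerivSnd K l a ϑ (ρ, θ ^ 16) =
      K / (8 * Y ^ 7) * (-2 * (ρ / θ ^ 16) ^ 2 + (l * θ) ^ 8 / 2) / θ ^ 16 + a / 16 / θ ^ 15 +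
        ϑ / (1 - θ ^ 16) ^ 2 := by
    simp only [costDerivSnd]
    rw [r1, r3, hsq, mul_pow]
    field_simp
  rw [s1, s2, s3]

end Cost

section NoInteriorMax

variable {p K L r t μ Y : ℝ}

theorem rpow_two_le_of_regime (hr : 0 ≤ r) (hL : 0 < L) (hY : Y ^ 8 = r ^ 2 + L ^ 8)
    (h : 12 * L ^ 8 ≤ r ^ 2) : Y ^ 8 ≤ 2 * r ^ 2 ∧ 0 < r := by
  have : 0 < L ^ 8 := by positivity
  refine ⟨by linarith, lt_of_le_of_ne hr ?_⟩
  rintro rfl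
  norm_num at h
  linarith

theorem sq_le_sq_mul_of_regime (hr : 0 ≤ r) (hL : 0 < L) (hY0 : 0 < Y) (ht : 0 < t) (ht1 : t ≤ 1)
    (hr1 : r ≤ 1) (hY : Y ^ 8 = r ^ 2 + L ^ 8) (h : 12 * L ^ 8 ≤ r ^ 2) :
    K ^ 2 / 32 ≤ (K / (4 * t ^ 2 * Y ^ 7) * (t * r)) ^ 2 * (t * r) := by
  obtain ⟨hY2, hr0⟩ := rpow_two_le_of_regime hr hL hY h
  have hYr : r ≤ Y ^ 2 := by
    refine le_of_pow_le_pow_left₀ four_ne_zero (by positivity) ?_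
    have h1 : r ^ 4 ≤ r ^ 2 := pow_le_pow_of_le_one hr hr1 (by norm_num)
    have : 0 < L ^ 8 := by positivity
    calc r ^ 4 ≤ r ^ 2 := h1
      _ ≤ Y ^ 8 := by linarith
      _ = (Y ^ 2) ^ 4 := by ring
  have hY14 : Y ^ 14 ≤ 2 * r ^ 3 := by
    have h12 : Y ^ 8 ≤ 13 / 12 * r ^ 2 := by linarith
    have h16 : Y ^ 8 * Y ^ 8 ≤ 13 / 12 * r ^ 2 * (13 / 12 * r ^ 2) := by gcongr
    have h14 : r * Y ^ 14 ≤ Y ^ 2 * Y ^ 14 := by gcongr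
    refine le_of_mul_le_mul_left ?_ hr0
    linarith [pow_nonneg hr 4]
  have e : (K / (4 * t ^ 2 * Y ^ 7) * (t * r)) ^ 2 * (t * r) =
      K ^ 2 / 16 * (r ^ 3 / (t * Y ^ 14)) := by
    field_simp; norm_num
  rw [e]
  have : 1 / 2 ≤ r ^ 3 / (t * Y ^ 14) := by
    rw [div_le_div_iff₀ two_pos (by positivity)]
    have : t * Y ^ 14 ≤ 1 * Y ^ 14 := by gcongr
    linarith
  nlinarith [sq_nonneg K]

theorem radial_le_time_of_regime (hK : 0 < K) (hr : 0 ≤ r) (hL : 0 < L) (hY0 : 0 < Y)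
    (ht : 0 < t) (hp : 0 < p) (hpr : p * r ≤ μ) (hY : Y ^ 8 = r ^ 2 + L ^ 8)
    (h : 12 * L ^ 8 ≤ r ^ 2) :
    2 * (K / (4 * t ^ 2 * Y ^ 7) * (t * r)) +
      4 * (K / (4 * t ^ 2 * Y ^ 7) * (L ^ 8 - 3 / 4 * r ^ 2) / Y ^ 8) * (t * r) ≤ 0 ∧
    (2 * (K / (4 * t ^ 2 * Y ^ 7) * (t * r)) +
      4 * (K / (4 * t ^ 2 * Y ^ 7) * (L ^ 8 - 3 / 4 * r ^ 2) / Y ^ 8) * (t * r)) * (4 * μ) ≤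
      p * (K / (8 * Y ^ 7) * (-2 * r ^ 2 + L ^ 8 / 2) / t) := by
  obtain ⟨hY2, hr0⟩ := rpow_two_le_of_regime hr hL hY h
  have hL8 : 0 < L ^ 8 := by positivity
  have e : 2 * (K / (4 * t ^ 2 * Y ^ 7) * (t * r)) +
      4 * (K / (4 * t ^ 2 * Y ^ 7) * (L ^ 8 - 3 / 4 * r ^ 2) / Y ^ 8) * (t * r) =
      K / (4 * t * Y ^ 15) * (r * (6 * L ^ 8 - r ^ 2)) := by
    have : L ^ 8 = Y ^ 8 - r ^ 2 := by linarith
    rw [this]; field_simp; ring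
  have e' : p * (K / (8 * Y ^ 7) * (-2 * r ^ 2 + L ^ 8 / 2) / t) =
      K / (4 * t * Y ^ 15) * (p * Y ^ 8 * (L ^ 8 / 4 - r ^ 2)) := by
    field_simp; ring
  have hc : 0 < K / (4 * t * Y ^ 15) := by positivity
  have hμ : 0 < μ := (mul_pos hp hr0).trans_le hpr
  rw [e, e']
  refine ⟨mul_nonpos_of_nonneg_of_nonpos hc.le
    (mul_nonpos_of_nonneg_of_nonpos hr (by linarith)), ?_⟩
  rw [mul_assoc (K / _)]
  refine mul_le_mul_of_nonneg_left ?_ hc.le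
  have h1 : r * (6 * L ^ 8 - r ^ 2) * (4 * μ) ≤ r * (-(r ^ 2 / 2)) * (4 * μ) := by
    gcongr; linarith
  have h2 : p * Y ^ 8 * (-r ^ 2) ≤ p * Y ^ 8 * (L ^ 8 / 4 - r ^ 2) := by
    gcongr; linarith
  have h3 : p * Y ^ 8 * r ^ 2 ≤ p * (2 * r ^ 2) * r ^ 2 := by gcongr
  have h4 : (p * r) * (2 * r ^ 3) ≤ μ * (2 * r ^ 3) := by gcongr
  linarith

theorem time_ge_of_regime {l θ : ℝ} (hK : 0 < K) (hl : 0 < l) (hθ : 0 < θ)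
    (hY0 : 0 < Y) (hY : Y ^ 8 = r ^ 2 + (l * θ) ^ 8) (h : r ^ 2 ≤ 12 * (l * θ) ^ 8) :
    -(K * l / 2 / θ ^ 15) ≤ K / (8 * Y ^ 7) * (-2 * r ^ 2 + (l * θ) ^ 8 / 2) / θ ^ 16 := by
  have hL8 : 0 < (l * θ) ^ 8 := by positivity
  have hY2 : Y ≤ 2 * (l * θ) := by
    refine le_of_pow_le_pow_left₀ (n := 8) (by norm_num) (by positivity) ?_
    rw [mul_pow 2 (l * θ)]; linarith
  have h1 : K / (8 * Y ^ 7) * (-2 * Y ^ 8) / θ ^ 16 ≤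
      K / (8 * Y ^ 7) * (-2 * r ^ 2 + (l * θ) ^ 8 / 2) / θ ^ 16 := by
    gcongr; linarith
  have h2 : K / (8 * Y ^ 7) * (-2 * Y ^ 8) / θ ^ 16 = -(K / 4 * Y / θ ^ 16) := by
    field_simp; norm_num
  have h3 : K / 4 * Y / θ ^ 16 ≤ K / 4 * (2 * (l * θ)) / θ ^ 16 := by gcongr
  have h4 : K / 4 * (2 * (l * θ)) / θ ^ 16 = K * l / 2 / θ ^ 15 := by field_simp; norm_num
  linarith

variable {E : Type*} [NormedAddCommGroup E] [InnerProductSpace ℝ E]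

set_option maxHeartbeats 1000000 in
/-- Doubling variables with `cost` produces no interior maximum. -/
theorem false_of_isLocalMax_cost [FiniteDimensional ℝ E] (hp : 1 < p) {w₁ w₂ : E → ℝ → ℝ}
    {x₀ y₀ : E} {l κ ε a m ϑ θ : ℝ} (hK : 0 < K) (hl : 0 < l) (hκ : 0 < κ) (hε : 0 < ε)
    (hm : 0 < m) (hϑ : 0 < ϑ) (hθ : 0 < θ) (hθ1 : θ < 1)
    (c1 : p * m ^ 4 ≤ K ^ 4 * min 1 (p - 1)) (c2 : 128 * κ * m ≤ K ^ 2)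
    (c3 : κ * m * K ≤ ε ^ 3 * l ^ 7)
    (c4 : p * (8 * K * l) + 16 * (48 * (√(p - 1) - 1) ^ 2 * ε +
      4 * κ * (Module.finrank ℝ E + p - 2)) ≤ p * a)
    (hYm : K * costBase l (‖x₀ - y₀‖ ^ 2) (θ ^ 16) ^ (1 / 8 : ℝ) ≤ m)
    (hx₀ : κ * ‖x₀‖ ^ 2 ≤ m) (hy₀ : κ * ‖y₀‖ ^ 2 ≤ m)
    (hw₁ : ∀ᶠ q in 𝓝 (x₀, θ ^ 16), ContinuousAt (fun q : E × ℝ => w₁ q.1 q.2) q ∧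
      IsJetSub p w₁ q.1 q.2)
    (hw₂ : ∀ᶠ q in 𝓝 (y₀, θ ^ 16), ContinuousAt (fun q : E × ℝ => w₂ q.1 q.2) q ∧
      IsJetSub p w₂ q.1 q.2)
    (hmax : ∀ᶠ q : E × E × ℝ in 𝓝 (x₀, y₀, θ ^ 16), w₁ q.1 q.2.2 + w₂ q.2.1 q.2.2 -
      cost K l a ϑ (‖q.1 - q.2.1‖ ^ 2) q.2.2 - κ * ‖q.1‖ ^ 2 - κ * ‖q.2.1‖ ^ 2 ≤
      w₁ x₀ (θ ^ 16) + w₂ y₀ (θ ^ 16) - cost K l a ϑ (‖x₀ - y₀‖ ^ 2) (θ ^ 16) -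
        κ * ‖x₀‖ ^ 2 - κ * ‖y₀‖ ^ 2) : False := by
  have hp0 : 0 < p := by linarith
  have ht : 0 < θ ^ 16 := by positivity
  have ht1 : θ ^ 16 < 1 := pow_lt_one₀ hθ.le hθ1 (by norm_num)
  set z := x₀ - y₀ with hz
  obtain ⟨Y, hYdef⟩ : ∃ Y, Y = costBase l (‖z‖ ^ 2) (θ ^ 16) ^ (1 / 8 : ℝ) := ⟨_, rfl⟩
  obtain ⟨Q, hQ⟩ : ∃ Q, Q = K / (4 * (θ ^ 16) ^ 2 * Y ^ 7) := ⟨_, rfl⟩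
  obtain ⟨r, hr⟩ : ∃ r, r = ‖z‖ ^ 2 / θ ^ 16 := ⟨_, rfl⟩
  rw [← hYdef] at hYm
  have hu := costBase_pos (ρ := ‖z‖ ^ 2) hl ht
  have hY0 : 0 < Y := hYdef ▸ Real.rpow_pos_of_pos hu _
  have hY : Y ^ 8 = r ^ 2 + (l * θ) ^ 8 := by
    rw [hYdef, ← Real.rpow_natCast, ← Real.rpow_mul hu.le, costBase,
      show θ ^ 16 = (θ ^ 8) ^ 2 by ring, Real.sqrt_sq (by positivity), hr]
    norm_num
    ring
  have hr0 : 0 ≤ r := by rw [hr]; positivity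
  have hρ : ‖z‖ ^ 2 = θ ^ 16 * r := by rw [hr]; field_simp
  have hL : 0 < l * θ := by positivity
  have hL8 : 0 < (l * θ) ^ 8 := by positivity
  have hQ0 : 0 ≤ Q := by rw [hQ]; positivity
  obtain ⟨b⟩ : Nonempty (OrthonormalBasis (Fin (Module.finrank ℝ E)) ℝ E) :=
    ⟨stdOrthonormalBasis ℝ E⟩
  obtain ⟨ν₁, ν₂, n1, n2, hν₁, hν₂, hall⟩ := exists_inclusion_radial
    (ι := Fin (Module.finrank ℝ E)) hp hw₁ hw₂
    (fun η hη => exists_eventually_cost_le hl hθ hθ1 hYdef hQ hη) hmax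
  rw [← hr] at hall
  have hk0 : 0 < 2 * √(κ * m) := by positivity
  have hk2 : (2 * √(κ * m)) ^ 2 = 4 * (κ * m) := by
    rw [mul_pow, Real.sq_sqrt (by positivity)]; norm_num
  have hq : ∀ x : E, κ * ‖x‖ ^ 2 ≤ m → ‖(2 * κ) • x‖ ≤ 2 * √(κ * m) := by
    intro x hx
    refine le_of_pow_le_pow_left₀ two_ne_zero hk0.le ?_
    rw [hk2, norm_smul, mul_pow, Real.norm_eq_abs, sq_abs]
    linarith [mul_le_mul_of_nonneg_left hx hκ.le]
  have hε' : 0 < ε / θ ^ 13 := by positivity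
  have hkQ : (2 * √(κ * m)) ^ 2 * Q ≤ (ε / θ ^ 13) ^ 3 := by
    have hYL : l * θ ≤ Y := by
      refine le_of_pow_le_pow_left₀ (n := 8) (by norm_num) hY0.le ?_
      linarith [sq_nonneg r]
    calc (2 * √(κ * m)) ^ 2 * Q
        ≤ 4 * (κ * m) * (K / (4 * (θ ^ 16) ^ 2 * (l * θ) ^ 7)) := by
          rw [hk2, hQ]; gcongr
      _ = κ * m * K / (θ ^ 39 * l ^ 7) := by field_simp
      _ ≤ ε ^ 3 * l ^ 7 / (θ ^ 39 * l ^ 7) := by gcongr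
      _ = (ε / θ ^ 13) ^ 3 := by field_simp
  have hprμ : p * r ≤ min 1 (p - 1) := by
    have h1 : r ≤ Y ^ 4 := by
      refine le_of_pow_le_pow_left₀ two_ne_zero (by positivity) ?_
      rw [← pow_mul]; norm_num; linarith
    have h2 : (K * Y) ^ 4 ≤ m ^ 4 := by gcongr
    refine le_of_mul_le_mul_left ?_ (pow_pos hK 4)
    calc K ^ 4 * (p * r) ≤ K ^ 4 * (p * Y ^ 4) := by gcongr
      _ = p * (K * Y) ^ 4 := by ring
      _ ≤ p * m ^ 4 := by gcongr
      _ ≤ _ := c1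
  have hr1 : r ≤ 1 := by
    linarith [hprμ.trans (min_le_left _ _), le_mul_of_one_le_left hr0 hp.le]
  have hsum : ∀ c : OrthonormalBasis (Fin (Module.finrank ℝ E)) ℝ E,
      ∑ k, 2 * κ * (‖sqrtDiff p ν₁ (b k)‖ ^ 2 + ‖sqrtDiff p ν₂ (c k)‖ ^ 2) =
        4 * κ * (Module.finrank ℝ E + p - 2) := by
    intro c
    rw [← Finset.mul_sum, Finset.sum_add_distrib, sum_norm_sqrtDiff hp b ν₁ n1,
      sum_norm_sqrtDiff hp c ν₂ n2]
    ring
  have hϑ' : 0 < p * (ϑ / (1 - θ ^ 16) ^ 2) := by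
    have : 0 < 1 - θ ^ 16 := by linarith
    positivity
  have hn : 0 ≤ 4 * κ * (Module.finrank ℝ E + p - 2) := by
    rw [← hsum b]; positivity
  have hθ13 : ε / θ ^ 13 ≤ ε / θ ^ 15 :=
    div_le_div_of_nonneg_left hε.le (by positivity)
      (pow_le_pow_of_le_one hθ.le hθ1.le (by norm_num))
  have hθ15 : 1 ≤ 1 / θ ^ 15 := by
    rw [le_div_iff₀ (by positivity), one_mul]; exact pow_le_one₀ hθ.le hθ1.le
  have hfin : p * (K * l / 2 / θ ^ 15) + 48 * (√(p - 1) - 1) ^ 2 * (ε / θ ^ 13) +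
      4 * κ * (Module.finrank ℝ E + p - 2) ≤ p * (a / 16 / θ ^ 15) := by
    have h1 : 48 * (√(p - 1) - 1) ^ 2 * (ε / θ ^ 13) ≤
        48 * (√(p - 1) - 1) ^ 2 * (ε / θ ^ 15) := by gcongr
    have h2 := mul_le_mul_of_nonneg_left hθ15 hn
    have h3 := mul_le_mul_of_nonneg_right c4 (zero_le_one.trans hθ15)
    have e1 : p * (K * l / 2 / θ ^ 15) = p * (8 * K * l) * (1 / θ ^ 15) / 16 := by
      field_simp; norm_num
    have e2 : ε / θ ^ 15 = ε * (1 / θ ^ 15) := by ring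
    have e3 : p * (a / 16 / θ ^ 15) = p * a * (1 / θ ^ 15) / 16 := by field_simp
    rw [e2] at h1
    rw [e1, e3]
    linarith
  have hh₁ : Q * ‖z‖ ^ 2 = Q * ‖z‖ ^ 2 := rfl
  have hKl : 0 ≤ p * (K * l / 2 / θ ^ 15) := by positivity
  have hεnn : 0 ≤ (√(p - 1) - 1) ^ 2 * (ε / θ ^ 13) := by positivity
  rcases le_total (12 * (l * θ) ^ 8) (r ^ 2) with hreg | hreg
  · obtain ⟨hneg, htime⟩ := radial_le_time_of_regime hK hr0 hL hY0 ht hp0 hprμ hY hreg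
    have hkh := sq_le_sq_mul_of_regime (K := K) hr0 hL hY0 ht ht1.le hr1 hY hreg
    rw [← hQ, ← hρ] at hneg htime hkh
    obtain ⟨c, hc⟩ := exists_basis_sum_radial_le hp hQ0 hε' hh₁ hkQ hneg
      (by rw [hk2]; linarith) hk0 (hq _ hx₀) (hq _ hy₀) n1 n2 hν₁ hν₂ b
    have h1 := hall b c
    rw [Finset.sum_add_distrib, hsum c] at h1
    linarith
  · have h21 : Q * ((l * θ) ^ 8 - 3 / 4 * r ^ 2) / Y ^ 8 * ‖z‖ ^ 2 ≤ Q * ‖z‖ ^ 2 := by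
      refine mul_le_mul_of_nonneg_right ?_ (sq_nonneg _)
      rw [div_le_iff₀ (by positivity)]
      refine mul_le_mul_of_nonneg_left ?_ hQ0
      linarith [sq_nonneg r]
    have h2 := sum_radial_le (p := p) hQ0 hε' hh₁ hkQ h21 hk0 (hq _ hx₀) (hq _ hy₀) n1 n2 hν₁ hν₂ b
    have htime := mul_le_mul_of_nonneg_left (time_ge_of_regime hK hl hθ hY0 hY hreg) hp0.le
    have h1 := hall b b
    rw [Finset.sum_add_distrib, hsum b] at h1
    linarith

end NoInteriorMax

section NullSubsolution

theorem exists_isMaxOn_of_superlevel {X : Type*} [TopologicalSpace X] {f : X → ℝ} {S C : Set X}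
    {a : X} (hC : IsCompact C) (hf : ContinuousOn f C) (ha : a ∈ S)
    (h : ∀ q ∈ S, f a ≤ f q → q ∈ C) : ∃ q ∈ C, f a ≤ f q ∧ ∀ q' ∈ S, f q' ≤ f q := by
  obtain ⟨q, hq, hmax⟩ := hC.exists_isMaxOn ⟨a, h a ha le_rfl⟩ hf
  have haq : f a ≤ f q := hmax (h a ha le_rfl)
  refine ⟨q, hq, haq, fun q' hq' => ?_⟩
  rcases le_total (f a) (f q') with h' | h'
  · exact hmax (h q' hq' h')
  · exact h'.trans haq

theorem eventually_mul_le (A : ℝ) {B : ℝ} (hB : 0 < B) : ∀ᶠ κ : ℝ in 𝓝[>] 0, κ * A ≤ B := by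
  have h : Tendsto (fun κ : ℝ => κ * A) (𝓝[>] 0) (𝓝 0) := by
    have := (continuous_mul_const A).tendsto (0 : ℝ)
    rw [zero_mul] at this
    exact this.mono_left nhdsWithin_le_nhds
  exact h.eventually (Iic_mem_nhds hB)

theorem continuousAt_cost {K l a ϑ ρ t : ℝ} (hl : 0 < l) (ht : 0 < t) (ht1 : t < 1) :
    ContinuousAt (fun q : ℝ × ℝ => cost K l a ϑ q.1 q.2) (ρ, t) := by
  have h1 : ContinuousAt (fun q : ℝ × ℝ => q.1) (ρ, t) := continuousAt_fst
  have h2 : ContinuousAt (fun q : ℝ × ℝ => q.2) (ρ, t) := continuousAt_snd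
  have h3 : ContinuousAt (fun q : ℝ × ℝ => costBase l q.1 q.2) (ρ, t) :=
    ((h1.pow 2).div (h2.pow 2) (pow_ne_zero 2 ht.ne')).add
      (continuousAt_const.mul (Real.continuous_sqrt.continuousAt.comp h2))
  exact ((continuousAt_const.mul (h3.rpow_const (Or.inl (costBase_pos hl ht).ne'))).add
    (continuousAt_const.mul (h2.rpow_const (Or.inl ht.ne')))).add
      (continuousAt_const.div (continuousAt_const.sub h2) (sub_pos.2 ht1).ne')

theorem cost_zero_le {K l a ϑ t : ℝ} (hK : 0 ≤ K) (hl : 0 ≤ l) (ha : 0 ≤ a) (ht : 0 ≤ t)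
    (ht1 : t ≤ 1) : cost K l a ϑ 0 t ≤ K * l + a + ϑ / (1 - t) := by
  have h1 : costBase l 0 t ^ (1 / 8 : ℝ) ≤ l := by
    have h2 : costBase l 0 t ≤ l ^ 8 := by
      have : l ^ 8 * √t ≤ l ^ 8 * 1 := by
        gcongr
        exact Real.sqrt_le_one.2 ht1
      simp only [costBase]
      linarith [zero_div (t ^ 2)]
    have h0 : 0 ≤ costBase l 0 t := by unfold costBase; positivity
    calc costBase l 0 t ^ (1 / 8 : ℝ) ≤ (l ^ 8) ^ (1 / 8 : ℝ) := by gcongr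
      _ = l := by rw [← Real.rpow_natCast, ← Real.rpow_mul hl]; norm_num
  have h2 : t ^ (1 / 16 : ℝ) ≤ 1 := Real.rpow_le_one ht ht1 (by norm_num)
  unfold cost
  have h3 := mul_le_mul_of_nonneg_left h1 hK
  have h4 := mul_le_mul_of_nonneg_left h2 ha
  linarith

theorem sq_le_of_costBase_rpow_le {K l ρ t m : ℝ} (hK : 0 < K) (hl : 0 < l) (ht : 0 < t)
    (h : K * costBase l ρ t ^ (1 / 8 : ℝ) ≤ m) : ρ ^ 2 ≤ t ^ 2 * (m / K) ^ 8 := by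
  have hu := costBase_pos (ρ := ρ) hl ht
  have h1 : costBase l ρ t ^ (1 / 8 : ℝ) ≤ m / K := by rwa [le_div_iff₀' hK]
  have h2 : costBase l ρ t ≤ (m / K) ^ 8 := by
    calc costBase l ρ t = (costBase l ρ t ^ (1 / 8 : ℝ)) ^ 8 := by
          rw [← Real.rpow_natCast, ← Real.rpow_mul hu.le]; norm_num
      _ ≤ (m / K) ^ 8 := by gcongr
  rw [← div_le_iff₀' (by positivity)]
  refine le_trans ?_ h2
  unfold costBase
  have : 0 ≤ l ^ 8 * √t := by positivity
  linarith

variable {E : Type*} [NormedAddCommGroup E] [InnerProductSpace ℝ E] {p : ℝ} {w : E → ℝ → ℝ}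

/-- Continuous nonnegative subsolutions on the whole space which, at every point of space, either
vanish at all positive times or have vanishing initial values. -/
structure IsNullSubsolution (p : ℝ) (w : E → ℝ → ℝ) : Prop where
  nonneg : ∀ x t, 0 < t → 0 ≤ w x t
  continuousAt : ∀ x t, 0 < t → ContinuousAt (fun q : E × ℝ => w q.1 q.2) (x, t)
  isJetSub : ∀ x t, 0 < t → IsJetSub p w x t
  initial : ∀ x, (∀ t, 0 < t → w x t = 0) ∨
    Tendsto (fun q : E × ℝ => w q.1 q.2) (𝓝 x ×ˢ 𝓝[>] 0) (𝓝 0)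

theorem IsNullSubsolution.comp_scale (hw : IsNullSubsolution p w) {R : ℝ} (hR : 0 < R) :
    IsNullSubsolution p fun x t => w (R • x) (R ^ 2 * t) where
  nonneg x t ht := hw.nonneg _ _ (by positivity)
  continuousAt x t ht := by
    have h1 : ContinuousAt (fun q : E × ℝ => (R • q.1, R ^ 2 * q.2)) (x, t) := by fun_prop
    exact ContinuousAt.comp (x := (x, t)) (g := fun q : E × ℝ => w q.1 q.2)
      (hw.continuousAt (R • x) (R ^ 2 * t) (by positivity)) h1
  isJetSub x t ht := by
    have := IsJetSub.comp_scale (x₀ := (0 : E)) (h := 0) (t := t) (x := x) hR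
      (by simpa using hw.isJetSub (R • x) (R ^ 2 * t) (by positivity))
    simpa using this
  initial x := by
    refine (hw.initial (R • x)).imp (fun h t ht => h _ (by positivity)) fun h => ?_
    have h1 : Tendsto (fun y : E => R • y) (𝓝 x) (𝓝 (R • x)) :=
      (continuous_const_smul R).tendsto x
    have h2 : Tendsto (fun t : ℝ => R ^ 2 * t) (𝓝[>] (0 : ℝ)) (𝓝[>] (0 : ℝ)) := by
      refine tendsto_nhdsWithin_iff.2 ⟨?_, ?_⟩
      · have := (continuous_const_mul (R ^ 2)).tendsto (0 : ℝ)
        rw [mul_zero] at this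
        exact this.mono_left nhdsWithin_le_nhds
      · filter_upwards [self_mem_nhdsWithin] with t ht
        exact mul_pos (a := R ^ 2) (by positivity) ht
    exact h.comp (h1.prodMap h2)

/-- Near the initial time, `w` and its time translate cannot both be close to the supremum. -/
theorem IsNullSubsolution.exists_forall_add_lt [FiniteDimensional ℝ E]
    (hw : IsNullSubsolution p w) {m h A c B : ℝ} (hm : ∀ x t, 0 < t → w x t ≤ m) (hh : 0 < h)
    (hc : 0 < c) : ∃ δ > 0, ∀ x y t, 0 < t → t ≤ δ → ‖x‖ ≤ A → (‖x - y‖ ^ 2) ^ 2 ≤ t ^ 2 * B →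
      w x t + w y (h + t) < m + c := by
  by_contra! hcon
  choose x y t ht htδ hxA hxy hlt using fun n : ℕ => hcon (1 / ((n : ℝ) + 1)) (by positivity)
  obtain ⟨x', -, φ, hφ, hx'⟩ := (isCompact_closedBall (0 : E) A).tendsto_subseq
    (fun n => mem_closedBall_zero_iff.2 (hxA n))
  have hδ0 : Tendsto (fun n => 1 / (((φ n : ℕ) : ℝ) + 1)) atTop (𝓝 0) :=
    tendsto_one_div_add_atTop_nhds_zero_nat.comp hφ.tendsto_atTop
  have ht0 : Tendsto (fun n => t (φ n)) atTop (𝓝 0) :=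
    squeeze_zero (fun n => (ht _).le) (fun n => htδ _) hδ0
  have hd : Tendsto (fun n => x (φ n) - y (φ n)) atTop (𝓝 0) := by
    have h1 : Tendsto (fun n => t (φ n) ^ 2 * B) atTop (𝓝 0) := by
      simpa using (ht0.pow 2).mul_const B
    have h2 : Tendsto (fun n => (‖x (φ n) - y (φ n)‖ ^ 2) ^ 2) atTop (𝓝 0) :=
      squeeze_zero (fun n => by positivity) (fun n => hxy _) h1
    have h3 : Tendsto (fun n => √(√((‖x (φ n) - y (φ n)‖ ^ 2) ^ 2))) atTop (𝓝 (√(√0))) :=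
      (h2.sqrt).sqrt
    refine tendsto_zero_iff_norm_tendsto_zero.2 ?_
    simpa [Real.sqrt_sq] using h3
  have hy' : Tendsto (fun n => y (φ n)) atTop (𝓝 x') := by
    simpa using hx'.sub hd
  rcases hw.initial x' with h0 | h0
  · have h1 : Tendsto (fun n => w (y (φ n)) (h + t (φ n))) atTop (𝓝 0) := by
      have h2 : Tendsto (fun n => (y (φ n), h + t (φ n))) atTop (𝓝 (x', h)) := by
        have := hy'.prodMk_nhds (ht0.const_add h)
        rwa [add_zero] at this
      have := (hw.continuousAt x' h hh).tendsto.comp h2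
      rwa [h0 h hh] at this
    obtain ⟨n, hn⟩ := (h1.eventually (gt_mem_nhds hc)).exists
    have := hlt (φ n)
    have := hm (x (φ n)) (t (φ n)) (ht _)
    linarith
  · have h1 : Tendsto (fun n => w (x (φ n)) (t (φ n))) atTop (𝓝 0) := by
      refine h0.comp (hx'.prodMk (tendsto_nhdsWithin_iff.2 ⟨ht0, ?_⟩))
      exact Eventually.of_forall fun n => ht _
    obtain ⟨n, hn⟩ := (h1.eventually (gt_mem_nhds hc)).exists
    have := hlt (φ n)
    have := hm (y (φ n)) (h + t (φ n)) (add_pos hh (ht _))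
    linarith

end NullSubsolution

section Liouville

variable {E : Type*} [NormedAddCommGroup E] [InnerProductSpace ℝ E] {p : ℝ} {w : E → ℝ → ℝ}

theorem exists_cost_parameters {p a' n m S A s : ℝ} (hp : 1 < p) (hS : 0 < S)
    (hs : 0 < s) : ∃ K l κ ε a ϑ : ℝ, 0 < K ∧ 0 < l ∧ 0 < κ ∧ 0 < ε ∧ 0 < a ∧ 0 < ϑ ∧
      p * m ^ 4 ≤ K ^ 4 * min 1 (p - 1) ∧ 128 * κ * m ≤ K ^ 2 ∧ κ * m * K ≤ ε ^ 3 * l ^ 7 ∧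
      p * (8 * K * l) + 16 * (48 * a' ^ 2 * ε + 4 * κ * (n + p - 2)) ≤ p * a ∧
      K * l + a + ϑ / s + 2 * (κ * A) < S := by
  have hp0 : 0 < p := by linarith
  obtain ⟨μ, hμ⟩ : ∃ μ, μ = min 1 (p - 1) := ⟨_, rfl⟩
  have hμ0 : 0 < μ := by rw [hμ]; exact lt_min one_pos (by linarith)
  obtain ⟨K, hK1, hK⟩ : ∃ K : ℝ, 1 ≤ K ∧ p * m ^ 4 ≤ K ^ 4 * μ := by
    refine ⟨max 1 (p * m ^ 4 / μ), le_max_left _ _, ?_⟩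
    rw [← div_le_iff₀ hμ0]
    exact (le_max_right 1 _).trans (le_self_pow₀ (le_max_left _ _) (by norm_num))
  have hK0 : 0 < K := by linarith
  obtain ⟨ε, hεle, hε⟩ := ((eventually_mul_le (768 * a' ^ 2)
    (show 0 < p * S / 24 by positivity)).and self_mem_nhdsWithin).exists
  have hε0 : 0 < ε := hε
  have hl0 : 0 < S / (96 * K) := by positivity
  have hKl : K * (S / (96 * K)) = S / 96 := by field_simp
  obtain ⟨κ, ⟨⟨⟨h1, h2⟩, h3⟩, h4⟩, hκ⟩ := (((((eventually_mul_le (128 * m)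
    (show 0 < K ^ 2 by positivity)).and (eventually_mul_le (m * K)
    (show 0 < ε ^ 3 * (S / (96 * K)) ^ 7 by positivity))).and
    (eventually_mul_le (64 * (n + p - 2)) (show 0 < p * S / 24 by positivity))).and
    (eventually_mul_le A (show 0 < S / 12 by positivity))).and self_mem_nhdsWithin).exists
  refine ⟨K, S / (96 * K), κ, ε, S / 6, s * (S / 6), hK0, hl0, hκ, hε0, by positivity,
    by positivity, hμ ▸ hK, by linarith, by linarith, ?_, ?_⟩
  · have : p * (8 * K * (S / (96 * K))) = p * (S / 12) := by
      rw [mul_assoc 8, hKl]; ring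
    linarith
  · rw [hKl, mul_div_cancel_left₀ _ hs.ne']
    linarith

set_option maxHeartbeats 1000000 in
theorem IsNullSubsolution.add_le [FiniteDimensional ℝ E] (hp : 1 < p)
    (hw : IsNullSubsolution p w) {m : ℝ} (hm0 : 0 < m) (hm : ∀ x t, 0 < t → w x t ≤ m)
    {h : ℝ} (hh : 0 < h) {x : E} {t : ℝ} (ht : 0 < t) (ht1 : t < 1) :
    w x t + w x (h + t) ≤ m := by
  by_contra! hcon
  obtain ⟨S, hS⟩ : ∃ S, S = (w x t + w x (h + t) - m) / 2 := ⟨_, rfl⟩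
  have hS0 : 0 < S := by rw [hS]; linarith
  have hs : 0 < 1 - t := sub_pos.2 ht1
  obtain ⟨K, l, κ, ε, a, ϑ, hK, hl, hκ, hε, ha, hϑ, c1, c2, c3, c4, c5⟩ :=
    exists_cost_parameters (m := m) (a' := √(p - 1) - 1) (n := Module.finrank ℝ E) (A := ‖x‖ ^ 2)
      hp hS0 hs
  obtain ⟨δ, hδ, hδlt⟩ := hw.exists_forall_add_lt (A := √(m / κ)) (B := (m / K) ^ 8) hm hh hS0
  set Φ : E × E × ℝ → ℝ := fun q => w q.1 q.2.2 + w q.2.1 (h + q.2.2) -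
    cost K l a ϑ (‖q.1 - q.2.1‖ ^ 2) q.2.2 - κ * ‖q.1‖ ^ 2 - κ * ‖q.2.1‖ ^ 2 with hΦ
  have hbase : m + S < Φ (x, x, t) := by
    have h1 := cost_zero_le (ϑ := ϑ) hK.le hl.le ha.le ht.le ht1.le
    simp only [hΦ, sub_self, norm_zero, ne_eq, OfNat.ofNat_ne_zero, not_false_eq_true, zero_pow]
    linarith
  have hlevel : ∀ q : E × E × ℝ, 0 < q.2.2 → q.2.2 < 1 → Φ (x, x, t) ≤ Φ q →
      K * costBase l (‖q.1 - q.2.1‖ ^ 2) q.2.2 ^ (1 / 8 : ℝ) ≤ m ∧ κ * ‖q.1‖ ^ 2 ≤ m ∧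
        κ * ‖q.2.1‖ ^ 2 ≤ m ∧ ϑ / (1 - q.2.2) ≤ m ∧ δ < q.2.2 := by
    rintro ⟨y, z, s⟩ hs0 hs1 hle
    dsimp only at hs0 hs1 ⊢
    have hs1' : 0 < 1 - s := by linarith
    have h1 : 0 ≤ K * costBase l (‖y - z‖ ^ 2) s ^ (1 / 8 : ℝ) := by
      have := (costBase_pos (ρ := ‖y - z‖ ^ 2) hl hs0).le
      positivity
    have h2 : 0 ≤ a * s ^ (1 / 16 : ℝ) := by positivity
    have h3 : 0 ≤ ϑ / (1 - s) := by positivity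
    have h4 : 0 ≤ κ * ‖y‖ ^ 2 := by positivity
    have h5 : 0 ≤ κ * ‖z‖ ^ 2 := by positivity
    have h6 := hm y s hs0
    have h7 := hm z (h + s) (by linarith)
    simp only [hΦ, cost] at hle hbase
    have hd : K * costBase l (‖y - z‖ ^ 2) s ^ (1 / 8 : ℝ) ≤ m := by linarith
    have hy : κ * ‖y‖ ^ 2 ≤ m := by linarith
    refine ⟨hd, hy, by linarith, by linarith, ?_⟩
    by_contra! hsδ
    have h8 := hδlt y z s hs0 hsδ (Real.le_sqrt_of_sq_le (by rwa [le_div_iff₀' hκ]))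
      (sq_le_of_costBase_rpow_le hK hl hs0 hd)
    linarith
  have hball : ∀ y : E, κ * ‖y‖ ^ 2 ≤ m → y ∈ closedBall (0 : E) √(m / κ) := fun y hy =>
    mem_closedBall_zero_iff.2 (Real.le_sqrt_of_sq_le (by rwa [le_div_iff₀' hκ]))
  have hcomp : IsCompact (closedBall (0 : E) √(m / κ) ×ˢ closedBall (0 : E) √(m / κ) ×ˢ
      Icc δ (1 - ϑ / m)) :=
    (isCompact_closedBall _ _).prod ((isCompact_closedBall _ _).prod isCompact_Icc)
  have hϑm : 0 < ϑ / m := by positivity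
  have hcont : ContinuousOn Φ (closedBall (0 : E) √(m / κ) ×ˢ closedBall (0 : E) √(m / κ) ×ˢ
      Icc δ (1 - ϑ / m)) := by
    rintro ⟨y, z, s⟩ ⟨-, -, hs1, hs2⟩
    dsimp only at hs1 hs2
    have hs0 : 0 < s := by linarith
    refine ContinuousAt.continuousWithinAt ?_
    have e1 : ContinuousAt (fun q : E × E × ℝ => (q.1, q.2.2)) (y, z, s) := by fun_prop
    have e2 : ContinuousAt (fun q : E × E × ℝ => (q.2.1, h + q.2.2)) (y, z, s) := by fun_prop
    have e3 : ContinuousAt (fun q : E × E × ℝ => (‖q.1 - q.2.1‖ ^ 2, q.2.2)) (y, z, s) := by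
      fun_prop
    have f1 := ContinuousAt.comp (x := (y, z, s)) (g := fun q : E × ℝ => w q.1 q.2)
      (hw.continuousAt y s hs0) e1
    have f2 := ContinuousAt.comp (x := (y, z, s)) (g := fun q : E × ℝ => w q.1 q.2)
      (hw.continuousAt z (h + s) (by linarith)) e2
    have f3 := ContinuousAt.comp (x := (y, z, s)) (continuousAt_cost (K := K) (a := a) (ϑ := ϑ)
      (ρ := ‖y - z‖ ^ 2) hl hs0 (by linarith)) e3
    have f4 : ContinuousAt (fun q : E × E × ℝ => κ * ‖q.1‖ ^ 2) (y, z, s) := by fun_prop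
    have f5 : ContinuousAt (fun q : E × E × ℝ => κ * ‖q.2.1‖ ^ 2) (y, z, s) := by fun_prop
    exact (((f1.add f2).sub f3).sub f4).sub f5
  obtain ⟨⟨x₀, y₀, t₀⟩, ⟨-, -, ht₀, ht₀'⟩, hbig, hmax⟩ := exists_isMaxOn_of_superlevel hcomp hcont
    (S := {q : E × E × ℝ | 0 < q.2.2 ∧ q.2.2 < 1}) (a := (x, x, t)) ⟨ht, ht1⟩ (by
      rintro q ⟨hq0, hq1⟩ hle
      obtain ⟨-, h2, h3, h4, h5⟩ := hlevel q hq0 hq1 hle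
      refine ⟨hball _ h2, hball _ h3, h5.le, ?_⟩
      have : ϑ / m ≤ 1 - q.2.2 := by
        rw [div_le_iff₀ (by linarith)] at h4 ⊢
        linarith
      linarith)
  dsimp only at ht₀ ht₀'
  have ht₀0 : 0 < t₀ := by linarith
  have ht₀1 : t₀ < 1 := by linarith
  obtain ⟨h1, h2, h3, -, -⟩ := hlevel _ ht₀0 ht₀1 hbig
  obtain ⟨θ, hθ0, hθ1, rfl⟩ : ∃ θ : ℝ, 0 < θ ∧ θ < 1 ∧ θ ^ 16 = t₀ := by
    refine ⟨t₀ ^ (1 / 16 : ℝ), by positivity, Real.rpow_lt_one ht₀0.le ht₀1 (by norm_num), ?_⟩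
    rw [← Real.rpow_natCast, ← Real.rpow_mul ht₀0.le]
    norm_num
  refine false_of_isLocalMax_cost hp (w₁ := w) (w₂ := fun y s => w y (h + s)) hK hl hκ hε hm0 hϑ
    hθ0 hθ1 c1 c2 c3 c4 h1 h2 h3 ?_ ?_ ?_
  · filter_upwards [continuous_snd.tendsto (x₀, θ ^ 16) (Ioi_mem_nhds ht₀0)] with q hq
    exact ⟨hw.continuousAt _ _ hq, hw.isJetSub _ _ hq⟩
  · filter_upwards [continuous_snd.tendsto (y₀, θ ^ 16) (Ioi_mem_nhds ht₀0)] with q hq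
    have hq' : 0 < h + q.2 := add_pos hh hq
    have e1 : ContinuousAt (fun q : E × ℝ => (q.1, h + q.2)) q := by fun_prop
    refine ⟨ContinuousAt.comp (x := q) (g := fun q : E × ℝ => w q.1 q.2)
      (hw.continuousAt q.1 (h + q.2) hq') e1, ?_⟩
    have := IsJetSub.comp_scale (x₀ := (0 : E)) (h := h) (t := q.2) (x := q.1) one_pos
      (by simpa using hw.isJetSub q.1 (h + q.2) hq')
    simpa using this
  · filter_upwards [(continuous_snd.comp continuous_snd).tendsto (x₀, y₀, θ ^ 16)
      (Ioo_mem_nhds ht₀0 ht₀1)] with q hq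
    exact hmax q hq

theorem IsNullSubsolution.two_mul_le [FiniteDimensional ℝ E] (hp : 1 < p)
    (hw : IsNullSubsolution p w) {m : ℝ} (hm0 : 0 < m) (hm : ∀ x t, 0 < t → w x t ≤ m)
    (x : E) {t : ℝ} (ht : 0 < t) : 2 * w x t ≤ m := by
  have key : ∀ w' : E → ℝ → ℝ, IsNullSubsolution p w' → (∀ x t, 0 < t → w' x t ≤ m) →
      ∀ y : E, 2 * w' y (1 / 2) ≤ m := by
    intro w' hw' hm' y
    have h1 : Tendsto (fun h : ℝ => w' y (1 / 2) + w' y (h + 1 / 2)) (𝓝[>] 0)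
        (𝓝 (w' y (1 / 2) + w' y (1 / 2))) := by
      refine tendsto_const_nhds.add ?_
      have h2 : Tendsto (fun h : ℝ => (y, h + 1 / 2)) (𝓝[>] 0) (𝓝 (y, 1 / 2)) := by
        have : Continuous fun h : ℝ => (y, h + 1 / 2) := by fun_prop
        have := this.tendsto 0
        rw [zero_add] at this
        exact this.mono_left nhdsWithin_le_nhds
      exact (hw'.continuousAt y (1 / 2) (by norm_num)).tendsto.comp h2
    rw [two_mul]
    refine le_of_tendsto h1 ?_
    filter_upwards [self_mem_nhdsWithin] with h hh
    exact hw'.add_le hp hm0 hm' hh (by norm_num) (by norm_num)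
  have hR : 0 < √(2 * t) := by positivity
  have := key _ (hw.comp_scale hR) (fun x s hs => hm _ _ (by positivity)) (√(2 * t)⁻¹ • x)
  have e : √(2 * t) ^ 2 * (1 / 2) = t := by rw [Real.sq_sqrt (by positivity)]; ring
  rwa [e, smul_smul, Real.sqrt_inv, mul_inv_cancel₀ hR.ne', one_smul] at this

/-- A bounded null subsolution vanishes. -/
theorem IsNullSubsolution.eq_zero [FiniteDimensional ℝ E] (hp : 1 < p)
    (hw : IsNullSubsolution p w) {M : ℝ} (hM : ∀ x t, 0 < t → w x t ≤ M) (x : E) {t : ℝ}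
    (ht : 0 < t) : w x t = 0 := by
  set A : Set ℝ := {r | ∃ x t, 0 < t ∧ r = w x t}
  have hne : A.Nonempty := ⟨_, x, t, ht, rfl⟩
  have hbdd : BddAbove A := ⟨M, by rintro r ⟨x, t, ht, rfl⟩; exact hM x t ht⟩
  have hle : ∀ x t, 0 < t → w x t ≤ sSup A := fun x t ht => le_csSup hbdd ⟨x, t, ht, rfl⟩
  have hsup : sSup A ≤ 0 := by
    by_contra! hpos
    have : sSup A ≤ sSup A / 2 := by
      refine csSup_le hne ?_
      rintro r ⟨x, t, ht, rfl⟩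
      linarith [hw.two_mul_le hp hpos hle x ht]
    linarith
  exact le_antisymm ((hle x t ht).trans hsup) (hw.nonneg x t ht)

end Liouville

section BallComparison

theorem exists_eventually_quadratic_le {j ϑ T ρ t₀ η : ℝ} (hϑ : 0 < ϑ) (ht : t₀ < T) (hη : 0 < η) :
    ∃ C : ℝ, ∀ᶠ q : ℝ × ℝ in 𝓝 (ρ, t₀), j * q.1 ^ 2 + ϑ / (T - q.2) ≤
      j * ρ ^ 2 + ϑ / (T - t₀) + 2 * j * ρ * (q.1 - ρ) + 2 * j / 2 * (q.1 - ρ) ^ 2 +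
        ϑ / (T - t₀) ^ 2 * (q.2 - t₀) + η * (q.1 - ρ) ^ 2 + C * (q.2 - t₀) ^ 2 := by
  have hT : 0 < T - t₀ := sub_pos.2 ht
  refine ⟨2 * ϑ / (T - t₀) ^ 3, ?_⟩
  filter_upwards [continuous_snd.tendsto (ρ, t₀)
    (Iio_mem_nhds (show t₀ < (T + t₀) / 2 by linarith))] with q hq
  have hq' : (T - t₀) / 2 ≤ T - q.2 := by
    have : q.2 < (T + t₀) / 2 := hq
    linarith
  have hq0 : 0 < T - q.2 := by linarith
  have e : ϑ / (T - q.2) = ϑ / (T - t₀) + ϑ / (T - t₀) ^ 2 * (q.2 - t₀) +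
      ϑ / ((T - q.2) * (T - t₀) ^ 2) * (q.2 - t₀) ^ 2 := by
    field_simp; ring
  have h1 : ϑ / ((T - q.2) * (T - t₀) ^ 2) * (q.2 - t₀) ^ 2 ≤
      2 * ϑ / (T - t₀) ^ 3 * (q.2 - t₀) ^ 2 := by
    refine mul_le_mul_of_nonneg_right ?_ (sq_nonneg _)
    calc ϑ / ((T - q.2) * (T - t₀) ^ 2) ≤ ϑ / ((T - t₀) / 2 * (T - t₀) ^ 2) := by gcongr
      _ = 2 * ϑ / (T - t₀) ^ 3 := by field_simp
  have h2 : 0 ≤ η * (q.1 - ρ) ^ 2 := by positivity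
  linarith

theorem ContinuousWithinAt.continuousAt_of_norm_lt {F : Type*} [NormedAddCommGroup F]
    {f : F × ℝ → ℝ} {x : F} {t : ℝ}
    (h : ContinuousWithinAt f (closedBall 0 1 ×ˢ Ici 0) (x, t)) (hx : ‖x‖ < 1) (ht : 0 < t) :
    ContinuousAt f (x, t) :=
  h.continuousAt (prod_mem_nhds (closedBall_mem_nhds_of_mem (by simpa using hx)) (Ici_mem_nhds ht))

variable {E : Type*} [NormedAddCommGroup E] [InnerProductSpace ℝ E] {p : ℝ}

theorem sqrtDiff_neg (ν v : E) : sqrtDiff p (-ν) v = sqrtDiff p ν v := by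
  simp [sqrtDiff, inner_neg_left]

theorem false_of_isLocalMax_quadratic [FiniteDimensional ℝ E] (hp : 1 < p) {w₁ w₂ : E → ℝ → ℝ}
    {x₀ y₀ : E} {t₀ j ϑ T : ℝ} (hj : 0 < j) (hϑ : 0 < ϑ) (ht : t₀ < T)
    (hw₁ : ∀ᶠ q in 𝓝 (x₀, t₀), ContinuousAt (fun q : E × ℝ => w₁ q.1 q.2) q ∧
      IsJetSub p w₁ q.1 q.2)
    (hw₂ : ∀ᶠ q in 𝓝 (y₀, t₀), ContinuousAt (fun q : E × ℝ => w₂ q.1 q.2) q ∧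
      IsJetSub p w₂ q.1 q.2)
    (hmax : ∀ᶠ q : E × E × ℝ in 𝓝 (x₀, y₀, t₀), w₁ q.1 q.2.2 + w₂ q.2.1 q.2.2 -
      (j * (‖q.1 - q.2.1‖ ^ 2) ^ 2 + ϑ / (T - q.2.2)) ≤
      w₁ x₀ t₀ + w₂ y₀ t₀ - (j * (‖x₀ - y₀‖ ^ 2) ^ 2 + ϑ / (T - t₀))) : False := by
  obtain ⟨ν₁, ν₂, -, -, hν₁, hν₂, hall⟩ := exists_inclusion_radial
    (ι := Fin (Module.finrank ℝ E)) (κ := 0) (G := fun ρ t => j * ρ ^ 2 + ϑ / (T - t)) hp hw₁ hw₂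
    (fun η hη => exists_eventually_quadratic_le hϑ ht hη) (by simpa using hmax)
  have h1 := hall (stdOrthonormalBasis ℝ E) (stdOrthonormalBasis ℝ E)
  have h2 : 0 < p * (ϑ / (T - t₀) ^ 2) := by
    have : 0 < T - t₀ := sub_pos.2 ht
    have : 0 < p := by linarith
    positivity
  refine absurd h1 (not_le.2 ?_)
  refine lt_of_eq_of_lt (Finset.sum_eq_zero fun k _ => ?_) h2
  by_cases hz : x₀ - y₀ = 0
  · simp [hz]
  · have hne : (2 * (2 * j * ‖x₀ - y₀‖ ^ 2)) • (x₀ - y₀) ≠ 0 := by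
      refine smul_ne_zero ?_ hz
      have := norm_pos_iff.2 hz
      positivity
    simp only [mul_zero, zero_smul, add_zero, neg_smul, neg_ne_zero, norm_neg, smul_neg]
      at hν₁ hν₂
    have e : sqrtDiff p ν₁ = sqrtDiff p ν₂ := by
      rw [hν₁ hne, hν₂ hne]
      exact funext fun v => (sqrtDiff_neg _ v).symm
    simp [e]

variable {U V : E → ℝ → ℝ}

theorem exists_forall_ball_sub_lt [FiniteDimensional ℝ E] {T c : ℝ} (hc : 0 < c)
    (hUc : ∀ x t, ‖x‖ < 1 → 0 ≤ t → ContinuousWithinAt (fun q : E × ℝ => U q.1 q.2)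
      (closedBall 0 1 ×ˢ Ici 0) (x, t))
    (hVc : ∀ x t, ‖x‖ ≤ 1 → 0 ≤ t → ContinuousWithinAt (fun q : E × ℝ => V q.1 q.2)
      (closedBall 0 1 ×ˢ Ici 0) (x, t))
    (hU1 : ∀ x t, ‖x‖ ≤ 1 → 0 < t → U x t ≤ 1) (hU0 : ∀ x, ‖x‖ < 1 → U x 0 ≤ 0)
    (hV0 : ∀ x t, ‖x‖ ≤ 1 → 0 < t → 0 ≤ V x t) (hV1 : ∀ x t, ‖x‖ = 1 → 0 ≤ t → V x t = 1) :
    ∃ j > 0, ∃ δ > 0, ∀ x y t, ‖x‖ ≤ 1 → ‖y‖ ≤ 1 → 0 < t → t ≤ T →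
      c ≤ U x t - V y t - j * (‖x - y‖ ^ 2) ^ 2 → ‖x‖ ≤ 1 - δ ∧ ‖y‖ ≤ 1 - δ ∧ δ ≤ t := by
  by_contra! hcon
  have hcon' : ∀ n : ℕ, ∃ x y t, ‖x‖ ≤ 1 ∧ ‖y‖ ≤ 1 ∧ 0 < t ∧ t ≤ T ∧
      c ≤ U x t - V y t - (n + 1 : ℝ) * (‖x - y‖ ^ 2) ^ 2 ∧
      ¬(‖x‖ ≤ 1 - 1 / (n + 1 : ℝ) ∧ ‖y‖ ≤ 1 - 1 / (n + 1 : ℝ) ∧ 1 / (n + 1 : ℝ) ≤ t) := by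
    intro n
    obtain ⟨x, y, t, h1, h2, h3, h4, h5, h6⟩ :=
      hcon (n + 1 : ℝ) (by positivity) (1 / (n + 1 : ℝ)) (by positivity)
    exact ⟨x, y, t, h1, h2, h3, h4, h5, fun h => (h6 h.1 h.2.1).not_ge h.2.2⟩
  choose x y t hx hy ht htT hle hnot using hcon'
  obtain ⟨⟨x', t'⟩, ⟨hx'1, ht'1⟩, φ, hφ, hlim⟩ :=
    ((isCompact_closedBall (0 : E) 1).prod (isCompact_Icc (a := (0 : ℝ)) (b := T))).tendsto_subseq
      (x := fun n => (x n, t n)) (fun n => ⟨mem_closedBall_zero_iff.2 (hx n), (ht n).le, htT n⟩)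
  have hx' : Tendsto (fun n => x (φ n)) atTop (𝓝 x') := (continuous_fst.tendsto _).comp hlim
  have ht' : Tendsto (fun n => t (φ n)) atTop (𝓝 t') := (continuous_snd.tendsto _).comp hlim
  have hx'1 : ‖x'‖ ≤ 1 := mem_closedBall_zero_iff.1 hx'1
  have ht'0 : 0 ≤ t' := ht'1.1
  have hδ0 : Tendsto (fun n => 1 / (((φ n : ℕ) : ℝ) + 1)) atTop (𝓝 0) :=
    tendsto_one_div_add_atTop_nhds_zero_nat.comp hφ.tendsto_atTop
  have hd : Tendsto (fun n => x (φ n) - y (φ n)) atTop (𝓝 0) := by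
    have h2 : Tendsto (fun n => (‖x (φ n) - y (φ n)‖ ^ 2) ^ 2) atTop (𝓝 0) := by
      refine squeeze_zero (fun n => by positivity) (fun n => ?_) hδ0
      rw [le_div_iff₀' (by positivity)]
      linarith [hle (φ n), hU1 _ _ (hx (φ n)) (ht (φ n)), hV0 _ _ (hy (φ n)) (ht (φ n))]
    have h3 : Tendsto (fun n => √(√((‖x (φ n) - y (φ n)‖ ^ 2) ^ 2))) atTop (𝓝 (√(√0))) :=
      (h2.sqrt).sqrt
    refine tendsto_zero_iff_norm_tendsto_zero.2 ?_
    simpa [Real.sqrt_sq] using h3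
  have hy' : Tendsto (fun n => y (φ n)) atTop (𝓝 x') := by
    simpa using hx'.sub hd
  have hpen : ∀ n, 0 ≤ ((n : ℕ) + 1 : ℝ) * (‖x n - y n‖ ^ 2) ^ 2 := fun n => by positivity
  rcases hx'1.eq_or_lt with h1 | h1
  · have h2 : Tendsto (fun n => V (y (φ n)) (t (φ n))) atTop (𝓝 1) := by
      have h3 : Tendsto (fun n => (y (φ n), t (φ n))) atTop
          (𝓝[closedBall 0 1 ×ˢ Ici 0] (x', t')) :=
        tendsto_nhdsWithin_iff.2 ⟨hy'.prodMk_nhds ht', Eventually.of_forall fun n =>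
          ⟨mem_closedBall_zero_iff.2 (hy _), (ht _).le⟩⟩
      have := (hVc x' t' hx'1 ht'0).tendsto.comp h3
      rwa [hV1 x' t' h1 ht'0] at this
    obtain ⟨n, hn⟩ := (h2.eventually (lt_mem_nhds (show 1 - c < 1 by linarith))).exists
    linarith [hle (φ n), hU1 _ _ (hx (φ n)) (ht (φ n)), hpen (φ n)]
  rcases ht'0.eq_or_lt with h0 | h0
  · subst h0
    have h2 : Tendsto (fun n => U (x (φ n)) (t (φ n))) atTop (𝓝 (U x' 0)) := by
      have h3 : Tendsto (fun n => (x (φ n), t (φ n))) atTop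
          (𝓝[closedBall 0 1 ×ˢ Ici 0] (x', 0)) :=
        tendsto_nhdsWithin_iff.2 ⟨hx'.prodMk_nhds ht', Eventually.of_forall fun n =>
          ⟨mem_closedBall_zero_iff.2 (hx _), (ht _).le⟩⟩
      exact (hUc x' 0 h1 le_rfl).tendsto.comp h3
    obtain ⟨n, hn⟩ := (h2.eventually (gt_mem_nhds ((hU0 x' h1).trans_lt hc))).exists
    linarith [hle (φ n), hV0 _ _ (hy (φ n)) (ht (φ n)), hpen (φ n)]
  · have hδ1 : Tendsto (fun n => 1 - 1 / (((φ n : ℕ) : ℝ) + 1)) atTop (𝓝 1) := by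
      simpa using hδ0.const_sub 1
    obtain ⟨n, ⟨h2, h3⟩, h4⟩ := (((hx'.norm.eventually_lt hδ1 h1).and
      (hy'.norm.eventually_lt hδ1 h1)).and (hδ0.eventually_lt ht' h0)).exists
    exact hnot (φ n) ⟨h2.le, h3.le, h4.le⟩

/-- Comparison on the unit ball when the supersolution equals one on the lateral boundary up to
the initial time. -/
theorem le_of_isJetSub_ball [FiniteDimensional ℝ E] (hp : 1 < p)
    (hUc : ∀ x t, ‖x‖ < 1 → 0 ≤ t → ContinuousWithinAt (fun q : E × ℝ => U q.1 q.2)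
      (closedBall 0 1 ×ˢ Ici 0) (x, t))
    (hVc : ∀ x t, ‖x‖ ≤ 1 → 0 ≤ t → ContinuousWithinAt (fun q : E × ℝ => V q.1 q.2)
      (closedBall 0 1 ×ˢ Ici 0) (x, t))
    (hU1 : ∀ x t, ‖x‖ ≤ 1 → 0 < t → U x t ≤ 1) (hU0 : ∀ x, ‖x‖ < 1 → U x 0 ≤ 0)
    (hV0 : ∀ x t, ‖x‖ ≤ 1 → 0 < t → 0 ≤ V x t) (hV1 : ∀ x t, ‖x‖ = 1 → 0 ≤ t → V x t = 1)
    (hUj : ∀ x t, ‖x‖ < 1 → 0 < t → IsJetSub p U x t)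
    (hVj : ∀ x t, ‖x‖ < 1 → 0 < t → IsJetSub p (fun x t => -V x t) x t)
    {x : E} {t : ℝ} (hx : ‖x‖ < 1) (ht : 0 < t) : U x t ≤ V x t := by
  by_contra! hcon
  obtain ⟨c, hc⟩ : ∃ c, c = (U x t - V x t) / 2 := ⟨_, rfl⟩
  have hc0 : 0 < c := by rw [hc]; linarith
  obtain ⟨j, hj, δ, hδ, hlev⟩ :=
    exists_forall_ball_sub_lt (T := t + 1) hc0 hUc hVc hU1 hU0 hV0 hV1
  set Φ : E × E × ℝ → ℝ := fun q => U q.1 q.2.2 + -V q.2.1 q.2.2 -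
    (j * (‖q.1 - q.2.1‖ ^ 2) ^ 2 + c / (t + 1 - q.2.2)) with hΦ
  have hbase : Φ (x, x, t) = c := by
    simp only [hΦ, sub_self, norm_zero, add_sub_cancel_left, div_one]
    linarith
  have hcomp : IsCompact (closedBall (0 : E) (1 - δ) ×ˢ closedBall (0 : E) (1 - δ) ×ˢ
      Icc δ (t + 1 - c)) :=
    (isCompact_closedBall _ _).prod ((isCompact_closedBall _ _).prod isCompact_Icc)
  have hUat : ∀ x t, ‖x‖ < 1 → 0 < t → ContinuousAt (fun q : E × ℝ => U q.1 q.2) (x, t) :=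
    fun x t hx ht => (hUc x t hx ht.le).continuousAt_of_norm_lt hx ht
  have hVat : ∀ x t, ‖x‖ < 1 → 0 < t → ContinuousAt (fun q : E × ℝ => -V q.1 q.2) (x, t) :=
    fun x t hx ht => ((hVc x t hx.le ht.le).continuousAt_of_norm_lt hx ht).neg
  have hcont : ContinuousOn Φ (closedBall (0 : E) (1 - δ) ×ˢ closedBall (0 : E) (1 - δ) ×ˢ
      Icc δ (t + 1 - c)) := by
    rintro ⟨y, z, s⟩ ⟨hy, hz, hs1, hs2⟩
    have hy := mem_closedBall_zero_iff.1 hy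
    have hz := mem_closedBall_zero_iff.1 hz
    dsimp only at hs1 hs2 hy hz
    have hs0 : 0 < s := by linarith
    refine ContinuousAt.continuousWithinAt ?_
    have e1 : ContinuousAt (fun q : E × E × ℝ => (q.1, q.2.2)) (y, z, s) := by fun_prop
    have e2 : ContinuousAt (fun q : E × E × ℝ => (q.2.1, q.2.2)) (y, z, s) := by fun_prop
    have f1 := ContinuousAt.comp (x := (y, z, s)) (g := fun q : E × ℝ => U q.1 q.2)
      (hUat y s (by linarith) hs0) e1
    have f2 := ContinuousAt.comp (x := (y, z, s)) (g := fun q : E × ℝ => -V q.1 q.2)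
      (hVat z s (by linarith) hs0) e2
    have f3 : ContinuousAt (fun q : E × E × ℝ => j * (‖q.1 - q.2.1‖ ^ 2) ^ 2) (y, z, s) := by
      fun_prop
    have f4 : ContinuousAt (fun q : E × E × ℝ => c / (t + 1 - q.2.2)) (y, z, s) := by
      refine ContinuousAt.div (by fun_prop) (by fun_prop) ?_
      dsimp only
      linarith
    exact (f1.add f2).sub (f3.add f4)
  obtain ⟨⟨x₀, y₀, t₀⟩, ⟨hx₀, hy₀, ht₀, ht₀'⟩, -, hmax⟩ :=
    exists_isMaxOn_of_superlevel hcomp hcont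
      (S := {q : E × E × ℝ | ‖q.1‖ < 1 ∧ ‖q.2.1‖ < 1 ∧ 0 < q.2.2 ∧ q.2.2 < t + 1})
      (a := (x, x, t)) ⟨hx, hx, ht, by simp⟩ (by
        rintro ⟨y, z, s⟩ ⟨hy, hz, hs, hs'⟩ hle
        dsimp only at hy hz hs hs'
        rw [hbase] at hle
        simp only [hΦ] at hle
        have hs1 : 0 < t + 1 - s := by linarith
        have h1 : 0 ≤ c / (t + 1 - s) := by positivity
        have h2 : 0 ≤ j * (‖y - z‖ ^ 2) ^ 2 := by positivity
        obtain ⟨h3, h4, h5⟩ := hlev y z s hy.le hz.le hs hs'.le (by linarith)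
        refine ⟨mem_closedBall_zero_iff.2 h3, mem_closedBall_zero_iff.2 h4, h5, ?_⟩
        have h6 : c / (t + 1 - s) ≤ 1 := by
          linarith [hU1 y s hy.le hs, hV0 z s hz.le hs]
        rw [div_le_one hs1] at h6
        dsimp only
        linarith)
  have hx₀ := mem_closedBall_zero_iff.1 hx₀
  have hy₀ := mem_closedBall_zero_iff.1 hy₀
  dsimp only at hx₀ hy₀ ht₀ ht₀'
  have hx1 : ‖x₀‖ < 1 := by linarith
  have hy1 : ‖y₀‖ < 1 := by linarith
  have ht0 : 0 < t₀ := by linarith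
  have ht1 : t₀ < t + 1 := by linarith
  have hev : ∀ z : E, ‖z‖ < 1 → ∀ᶠ q in 𝓝 (z, t₀), ‖q.1‖ < 1 ∧ 0 < q.2 := fun z hz =>
    ((continuous_fst.norm.tendsto (z, t₀)).eventually_lt_const hz).and
      ((continuous_snd.tendsto (z, t₀)).eventually_const_lt ht0)
  refine false_of_isLocalMax_quadratic hp hj hc0 ht1
    ((hev x₀ hx1).mono fun q hq => ⟨hUat _ _ hq.1 hq.2, hUj _ _ hq.1 hq.2⟩)
    ((hev y₀ hy1).mono fun q hq => ⟨hVat _ _ hq.1 hq.2, hVj _ _ hq.1 hq.2⟩) ?_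
  have c1 : Continuous fun q : E × E × ℝ => ‖q.1‖ := by fun_prop
  have c2 : Continuous fun q : E × E × ℝ => ‖q.2.1‖ := by fun_prop
  have c3 : Continuous fun q : E × E × ℝ => q.2.2 := by fun_prop
  filter_upwards [(c1.tendsto (x₀, y₀, t₀)).eventually_lt_const hx1,
    (c2.tendsto (x₀, y₀, t₀)).eventually_lt_const hy1,
    (c3.tendsto (x₀, y₀, t₀)).eventually_const_lt ht0,
    (c3.tendsto (x₀, y₀, t₀)).eventually_lt_const ht1] with q h1 h2 h3 h4
  exact hmax q ⟨h1, h2, h3, h4⟩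

end BallComparison

section PositivePart

variable {E : Type*} {p : ℝ} {v : E → ℝ → ℝ} {Ω : Set E}

/-- The positive part of `v` on `Ω`, extended by zero. -/
def truncation (Ω : Set E) (v : E → ℝ → ℝ) (x : E) (t : ℝ) : ℝ :=
  if x ∈ Ω then max (v x t) 0 else 0

theorem truncation_nonneg (x : E) (t : ℝ) : 0 ≤ truncation Ω v x t := by
  unfold truncation
  split_ifs
  exacts [le_max_right _ _, le_rfl]

theorem eventually_truncation_lt [TopologicalSpace E] {x : E} {t a : ℝ} (ha : 0 < a)
    (h : x ∈ closure Ω → v x t ≤ 0 ∧ ContinuousWithinAt (fun q : E × ℝ => v q.1 q.2)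
      (closure Ω ×ˢ Ici 0) (x, t)) :
    ∀ᶠ q : E × ℝ in 𝓝 (x, t), 0 < q.2 → truncation Ω v q.1 q.2 < a := by
  by_cases hx : x ∈ closure Ω
  · obtain ⟨h1, h2⟩ := h hx
    have h3 := h2.tendsto.eventually_lt_const (h1.trans_lt ha)
    filter_upwards [eventually_nhdsWithin_iff.1 h3] with q hq hq0
    unfold truncation
    split_ifs with hqΩ
    exacts [max_lt (hq ⟨subset_closure hqΩ, hq0.le⟩) ha, ha]
  · filter_upwards [continuous_fst.tendsto (x, t) (isClosed_closure.isOpen_compl.mem_nhds hx)]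
      with q hq _
    have : q.1 ∉ Ω := fun hqΩ => hq (subset_closure hqΩ)
    rwa [truncation, if_neg this]

theorem eventually_truncation_eq [TopologicalSpace E] (hΩ : IsOpen Ω) {x : E} {t : ℝ} (hx : x ∈ Ω) :
    ∀ᶠ q : E × ℝ in 𝓝 (x, t), truncation Ω v q.1 q.2 = max (v q.1 q.2) 0 := by
  filter_upwards [continuous_fst.tendsto (x, t) (hΩ.mem_nhds hx)] with q hq
  exact if_pos hq

variable [NormedAddCommGroup E] [InnerProductSpace ℝ E] [FiniteDimensional ℝ E] [Nontrivial E]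

theorem isJetSub_truncation (hp : 1 < p) (hΩ : IsOpen Ω) {x : E} {t : ℝ}
    (hj : x ∈ Ω → IsJetSub p v x t) : IsJetSub p (truncation Ω v) x t := by
  by_cases h : x ∈ Ω ∧ 0 ≤ v x t
  · refine (hj h.1).of_le ?_ (by rw [truncation, if_pos h.1, max_eq_left h.2])
    filter_upwards [eventually_truncation_eq hΩ h.1] with q hq
    rw [hq]
    exact le_max_left _ _
  · refine (isJetSub_const hp 0).of_le (Eventually.of_forall fun q => truncation_nonneg _ _) ?_
    unfold truncation
    split_ifs with hx
    exacts [max_eq_right (le_of_lt (not_le.1 fun h' => h ⟨hx, h'⟩)), rfl]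

/-- Bounded subsolutions which are nonpositive on the parabolic boundary are nonpositive. -/
theorem nonpos_of_nonpos_frontier (hp : 1 < p) (hΩ : IsOpen Ω) {M : ℝ}
    (hM : ∀ x ∈ Ω, ∀ t, 0 < t → v x t ≤ M)
    (hc : ∀ x ∈ closure Ω, ∀ t : ℝ, 0 ≤ t → ¬(x ∈ frontier Ω ∧ t = 0) →
      ContinuousWithinAt (fun q : E × ℝ => v q.1 q.2) (closure Ω ×ˢ Ici 0) (x, t))
    (hj : ∀ x ∈ Ω, ∀ t, 0 < t → IsJetSub p v x t) (h0 : ∀ x ∈ Ω, v x 0 ≤ 0)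
    (hb : ∀ y ∈ frontier Ω, ∀ t, 0 < t → v y t ≤ 0) : ∀ x ∈ Ω, ∀ t, 0 < t → v x t ≤ 0 := by
  have hW : IsNullSubsolution p (truncation Ω v) := by
    refine ⟨fun x t _ => truncation_nonneg x t, fun x t ht => ?_, fun x t ht =>
      isJetSub_truncation hp hΩ fun hx => hj x hx t ht, fun x => ?_⟩
    · by_cases hx : x ∈ Ω
      · have h1 : ContinuousAt (fun q : E × ℝ => v q.1 q.2) (x, t) :=
          (hc x (subset_closure hx) t ht.le (fun h => ht.ne' h.2)).continuousAt
            (prod_mem_nhds (Filter.mem_of_superset (hΩ.mem_nhds hx) subset_closure)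
              (Ici_mem_nhds ht))
        have h2 : ContinuousAt (fun q : E × ℝ => max (v q.1 q.2) 0) (x, t) :=
          h1.max continuousAt_const
        exact h2.congr_of_eventuallyEq (eventually_truncation_eq hΩ hx)
      · have h1 : truncation Ω v x t = 0 := if_neg hx
        have h2 : Tendsto (fun q : E × ℝ => truncation Ω v q.1 q.2) (𝓝 (x, t)) (𝓝 0) := by
          refine tendsto_order.2 ⟨fun a ha => Eventually.of_forall fun q => ?_, fun a ha => ?_⟩
          · exact ha.trans_le (truncation_nonneg _ _)
          have h2 := eventually_truncation_lt (v := v) (t := t) ha (x := x) (Ω := Ω)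
            fun hx' => ⟨hb x ⟨hx', by rwa [hΩ.interior_eq]⟩ t ht,
              hc x hx' t ht.le fun h => ht.ne' h.2⟩
          filter_upwards [h2, (continuous_snd.tendsto (x, t)).eventually_const_lt ht] with q h3 h4
          exact h3 h4
        rw [ContinuousAt]
        simpa only [h1] using h2
    · by_cases hx : x ∈ Ω
      · right
        refine tendsto_order.2 ⟨fun a ha => Eventually.of_forall fun q => ?_, fun a ha => ?_⟩
        · exact ha.trans_le (truncation_nonneg _ _)
        · have h2 := eventually_truncation_lt (v := v) (t := 0) ha (x := x) (Ω := Ω)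
            fun hx' => ⟨h0 x hx, hc x hx' 0 le_rfl fun h => h.1.2 (by rwa [hΩ.interior_eq])⟩
          have h3 : 𝓝 x ×ˢ 𝓝[>] (0 : ℝ) ≤ 𝓝 (x, 0) := by
            rw [nhds_prod_eq]
            exact Filter.prod_mono le_rfl nhdsWithin_le_nhds
          have h4 : ∀ᶠ q : E × ℝ in 𝓝 x ×ˢ 𝓝[>] (0 : ℝ), 0 < q.2 :=
            tendsto_snd.eventually self_mem_nhdsWithin
          filter_upwards [h3 h2, h4] with q h5 h6
          exact h5 h6
      · exact Or.inl fun t _ => if_neg hx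
  intro x hx t ht
  have h1 := hW.eq_zero hp (M := max M 0) (fun x t ht => by
    unfold truncation
    split_ifs with hx
    exacts [max_le_max (hM x hx t ht) le_rfl, le_max_right _ _]) x ht
  rw [truncation, if_pos hx] at h1
  exact (le_max_left _ _).trans h1.le

end PositivePart

section Barrier

variable {N : ℕ} {p : ℝ} {Ω : Set (EuclideanSpace ℝ (Fin N))}
  {u : EuclideanSpace ℝ (Fin N) → ℝ → ℝ}

theorem IsSolP.le_one [NeZero N] (hp : 1 < p) (hΩ : IsOpen Ω) (hu : IsSolP p Ω u) :
    ∀ x ∈ closure Ω, ∀ t, 0 < t → u x t ≤ 1 := by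
  obtain ⟨⟨M, hM⟩, hc, hv, h0, hb⟩ := hu
  have h := nonpos_of_nonpos_frontier (v := fun x t => u x t + (-1)) hp hΩ (M := M + (-1))
    (fun x hx t ht => by
      have := (le_abs_self _).trans (hM x (subset_closure hx) t ht.le)
      linarith)
    (fun x hx t ht hne => (hc x hx t ht hne).add continuousWithinAt_const)
    (fun x hx t ht => (hv.isJetSub hp hx ht).add_const (-1))
    (fun x hx => by rw [h0 x hx]; norm_num) (fun y hy t ht => by rw [hb y hy t ht]; norm_num)
  intro x hx t ht
  rw [closure_eq_self_union_frontier] at hx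
  rcases hx with hx | hx
  · linarith [h x hx t ht]
  · exact (hb x hx t ht).le

theorem IsSolP.nonneg [NeZero N] (hp : 1 < p) (hΩ : IsOpen Ω) (hu : IsSolP p Ω u) :
    ∀ x ∈ closure Ω, ∀ t, 0 < t → 0 ≤ u x t := by
  obtain ⟨⟨M, hM⟩, hc, hv, h0, hb⟩ := hu
  have h := nonpos_of_nonpos_frontier (v := fun x t => -u x t) hp hΩ (M := M)
    (fun x hx t ht => (neg_le_abs _).trans (hM x (subset_closure hx) t ht.le))
    (fun x hx t ht hne => (hc x hx t ht hne).neg)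
    (fun x hx t ht => hv.isJetSub_neg hp hx ht)
    (fun x hx => by rw [h0 x hx]; norm_num) (fun y hy t ht => by rw [hb y hy t ht]; norm_num)
  intro x hx t ht
  rw [closure_eq_self_union_frontier] at hx
  rcases hx with hx | hx
  · linarith [h x hx t ht]
  · rw [hb x hx t ht]; exact zero_le_one

theorem ball_infDist_frontier_subset {E : Type*} [NormedAddCommGroup E] [NormedSpace ℝ E]
    {Ω : Set E} (hΩ : IsOpen Ω) {x : E} (hx : x ∈ Ω) :
    ball x (infDist x (frontier Ω)) ⊆ Ω := by
  rcases (ball x (infDist x (frontier Ω))).eq_empty_or_nonempty with h | h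
  · rw [h]; exact empty_subset _
  have hdisj : Disjoint (frontier Ω) (ball x (infDist x (frontier Ω))) := by
    refine Set.disjoint_left.2 fun y hy hyb => ?_
    have := infDist_le_dist_of_mem (x := x) hy
    rw [mem_ball, dist_comm] at hyb
    linarith
  have hconn : IsPreconnected (ball x (infDist x (frontier Ω))) :=
    (convex_ball _ _).isPreconnected
  refine hconn.subset_left_of_subset_union hΩ isClosed_closure.isOpen_compl
    (disjoint_compl_right.mono_left subset_closure) (fun y hy => ?_)
    ⟨x, mem_ball_self (nonempty_ball.1 h), hx⟩
  by_cases hyc : y ∈ closure Ω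
  · rw [closure_eq_self_union_frontier] at hyc
    exact Or.inl (hyc.resolve_right fun hf => disjoint_left.1 hdisj hf hy)
  · exact Or.inr hyc

theorem IsSolP.le_ball_of_pos [NeZero N] (hp : 1 < p) (hΩ : IsOpen Ω) (hu : IsSolP p Ω u)
    {uB : EuclideanSpace ℝ (Fin N) → ℝ → ℝ} (huB : IsSolP p (ball 0 1) uB)
    {x₀ : EuclideanSpace ℝ (Fin N)} {R : ℝ} (hR : 0 < R) (hsub : ball x₀ R ⊆ Ω) {h s : ℝ}
    (hh : 0 < h) (hs : 0 < s) : u x₀ (R ^ 2 * s) ≤ uB 0 (h + s) := by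
  have hBc : closure (ball (0 : EuclideanSpace ℝ (Fin N)) 1) = closedBall 0 1 :=
    closure_ball _ one_ne_zero
  have hBf : frontier (ball (0 : EuclideanSpace ℝ (Fin N)) 1) = sphere 0 1 :=
    frontier_ball _ one_ne_zero
  have hmem : ∀ x : EuclideanSpace ℝ (Fin N), ‖x‖ < 1 → x₀ + R • x ∈ Ω := fun x hx => hsub (by
    rw [mem_ball, dist_eq_norm, add_sub_cancel_left, norm_smul, Real.norm_of_nonneg hR.le]
    nlinarith)
  have hmem' : ∀ x : EuclideanSpace ℝ (Fin N), ‖x‖ ≤ 1 → x₀ + R • x ∈ closure Ω := fun x hx => by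
    refine closure_mono hsub ?_
    rw [closure_ball _ hR.ne', mem_closedBall, dist_eq_norm, add_sub_cancel_left, norm_smul,
      Real.norm_of_nonneg hR.le]
    nlinarith
  have hle1 := hu.le_one hp hΩ
  have hBnn := huB.nonneg hp isOpen_ball
  obtain ⟨-, hc, hv, h0, hb⟩ := hu
  obtain ⟨-, hBcont, hBv, hB0, hBb⟩ := huB
  rw [hBc] at hBcont hBnn
  rw [hBf] at hBcont hBb
  have key := le_of_isJetSub_ball (U := fun x t => u (x₀ + R • x) (0 + R ^ 2 * t))
    (V := fun x t => uB x (h + t)) hp ?_ ?_ ?_ ?_ ?_ ?_ ?_ ?_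
    (x := (0 : EuclideanSpace ℝ (Fin N))) (t := s) (by simp) hs
  · simpa using key
  · intro x t hx ht
    have h1 : ContinuousWithinAt
        (fun q : EuclideanSpace ℝ (Fin N) × ℝ => (x₀ + R • q.1, 0 + R ^ 2 * q.2))
        (closedBall 0 1 ×ˢ Ici 0) (x, t) := by fun_prop
    refine ContinuousWithinAt.comp (x := (x, t))
      (g := fun q : EuclideanSpace ℝ (Fin N) × ℝ => u q.1 q.2)
      (hc (x₀ + R • x) (hmem' x hx.le) (0 + R ^ 2 * t) (by positivity)
        fun hf => hf.1.2 (by rw [hΩ.interior_eq]; exact hmem x hx)) h1 ?_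
    rintro ⟨y, r⟩ ⟨hy, hr⟩
    have hr : 0 ≤ r := hr
    refine ⟨hmem' y (mem_closedBall_zero_iff.1 hy), ?_⟩
    simp only [mem_Ici]
    positivity
  · intro x t hx ht
    have h1 : ContinuousWithinAt
        (fun q : EuclideanSpace ℝ (Fin N) × ℝ => (q.1, h + q.2))
        (closedBall 0 1 ×ˢ Ici 0) (x, t) := by fun_prop
    refine ContinuousWithinAt.comp (x := (x, t))
      (g := fun q : EuclideanSpace ℝ (Fin N) × ℝ => uB q.1 q.2)
      (hBcont x (mem_closedBall_zero_iff.2 hx) (h + t) (by positivity)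
        fun hf => by linarith [hf.2]) h1 ?_
    rintro ⟨y, r⟩ ⟨hy, hr⟩
    have hr : 0 ≤ r := hr
    refine ⟨hy, ?_⟩
    simp only [mem_Ici]
    positivity
  · exact fun x t hx ht => hle1 _ (hmem' x hx) _ (by positivity)
  · intro x hx
    simp only [mul_zero, add_zero]
    exact (h0 _ (hmem x hx)).le
  · exact fun x t hx ht => hBnn x (mem_closedBall_zero_iff.2 hx) _ (by positivity)
  · exact fun x t hx ht => hBb x (mem_sphere_zero_iff_norm.2 hx) _ (by positivity)
  · exact fun x t hx ht => IsJetSub.comp_scale hR (hv.isJetSub hp (hmem x hx) (by positivity))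
  · intro x t hx ht
    have := IsJetSub.comp_scale (x₀ := (0 : EuclideanSpace ℝ (Fin N))) (h := h) (t := t) (x := x)
      one_pos (by simpa using hBv.isJetSub_neg hp (mem_ball_zero_iff.2 hx) (by positivity))
    simpa using this

theorem IsSolP.le_ball [NeZero N] (hp : 1 < p) (hΩ : IsOpen Ω) (hu : IsSolP p Ω u)
    {uB : EuclideanSpace ℝ (Fin N) → ℝ → ℝ} (huB : IsSolP p (ball 0 1) uB)
    {x₀ : EuclideanSpace ℝ (Fin N)} {R : ℝ} (hR : 0 < R) (hsub : ball x₀ R ⊆ Ω) {s : ℝ}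
    (hs : 0 < s) : u x₀ (R ^ 2 * s) ≤ uB 0 s := by
  have h1 : Tendsto (fun h : ℝ => uB 0 (h + s)) (𝓝[>] 0) (𝓝 (uB 0 s)) := by
    have h2 : Tendsto (fun h : ℝ => ((0 : EuclideanSpace ℝ (Fin N)), h + s)) (𝓝[>] 0)
        (𝓝[ball 0 1 ×ˢ Ioi 0] (0, s)) := by
      refine tendsto_nhdsWithin_iff.2 ⟨?_, ?_⟩
      · have : Continuous fun h : ℝ => ((0 : EuclideanSpace ℝ (Fin N)), h + s) := by fun_prop
        have := this.tendsto 0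
        rw [zero_add] at this
        exact this.mono_left nhdsWithin_le_nhds
      · filter_upwards [self_mem_nhdsWithin] with h hh
        exact ⟨mem_ball_self one_pos, add_pos hh hs⟩
    exact (huB.2.2.1.1 (0, s) ⟨mem_ball_self one_pos, hs⟩).tendsto.comp h2
  refine ge_of_tendsto h1 ?_
  filter_upwards [self_mem_nhdsWithin] with h hh
  exact hu.le_ball_of_pos hp hΩ huB hR hsub hh hs

end Barrier

/-- the barrier from above: `u(x,t) ≤ u_B(0, t/d_Γ(x)²)` for `x ∈ Ω`, `t > 0`,
where `u_B` solves problem (P) in the unit ball. -/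
theorem stmt8 (N : ℕ) (hN : 2 ≤ N) (p : ℝ) (hp : 1 < p)
    (Ω : Set (EuclideanSpace ℝ (Fin N))) (hΩo : IsOpen Ω) (hΩc : IsConnected Ω)
    (hΓ : (frontier Ω).Nonempty)
    (u : EuclideanSpace ℝ (Fin N) → ℝ → ℝ) (hu : IsSolP p Ω u)
    (uB : EuclideanSpace ℝ (Fin N) → ℝ → ℝ)
    (huB : IsSolP p (Metric.ball (0 : EuclideanSpace ℝ (Fin N)) 1) uB) :
    ∀ x ∈ Ω, ∀ t : ℝ, 0 < t →
      u x t ≤ uB 0 (t / (Metric.infDist x (frontier Ω))^2) := by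
  have : NeZero N := ⟨by omega⟩
  intro x hx t ht
  have hR : 0 < infDist x (frontier Ω) := (isClosed_frontier.notMem_iff_infDist_pos hΓ).1
    fun h => h.2 (by rwa [hΩo.interior_eq])
  have h := hu.le_ball hp hΩo huB hR (ball_infDist_frontier_subset hΩo hx)
    (div_pos ht (pow_pos hR 2))
  rwa [mul_div_cancel₀ _ (pow_pos hR 2).ne'] at h

end
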